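/- Let B ⊂ ℝ^d be a closed Euclidean ball, let π_1,…,π_m be real-analytic on a connected open set U ⊇ B, and let D ⊆ B be semi-analytic. Let G be a nontrivial d-tree on m indices (G ∈ 𝒢_K for some K). Then there exists a finite constant C such that for all ε_1,…,ε_{m−1} > 0, all λ ∈ ℝ with λ ≠ 0, and every c > 0 with |∂^Gπ(x)| ≥ c for all x ∈ E_ε ∩ D, where E_ε := {x ∈ B : |π_j(x)| ≤ ε_j for j = 1,…,m−1}, one has |∫_{E_ε ∩ D} e^{iλπ_m(x)} dx| ≤ C · c^{−1/#G} · |λ|^{−G^{(m)}/#G} · Π_{j=1}^{m−1} ε_j^{G^{(j)}/#G}. -/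

import Mathlib

open MeasureTheory
open scoped ENNReal

/-- A `d`-tree on `m` indices: an element of `⋃ K, 𝒢_K` where `𝒢_0 = {1,…,m}` and
`𝒢_K = 𝒢_{K-1} ∪ (𝒢_{K-1})^d`. -/
inductive DTree (d m : ℕ) : Type
  | leaf : Fin m → DTree d m
  | node : (Fin d → DTree d m) → DTree d m

namespace DTree
variable {d m : ℕ}

/-- `#G`: `0` for a trivial tree, `#G_1 + ⋯ + #G_d + 1` for `G = (G_1,…,G_d)`. -/
noncomputable def count : DTree d m → ℕ :=
  DTree.rec (motive := fun _ => ℕ) (fun _ => 0) (fun _ ih => (∑ k, ih k) + 1)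

/-- `G^{(j)}`: the number of leaves of `G` carrying the index `j`. -/
noncomputable def mult (j : Fin m) : DTree d m → ℕ :=
  DTree.rec (motive := fun _ => ℕ) (fun i => if i = j then 1 else 0) (fun _ ih => ∑ k, ih k)

/-- The depth of a `d`-tree; `G ∈ 𝒢_K` if and only if `G.depth ≤ K`. -/
noncomputable def depth : DTree d m → ℕ :=
  DTree.rec (motive := fun _ => ℕ) (fun _ => 0) (fun _ ih => (Finset.univ.sup ih) + 1)

/-- The derived function `∂^G π`: `π_i` for the trivial tree `i`, and the Jacobian
determinant `det [∂_{x_r} (∂^{G_k} π)]` for `G = (G_1,…,G_d)`. -/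
noncomputable def deriv (π : Fin m → (Fin d → ℝ) → ℝ) : DTree d m → (Fin d → ℝ) → ℝ :=
  DTree.rec (motive := fun _ => (Fin d → ℝ) → ℝ) (fun i => π i)
    (fun _ ih x => (Matrix.of fun r k : Fin d => fderiv ℝ (ih k) x (Pi.single r 1)).det)

/-- A `d`-tree is nontrivial when it is not a single leaf. -/
def Nontrivial (G : DTree d m) : Prop := ∀ i, G ≠ DTree.leaf i

end DTree

/-- `D` is semi-analytic relative to the open set `U`: a finite union of sets defined by
finitely many real-analytic equations and strict inequalities. -/
def IsSemianalytic {d : ℕ} (U : Set (Fin d → ℝ)) (D : Set (Fin d → ℝ)) : Prop :=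
  ∃ (n : ℕ) (k l : Fin n → ℕ)
    (f : (i : Fin n) → Fin (k i) → (Fin d → ℝ) → ℝ)
    (g : (i : Fin n) → Fin (l i) → (Fin d → ℝ) → ℝ),
      (∀ i j, AnalyticOnNhd ℝ (f i j) U) ∧ (∀ i j, AnalyticOnNhd ℝ (g i j) U) ∧
      D = ⋃ i, {x ∈ U | (∀ j, f i j x = 0) ∧ ∀ j, 0 < g i j x}

section

open Filter Topology Metric MeasureTheory
open scoped ENNReal NNReal

/-- Evaluation of a convergent power series at elements of a Banach algebra. -/
theorem exists_analytic_extension_algebra {ι : Type} [Fintype ι] [DecidableEq ι]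
    {Y A Z Z' : Type} [NormedAddCommGroup Y] [NormedSpace ℝ Y] [NormedRing A] [NormedAlgebra ℝ A]
    [NormedAddCommGroup Z] [NormedSpace ℝ Z] [CompleteSpace Z]
    [NormedAddCommGroup Z'] [NormedSpace ℝ Z'] (J : Y →L[ℝ] A →L[ℝ] Z)
    {f : (ι → ℝ) → Y} (hf : AnalyticAt ℝ f 0) :
    ∃ F : (ι → A) → Z, ∃ ρ > 0, AnalyticOnNhd ℝ F (ball 0 ρ) ∧
      ∀ (e : Z →L[ℝ] Z') (T : Y →L[ℝ] Z') (x : ι → ℝ) (X : ι → A), ‖x‖ < ρ → ‖X‖ < ρ →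
        (∀ (m : ℕ) (c : Fin m → ι) (y : Y),
          e (J y (List.ofFn fun j => X (c j)).prod) = (∏ j, x (c j)) • T y) →
        e (F X) = T (f x) := by
  obtain ⟨p, r, hp⟩ := hf
  let q : FormalMultilinearSeries ℝ (ι → A) Z := fun m =>
    ∑ c : Fin m → ι, (J (p m fun j => Pi.single (c j) 1)).compContinuousMultilinearMap
      ((ContinuousMultilinearMap.mkPiAlgebraFin ℝ m A).compContinuousLinearMap
        fun j => ContinuousLinearMap.proj (c j))
  obtain ⟨a, ha0, har⟩ := ENNReal.lt_iff_exists_nnreal_btwn.1 hp.r_pos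
  have ha : 0 < a := by exact_mod_cast ha0
  obtain ⟨C, hC, hCp⟩ := p.norm_mul_pow_le_of_lt_radius (har.trans_le hp.r_le)
  set K : ℝ := ‖J‖ * C * max 1 ‖(1 : A)‖
  have hq : ∀ m, ‖q m‖ ≤ K * (Fintype.card ι / a) ^ m := by
    intro m
    have h1 : ∀ c : Fin m → ι, ‖(J (p m fun j => Pi.single (c j) 1)).compContinuousMultilinearMap
      ((ContinuousMultilinearMap.mkPiAlgebraFin ℝ m A).compContinuousLinearMap
        fun j => ContinuousLinearMap.proj (R := ℝ) (φ := fun _ : ι => A) (c j))‖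
          ≤ K * (1 / a) ^ m := by
      intro c
      refine (ContinuousLinearMap.norm_compContinuousMultilinearMap_le _ _).trans ?_
      have h2 : ‖(ContinuousMultilinearMap.mkPiAlgebraFin ℝ m A).compContinuousLinearMap
        fun j => ContinuousLinearMap.proj (R := ℝ) (φ := fun _ : ι => A) (c j)‖ ≤ max 1 ‖(1 : A)‖ := by
        refine (ContinuousMultilinearMap.norm_compContinuousLinearMap_le _ _).trans ?_
        have h3 : ∏ j, ‖ContinuousLinearMap.proj (R := ℝ) (φ := fun _ : ι => A) (c j)‖ ≤ 1 := by
          apply Finset.prod_le_one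
          · intros; positivity
          · intro j _
            refine ContinuousLinearMap.opNorm_le_bound _ zero_le_one fun x => ?_
            rw [one_mul]; exact norm_le_pi_norm x (c j)
        calc _ ≤ max 1 ‖(1 : A)‖ * 1 := by
              gcongr
              exact ContinuousMultilinearMap.norm_mkPiAlgebraFin_le
          _ = _ := mul_one _
      have h4 : ‖p m fun j => Pi.single (c j) (1 : ℝ)‖ ≤ C * (1 / a) ^ m := by
        have h5 := (p m).le_opNorm fun j => Pi.single (c j) (1 : ℝ)
        have h6 : ∏ j, ‖(Pi.single (c j) (1 : ℝ) : ι → ℝ)‖ = 1 := by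
          apply Finset.prod_eq_one
          intro j _
          rw [Pi.norm_single, norm_one]
        rw [h6, mul_one] at h5
        refine h5.trans ?_
        rw [one_div, inv_pow, ← div_eq_mul_inv, le_div_iff₀ (by positivity)]
        exact hCp m
      calc _ ≤ (‖J‖ * (C * (1 / a) ^ m)) * max 1 ‖(1 : A)‖ := by
            gcongr
            exact (J.le_opNorm _).trans (by gcongr)
        _ = _ := by simp only [K]; ring
    have h7 : ‖q m‖ ≤ ∑ c : Fin m → ι, K * (1 / a) ^ m :=
      (norm_sum_le (E := (ι → A) [×m]→L[ℝ] Z) _ _).trans (Finset.sum_le_sum fun c _ => h1 c)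
    refine h7.trans (le_of_eq ?_)
    simp only [Finset.sum_const, Finset.card_univ, Fintype.card_fun, Fintype.card_fin,
      nsmul_eq_mul, Nat.cast_pow]
    rw [div_pow, div_pow]
    ring
  set b : NNReal := a / (Fintype.card ι + 1)
  have hb : 0 < b := by positivity
  have hqr : (b : ENNReal) ≤ q.radius := by
    apply q.le_radius_of_bound K
    intro m
    have : (0 : ℝ) < a := ha
    calc ‖q m‖ * (b : ℝ) ^ m ≤ K * (Fintype.card ι / a) ^ m * (b : ℝ) ^ m := by
          gcongr; exact hq m
      _ = K * (Fintype.card ι / (Fintype.card ι + 1)) ^ m := by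
          rw [mul_assoc, ← mul_pow]
          congr 2
          simp only [b]; push_cast
          field_simp
      _ ≤ K * 1 := by
          gcongr
          apply pow_le_one₀ (by positivity)
          rw [div_le_one (by positivity)]; linarith
      _ = K := mul_one _
  have hba : (b : ℝ) ≤ a := by
    simp only [b]; push_cast
    apply div_le_self (by positivity)
    linarith [Nat.cast_nonneg (α := ℝ) (Fintype.card ι)]
  have hqs := q.hasFPowerSeriesOnBall (lt_of_lt_of_le (by exact_mod_cast hb) hqr)
  refine ⟨q.sum, b, by exact_mod_cast hb, ?_, ?_⟩
  · intro X hX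
    apply hqs.analyticAt_of_mem
    rw [Metric.mem_ball, dist_zero_right] at hX
    rw [Metric.mem_eball, edist_zero_right]
    refine lt_of_lt_of_le ?_ hqr
    rw [← ofReal_norm, ← ENNReal.ofReal_coe_nnreal]
    exact (ENNReal.ofReal_lt_ofReal_iff (by exact_mod_cast hb)).2 hX
  · intro e T x X hx hX h
    have hS1 := hqs.hasSum (y := X) (by
      rw [Metric.mem_eball, edist_zero_right]
      refine lt_of_lt_of_le ?_ hqr
      rw [← ofReal_norm, ← ENNReal.ofReal_coe_nnreal]
      exact (ENNReal.ofReal_lt_ofReal_iff (by exact_mod_cast hb)).2 hX)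
    have hS2 := hp.hasSum (y := x) (by
      rw [Metric.mem_eball, edist_zero_right]
      refine lt_trans ?_ har
      rw [← ofReal_norm, ← ENNReal.ofReal_coe_nnreal]
      exact (ENNReal.ofReal_lt_ofReal_iff (by exact_mod_cast ha)).2 (hx.trans_le hba))
    rw [zero_add] at hS1 hS2
    have hS1' := e.hasSum hS1
    have hS2' := T.hasSum hS2
    refine hS1'.unique ?_
    convert hS2' using 2 with m
    change e (q m fun _ => X) = T (p m fun _ => x)
    have hxs : x = ∑ i, x i • (Pi.single i (1 : ℝ) : ι → ℝ) := by
      ext i; simp [Finset.sum_apply, Pi.single_apply]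
    conv_rhs => rw [hxs]
    rw [ContinuousMultilinearMap.map_sum]
    simp only [q, sum_apply,
      ContinuousLinearMap.compContinuousMultilinearMap_coe, Function.comp_apply,
      ContinuousMultilinearMap.compContinuousLinearMap_apply,
      ContinuousMultilinearMap.mkPiAlgebraFin_apply, ContinuousLinearMap.proj_apply, map_sum]
    refine Finset.sum_congr rfl fun c _ => ?_
    rw [h m c, ContinuousMultilinearMap.map_smul_univ, map_smul]

/-- Coefficient sequences of power series in one variable. -/
abbrev CoeffSpace (Y : Type) [NormedAddCommGroup Y] := BoundedContinuousFunction ℕ Y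

namespace CoeffSpace

variable (Y : Type) [NormedAddCommGroup Y] [NormedSpace ℝ Y]

/-- The constant coefficient. -/
noncomputable def coeffZero : CoeffSpace Y →L[ℝ] Y :=
  LinearMap.mkContinuous
    { toFun := fun v => v 0
      map_add' := fun _ _ => rfl
      map_smul' := fun _ _ => rfl } 1 fun v => by
        rw [one_mul]; exact v.norm_coe_le_norm 0

/-- Constant power series. -/
noncomputable def const : Y →L[ℝ] CoeffSpace Y :=
  LinearMap.mkContinuous
    { toFun := fun y => BoundedContinuousFunction.ofNormedAddCommGroupDiscrete
        (fun n => if n = 0 then y else 0) ‖y‖ (fun n => by split_ifs <;> simp)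
      map_add' := fun a b => by ext n; simp; split_ifs <;> simp
      map_smul' := fun a b => by ext n; simp } 1 fun v => by
        rw [one_mul]
        exact (BoundedContinuousFunction.norm_le (norm_nonneg _)).2
          fun n => by simp; split_ifs <;> simp

/-- Division by the variable, dropping the constant coefficient. -/
noncomputable def left : CoeffSpace Y →L[ℝ] CoeffSpace Y :=
  LinearMap.mkContinuous
    { toFun := fun v => BoundedContinuousFunction.ofNormedAddCommGroupDiscrete
        (fun n => v (n + 1)) ‖v‖ (fun n => v.norm_coe_le_norm _)
      map_add' := fun a b => by ext n; simp
      map_smul' := fun a b => by ext n; simp } 1 fun v => by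
        rw [one_mul]
        exact (BoundedContinuousFunction.norm_le (norm_nonneg _)).2
          fun n => v.norm_coe_le_norm _

/-- Multiplication by the variable. -/
noncomputable def right : CoeffSpace Y →L[ℝ] CoeffSpace Y :=
  LinearMap.mkContinuous
    { toFun := fun v => BoundedContinuousFunction.ofNormedAddCommGroupDiscrete
        (fun n => if n = 0 then 0 else v (n - 1)) ‖v‖
        (fun n => by split_ifs <;> simp [v.norm_coe_le_norm])
      map_add' := fun a b => by ext n; simp; split_ifs <;> simp
      map_smul' := fun a b => by ext n; simp } 1 fun v => by
        rw [one_mul]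
        exact (BoundedContinuousFunction.norm_le (norm_nonneg _)).2
          fun n => by simp; split_ifs <;> simp [v.norm_coe_le_norm]

variable {Y}

@[simp] theorem coeffZero_apply (v : CoeffSpace Y) : coeffZero Y v = v 0 := rfl
@[simp] theorem const_apply (y : Y) (n : ℕ) : const Y y n = if n = 0 then y else 0 := rfl
@[simp] theorem left_apply (v : CoeffSpace Y) (n : ℕ) : left Y v n = v (n + 1) := rfl
@[simp] theorem right_apply (v : CoeffSpace Y) (n : ℕ) :
    right Y v n = if n = 0 then 0 else v (n - 1) := rfl

theorem norm_right_le : ‖right Y‖ ≤ 1 := LinearMap.mkContinuous_norm_le _ zero_le_one _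
theorem norm_left_le : ‖left Y‖ ≤ 1 := LinearMap.mkContinuous_norm_le _ zero_le_one _

theorem left_right (v : CoeffSpace Y) : left Y (right Y v) = v := by ext; simp
theorem left_const (y : Y) : left Y (const Y y) = 0 := by ext; simp

theorem right_left (v : CoeffSpace Y) : right Y (left Y v) + const Y (v 0) = v := by
  ext n; cases n <;> simp

/-- A power series is recovered from its first `k` coefficients and its `k`-th tail. -/
theorem iterate_right_left (k : ℕ) (v : CoeffSpace Y) :
    (right Y ^ k) ((left Y ^ k) v) +
      ∑ i : Fin k, (right Y ^ (i : ℕ)) (const Y (((left Y ^ (i : ℕ)) v) 0)) = v := by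
  induction k with
  | zero => simp
  | succ k ih =>
    conv_rhs => rw [← ih]
    rw [Fin.sum_univ_castSucc]
    simp only [Fin.val_last, Fin.val_castSucc]
    rw [add_comm (∑ i : Fin k, _), ← add_assoc]
    congr 1
    rw [pow_succ, pow_succ' (left Y), mul_apply_eq_comp,
      mul_apply_eq_comp, ← map_add, right_left]

theorem left_pow_apply (k : ℕ) (v : CoeffSpace Y) (n : ℕ) : (left Y ^ k) v n = v (n + k) := by
  induction k generalizing n with
  | zero => simp
  | succ k ih =>
    rw [pow_succ', mul_apply_eq_comp, left_apply, ih]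
    congr 1; ring

variable [CompleteSpace Y]

/-- The sum of the power series with given coefficients. -/
noncomputable def eval (w : ℝ) : CoeffSpace Y →L[ℝ] Y :=
  (coeffZero Y).comp (Ring.inverse (1 - w • left Y))

theorem analyticAt_eval : AnalyticAt ℝ (fun w => eval (Y := Y) w) 0 := by
  have h1 : AnalyticAt ℝ (fun w : ℝ => Ring.inverse (1 - w • left Y)) 0 := by
    have h := analyticAt_inverse_one_sub ℝ (CoeffSpace Y →L[ℝ] CoeffSpace Y)
    have h2 : AnalyticAt ℝ (fun w : ℝ => w • left Y) 0 := by fun_prop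
    refine AnalyticAt.fun_comp (g := fun x => Ring.inverse (1 - x)) ?_ h2
    simpa using h
  exact ((ContinuousLinearMap.compL ℝ _ _ _ (coeffZero Y)).analyticAt _).fun_comp h1

theorem eval_sub {w : ℝ} (hw : |w| < 1) (v : CoeffSpace Y) : eval w (v - w • left Y v) = v 0 := by
  have hu : IsUnit (1 - w • left Y) := by
    apply isUnit_one_sub_of_norm_lt_one
    rw [norm_smul, Real.norm_eq_abs]
    exact (mul_le_of_le_one_right (abs_nonneg w) norm_left_le).trans_lt hw
  have h := Ring.inverse_mul_cancel _ hu
  have h2 : v - w • left Y v = (1 - w • left Y) v := by simp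
  rw [h2, eval, ContinuousLinearMap.comp_apply, ← mul_apply_eq_comp, h]
  rfl

theorem eval_const {w : ℝ} (hw : |w| < 1) (y : Y) : eval w (const Y y) = y := by
  simpa [left_const] using eval_sub hw (const Y y)

theorem eval_right {w : ℝ} (hw : |w| < 1) (v : CoeffSpace Y) :
    eval w (right Y v) = w • eval w v := by
  have := eval_sub hw (right Y v)
  rw [left_right, map_sub, map_smul] at this
  simpa [sub_eq_zero] using this

theorem eval_right_pow {w : ℝ} (hw : |w| < 1) (k : ℕ) (v : CoeffSpace Y) :
    eval w ((right Y ^ k) v) = w ^ k • eval w v := by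
  induction k with
  | zero => simp
  | succ k ih =>
    rw [pow_succ', mul_apply_eq_comp, eval_right hw, ih, smul_smul, pow_succ']

theorem eval_eq {w : ℝ} (hw : |w| < 1) (v : CoeffSpace Y) :
    eval w v = v 0 + w • eval w (left Y v) := by
  rw [← eval_sub hw v, map_sub, map_smul]; abel

theorem eventually_abs_lt_one : ∀ᶠ w : ℝ in 𝓝 0, |w| < 1 := by
  filter_upwards [Metric.ball_mem_nhds (0 : ℝ) one_pos] with w hw
  simpa using hw

theorem eq_zero_of_eval {v : CoeffSpace Y} (h : ∀ᶠ w in 𝓝 (0 : ℝ), eval w v = 0) : v = 0 := by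
  have key : ∀ v : CoeffSpace Y, (∀ᶠ w in 𝓝 (0 : ℝ), eval w v = 0) →
      v 0 = 0 ∧ ∀ᶠ w in 𝓝 (0 : ℝ), eval w (left Y v) = 0 := by
    intro v h
    have h0 : v 0 = 0 := by
      have := h.self_of_nhds
      rw [eval_eq (by simp)] at this
      simpa using this
    refine ⟨h0, ?_⟩
    have h1 : ∀ᶠ w in 𝓝[≠] (0 : ℝ), eval w (left Y v) = 0 := by
      filter_upwards [h.filter_mono nhdsWithin_le_nhds, self_mem_nhdsWithin,
        eventually_abs_lt_one.filter_mono nhdsWithin_le_nhds] with w hw hw0 hw1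
      rw [eval_eq hw1, h0, zero_add] at hw
      exact (smul_eq_zero.1 hw).resolve_left hw0
    have ha : AnalyticAt ℝ (fun w => eval w (left Y v)) 0 :=
      ((ContinuousLinearMap.apply ℝ Y (left Y v)).analyticAt _).fun_comp analyticAt_eval
    exact (ha.frequently_zero_iff_eventually_zero).1 h1.frequently
  have key2 : ∀ n, ∀ᶠ w in 𝓝 (0 : ℝ), eval w ((left Y ^ n) v) = 0 := by
    intro n
    induction n with
    | zero => simpa using h
    | succ n ih => rw [pow_succ']; exact (key _ ih).2
  ext n
  have := (key _ (key2 n)).1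
  rwa [left_pow_apply, zero_add] at this

end CoeffSpace

namespace CoeffSpace

theorem eval_list_prod {Y ι : Type} [NormedAddCommGroup Y] [NormedSpace ℝ Y] [CompleteSpace Y]
    {w : ℝ} {x : ι → ℝ} {X : ι → CoeffSpace Y →L[ℝ] CoeffSpace Y}
    (h : ∀ i v, eval w (X i v) = x i • eval w v) (m : ℕ) (c : Fin m → ι) (v : CoeffSpace Y) :
    eval w ((List.ofFn fun j => X (c j)).prod v) = (∏ j, x (c j)) • eval w v := by
  induction m with
  | zero => simp
  | succ m ih =>
    rw [List.ofFn_succ, List.prod_cons, mul_apply_eq_comp, h, ih, Fin.prod_univ_succ, smul_smul]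

variable {E Y : Type} [NormedAddCommGroup E] [NormedSpace ℝ E] [FiniteDimensional ℝ E]
  [NormedAddCommGroup Y] [NormedSpace ℝ Y] [CompleteSpace Y]

theorem exists_operator_substitution (Y' Z : Type) [NormedAddCommGroup Y'] [NormedSpace ℝ Y']
    [NormedAddCommGroup Z] [NormedSpace ℝ Z] [CompleteSpace Z]
    (J : Y' →L[ℝ] (CoeffSpace Y →L[ℝ] CoeffSpace Y) →L[ℝ] Z)
    {f : E × ℝ → Y'} (hf : AnalyticAt ℝ f 0) :
    ∀ᶠ r in 𝓝[>] (0 : ℝ), ∃ F : E → Z, AnalyticAt ℝ F 0 ∧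
      ∀ᶠ p : E × ℝ in 𝓝 0, ∀ (e : Z →L[ℝ] Y) (T : Y' →L[ℝ] Y),
        (∀ (a : ℝ) y (A : CoeffSpace Y →L[ℝ] CoeffSpace Y),
          (∀ v, eval p.2 (A v) = a • eval p.2 v) → e (J y A) = a • T y) →
        e (F p.1) = T (f (p.1, r * p.2)) := by
  let φ := (Module.finBasis ℝ (E × ℝ)).equivFunL
  have hf' : AnalyticAt ℝ (fun x => f (φ.symm x)) 0 := by
    apply AnalyticAt.fun_comp (g := f)
    · simpa using hf
    · exact φ.symm.toContinuousLinearMap.analyticAt 0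
  obtain ⟨F, ρ, hρ, hF, hFe⟩ := exists_analytic_extension_algebra (Z' := Y) J hf'
  have hr : ∀ᶠ r in 𝓝[>] (0 : ℝ), r * ‖φ (0, 1)‖ < ρ := by
    have : Tendsto (fun r : ℝ => r * ‖φ (0, 1)‖) (𝓝 0) (𝓝 (0 * ‖φ (0, 1)‖)) := by
      apply Continuous.tendsto'; fun_prop; rfl
    rw [zero_mul] at this
    exact (this.eventually_lt_const hρ).filter_mono nhdsWithin_le_nhds
  filter_upwards [hr, self_mem_nhdsWithin] with r hr hr0
  have hr0 : 0 < r := hr0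
  let X : E → _ → CoeffSpace Y →L[ℝ] CoeffSpace Y := fun t i =>
    (φ (t, 0) i) • (1 : CoeffSpace Y →L[ℝ] CoeffSpace Y) + (r * φ (0, 1) i) • right Y
  have hXa : AnalyticAt ℝ X 0 := by
    apply AnalyticAt.pi
    intro i
    apply AnalyticAt.fun_add _ analyticAt_const
    apply AnalyticAt.fun_smul _ analyticAt_const
    exact (((ContinuousLinearMap.proj (R := ℝ) (φ := fun _ => ℝ) i).comp
      (φ.toContinuousLinearMap.comp (ContinuousLinearMap.inl ℝ E ℝ))).analyticAt 0)
  have hX0 : ‖X 0‖ < ρ := by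
    refine (pi_norm_lt_iff hρ).2 fun i => ?_
    have : X 0 i = (r * φ (0, 1) i) • right Y := by
      simp [X, show ((0 : E), (0 : ℝ)) = 0 from rfl]
    rw [this, norm_smul, norm_mul, Real.norm_of_nonneg hr0.le]
    calc _ ≤ r * ‖φ (0, 1)‖ * 1 := by
          gcongr
          · exact norm_le_pi_norm (φ (0, 1)) i
          · exact norm_right_le
      _ < ρ := by rwa [mul_one]
  refine ⟨fun t => F (X t), ?_, ?_⟩
  · exact AnalyticAt.fun_comp (hF _ (by simpa using hX0)) hXa
  · have h1 : ∀ᶠ p : E × ℝ in 𝓝 0, ‖X p.1‖ < ρ := by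
      have : ContinuousAt (fun p : E × ℝ => ‖X p.1‖) 0 :=
        (ContinuousAt.comp' (g := X) (f := Prod.fst) (x := (0 : E × ℝ)) hXa.continuousAt
          continuousAt_fst).norm
      exact this.eventually_lt_const hX0
    have h2 : ∀ᶠ p : E × ℝ in 𝓝 0, ‖φ (p.1, r * p.2)‖ < ρ := by
      have : Continuous fun p : E × ℝ => ‖φ (p.1, r * p.2)‖ := by fun_prop
      apply this.continuousAt.eventually_lt_const
      simpa [show ((0 : E), (0 : ℝ)) = 0 from rfl] using hρ
    have h3 : ∀ᶠ p : E × ℝ in 𝓝 0, |p.2| < 1 :=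
      (continuous_snd.tendsto (0 : E × ℝ)).eventually eventually_abs_lt_one
    filter_upwards [h1, h2, h3] with p h1 h2 h3 e T he
    have := hFe e T _ _ h2 h1 ?_
    · simpa using this
    intro m c y
    apply he
    intro v
    apply eval_list_prod
    intro i v
    have : φ (p.1, r * p.2) i = φ (p.1, 0) i + r * p.2 * φ (0, 1) i := by
      have : (p.1, r * p.2) = (p.1, (0 : ℝ)) + (r * p.2) • ((0 : E), (1 : ℝ)) := by simp
      rw [this, map_add, map_smul]
      rfl
    rw [this]
    simp only [X, add_apply, smul_apply, one_apply_eq_self, map_add, map_smul, eval_right h3,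
      add_smul, smul_smul]
    congr 2; ring

/-- Expansion of an analytic function in its last variable. -/
theorem exists_coeff {f : E × ℝ → Y} (hf : AnalyticAt ℝ f 0) :
    ∀ᶠ r in 𝓝[>] (0 : ℝ), ∃ F : E → CoeffSpace Y, AnalyticAt ℝ F 0 ∧
      ∀ᶠ p : E × ℝ in 𝓝 0, f (p.1, r * p.2) = eval p.2 (F p.1) := by
  let J : Y →L[ℝ] (CoeffSpace Y →L[ℝ] CoeffSpace Y) →L[ℝ] CoeffSpace Y :=
    (ContinuousLinearMap.apply ℝ (CoeffSpace Y)).comp (const Y)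
  filter_upwards [exists_operator_substitution Y (CoeffSpace Y) J hf] with r ⟨F, hF, h⟩
  refine ⟨F, hF, ?_⟩
  have h3 : ∀ᶠ p : E × ℝ in 𝓝 0, |p.2| < 1 :=
    (continuous_snd.tendsto (0 : E × ℝ)).eventually eventually_abs_lt_one
  filter_upwards [h, h3] with p hp h3
  symm
  refine hp (eval p.2) (ContinuousLinearMap.id ℝ Y) ?_
  intro a y A hA
  change eval p.2 (A (const Y y)) = _
  rw [hA, eval_const h3]; rfl

/-- The operator of multiplication by an analytic function. -/
theorem exists_multiplication {f : E × ℝ → ℝ} (hf : AnalyticAt ℝ f 0) :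
    ∀ᶠ r in 𝓝[>] (0 : ℝ), ∃ F : E → CoeffSpace Y →L[ℝ] CoeffSpace Y, AnalyticAt ℝ F 0 ∧
      ∀ᶠ p : E × ℝ in 𝓝 0, ∀ v, eval p.2 (F p.1 v) = f (p.1, r * p.2) • eval p.2 v := by
  let J : ℝ →L[ℝ] (CoeffSpace Y →L[ℝ] CoeffSpace Y) →L[ℝ] (CoeffSpace Y →L[ℝ] CoeffSpace Y) :=
    ContinuousLinearMap.lsmul ℝ ℝ
  filter_upwards [exists_operator_substitution ℝ _ J hf] with r ⟨F, hF, h⟩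
  refine ⟨F, hF, ?_⟩
  filter_upwards [h] with p hp v
  refine hp ((eval p.2).comp (ContinuousLinearMap.apply ℝ _ v))
    ((ContinuousLinearMap.id ℝ ℝ).smulRight (eval p.2 v)) ?_
  intro a y A hA
  change eval p.2 (y • A v) = a • y • eval p.2 v
  rw [map_smul, hA, smul_comm]

end CoeffSpace

theorem AnalyticAt.clm_apply {E F G : Type} [NormedAddCommGroup E] [NormedSpace ℝ E]
    [NormedAddCommGroup F] [NormedSpace ℝ F] [NormedAddCommGroup G] [NormedSpace ℝ G]
    {A : E → F →L[ℝ] G} {v : E → F} {x : E} (hA : AnalyticAt ℝ A x) (hv : AnalyticAt ℝ v x) :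
    AnalyticAt ℝ (fun t => A t (v t)) x :=
  AnalyticAt.fun_comp (g := fun p : (F →L[ℝ] G) × F => p.1 p.2)
    ((ContinuousLinearMap.id ℝ (F →L[ℝ] G)).analyticAt_bilinear _) (hA.prod hv)

set_option maxHeartbeats 1600000 in
/-- Weierstrass division for real-analytic germs, with Banach space valued dividend. -/
theorem weierstrass_division {E Y : Type} [NormedAddCommGroup E] [NormedSpace ℝ E]
    [FiniteDimensional ℝ E] [NormedAddCommGroup Y] [NormedSpace ℝ Y] [CompleteSpace Y]
    {f : E × ℝ → ℝ} {g : E × ℝ → Y} (hf : AnalyticAt ℝ f 0) (hg : AnalyticAt ℝ g 0) (k : ℕ)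
    {u : ℝ → ℝ} (hu : AnalyticAt ℝ u 0) (hu0 : u 0 ≠ 0)
    (hfu : ∀ᶠ z in 𝓝 (0 : ℝ), f (0, z) = z ^ k * u z) :
    ∃ (Q : E × ℝ → Y) (b : Fin k → E → Y), AnalyticAt ℝ Q 0 ∧ (∀ i, AnalyticAt ℝ (b i) 0) ∧
      ∀ᶠ p : E × ℝ in 𝓝 0, g p = f p • Q p + ∑ i : Fin k, p.2 ^ (i : ℕ) • b i p.1 := by
  open CoeffSpace in
  have hsnd : Tendsto (Prod.snd : E × ℝ → ℝ) (𝓝 0) (𝓝 0) := continuous_snd.tendsto (0 : E × ℝ)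
  have hfst : Tendsto (Prod.fst : E × ℝ → E) (𝓝 0) (𝓝 0) := continuous_fst.tendsto (0 : E × ℝ)
  have hu2 : AnalyticAt ℝ (fun p : E × ℝ => (u p.2)⁻¹) 0 :=
    (AnalyticAt.fun_comp (g := u) (f := Prod.snd) (x := (0 : E × ℝ)) hu analyticAt_snd).inv hu0
  let e : E × ℝ → ℝ := fun p => f p * (u p.2)⁻¹ - p.2 ^ k
  have he : AnalyticAt ℝ e 0 := (hf.mul hu2).sub (analyticAt_snd.pow k)
  obtain ⟨r, ⟨⟨Φ, hΦ, hΦe⟩, γ, hγ, hγe⟩, hr0⟩ := ((exists_multiplication (Y := Y) he).and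
    (exists_coeff hg) |>.and self_mem_nhdsWithin).exists
  have hr0 : 0 < r := hr0
  have hΦ0 : Φ 0 = 0 := by
    ext1 v
    apply eq_zero_of_eval
    have h1 : Tendsto (fun w : ℝ => ((0 : E), w)) (𝓝 0) (𝓝 0) := by
      apply Continuous.tendsto'; fun_prop; rfl
    have h2 : Tendsto (fun w : ℝ => r * w) (𝓝 0) (𝓝 0) := by
      apply Continuous.tendsto'; fun_prop; simp
    filter_upwards [h1.eventually hΦe, h2.eventually hfu, h2.eventually
      (hu.continuousAt.eventually_ne hu0)] with w h1 h2 h3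
    rw [h1]
    simp only [e]
    rw [h2, mul_assoc, mul_inv_cancel₀ h3, mul_one, sub_self, zero_smul]
  let a : ℝ := (r ^ k)⁻¹
  have ha : r ^ k * a = 1 := mul_inv_cancel₀ (by positivity)
  let Ψ : E → CoeffSpace Y →L[ℝ] CoeffSpace Y := fun t => -(a • (left Y ^ k * Φ t))
  have hΨ : AnalyticAt ℝ Ψ 0 := by
    have h1 : AnalyticAt ℝ (fun t => left Y ^ k * Φ t) 0 := analyticAt_const.fun_mul hΦ
    have h2 : AnalyticAt ℝ (fun t => a • (left Y ^ k * Φ t)) 0 := analyticAt_const.fun_smul h1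
    exact h2.fun_neg
  have hΨ0 : Ψ 0 = 0 := by simp [Ψ, hΦ0]
  let N : E → CoeffSpace Y →L[ℝ] CoeffSpace Y := fun t => Ring.inverse (1 - Ψ t)
  have hN : AnalyticAt ℝ N 0 := by
    apply AnalyticAt.fun_comp (g := fun x => Ring.inverse (1 - x)) _ hΨ
    rw [hΨ0]
    exact analyticAt_inverse_one_sub ℝ _
  let q : E → CoeffSpace Y := fun t => N t (a • (left Y ^ k) (γ t))
  have hq : AnalyticAt ℝ q 0 := by
    apply AnalyticAt.clm_apply hN
    exact analyticAt_const.fun_smul (((left Y ^ k).analyticAt _).fun_comp hγ)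
  let h : E → CoeffSpace Y := fun t => γ t - Φ t (q t)
  have hh : AnalyticAt ℝ h 0 := hγ.sub (hΦ.clm_apply hq)
  have hqh : ∀ᶠ t in 𝓝 (0 : E), (left Y ^ k) (h t) = (r ^ k) • q t := by
    have : ∀ᶠ t in 𝓝 (0 : E), ‖Ψ t‖ < 1 := by
      apply hΨ.continuousAt.norm.eventually_lt_const
      simp [hΨ0]
    filter_upwards [this] with t ht
    have h1 : (1 - Ψ t) (q t) = a • (left Y ^ k) (γ t) := by
      simp only [q, N]
      rw [← mul_apply_eq_comp, Ring.mul_inverse_cancel _ (isUnit_one_sub_of_norm_lt_one ht)]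
      rfl
    have h2 : q t = a • (left Y ^ k) (h t) := by
      simp only [h, map_sub, smul_sub]
      rw [← h1]
      simp [Ψ]
    rw [h2, smul_smul, ha, one_smul]
  refine ⟨fun p => (u p.2)⁻¹ • eval (p.2 / r) (q p.1),
    fun i t => (r ^ (i : ℕ))⁻¹ • ((left Y ^ (i : ℕ)) (h t)) 0, ?_, ?_, ?_⟩
  · apply hu2.fun_smul
    apply AnalyticAt.clm_apply
    · apply AnalyticAt.fun_comp (g := fun w => eval (Y := Y) w) (f := fun p : E × ℝ => p.2 / r)
      · simpa using analyticAt_eval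
      · exact analyticAt_snd.div analyticAt_const hr0.ne'
    · exact AnalyticAt.fun_comp (f := Prod.fst) (x := (0 : E × ℝ)) hq analyticAt_fst
  · intro i
    apply analyticAt_const.fun_smul
    exact (((coeffZero Y).comp (left Y ^ (i : ℕ))).analyticAt _).fun_comp hh
  · have hsc : Tendsto (fun p : E × ℝ => (p.1, p.2 / r)) (𝓝 0) (𝓝 0) := by
      apply Continuous.tendsto'
      · fun_prop
      · simp
    filter_upwards [hsc.eventually hΦe, hsc.eventually hγe, hfst.eventually hqh,
      (hsc.snd_nhds).eventually eventually_abs_lt_one,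
      hsnd.eventually (hu.continuousAt.eventually_ne hu0)] with p h1 h2 h3 h4 h5
    have hrz : r * (p.2 / r) = p.2 := by field_simp
    simp only [hrz] at h1 h2
    have h6 := congrArg (eval (p.2 / r)) (iterate_right_left k (h p.1))
    rw [map_add, eval_right_pow h4, h3, map_sum] at h6
    simp only [eval_right_pow h4, eval_const h4] at h6
    have h7 : eval (p.2 / r) (h p.1) = g p - e p • eval (p.2 / r) (q p.1) := by
      simp only [h]
      rw [map_sub, ← h2, h1]
    rw [h7, eq_sub_iff_add_eq] at h6
    rw [← h6]
    simp only [e, smul_smul, map_smul, sub_smul, div_pow]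
    rw [div_mul_cancel₀ _ (by positivity)]
    simp only [div_eq_mul_inv]
    abel

theorem AnalyticAt.exists_sub_eq_mul {E : Type} [NormedAddCommGroup E] [NormedSpace ℝ E]
    [FiniteDimensional ℝ E] {f : E → ℝ} (hf : AnalyticAt ℝ f 0) (L : E →L[ℝ] ℝ) (v : E) :
    ∃ K : E → ℝ, AnalyticAt ℝ K 0 ∧ ∀ᶠ p in 𝓝 0, f p = f (p - L p • v) + L p * K p := by
  have h1 : AnalyticAt ℝ (fun p : E × ℝ => f (p.1 + p.2 • v)) 0 := by
    apply AnalyticAt.fun_comp (g := f)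
    · simpa using hf
    · exact analyticAt_fst.fun_add (analyticAt_snd.fun_smul analyticAt_const)
  obtain ⟨Q, b, hQ, hb, h⟩ := weierstrass_division (f := fun p : E × ℝ => p.2)
    analyticAt_snd h1 1 (u := fun _ => 1) analyticAt_const one_ne_zero (by simp)
  have hL : Tendsto (fun p : E => (p - L p • v, L p)) (𝓝 0) (𝓝 0) := by
    apply Continuous.tendsto'
    · fun_prop
    · simp
  have hL0 : Tendsto (fun p : E => (p - L p • v, (0 : ℝ))) (𝓝 0) (𝓝 0) := by
    apply Continuous.tendsto'
    · fun_prop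
    · simp
  refine ⟨fun p => Q (p - L p • v, L p), ?_, ?_⟩
  · apply AnalyticAt.fun_comp (g := Q)
    · simpa [show ((0 : E), (0 : ℝ)) = 0 from rfl] using hQ
    · have := L.analyticAt 0
      fun_prop
  · filter_upwards [hL.eventually h, hL0.eventually h] with p h1 h2
    simp at h1 h2
    rw [h1, h2]; ring

/-- Hadamard's lemma with analytic parameters. -/
theorem AnalyticAt.exists_hadamard {ι E : Type} [Fintype ι] [DecidableEq ι] [NormedAddCommGroup E]
    [NormedSpace ℝ E] [FiniteDimensional ℝ E] {f : (ι → ℝ) × E → ℝ} (hf : AnalyticAt ℝ f 0) :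
    ∃ K : ι → (ι → ℝ) × E → ℝ, (∀ i, AnalyticAt ℝ (K i) 0) ∧
      ∀ᶠ p in 𝓝 0, f p = f (0, p.2) + ∑ i, p.1 i * K i p := by
  have key : ∀ s : Finset ι, ∃ K : ι → (ι → ℝ) × E → ℝ, (∀ i, AnalyticAt ℝ (K i) 0) ∧
      ∀ᶠ p in 𝓝 0, f p = f (fun i => if i ∈ s then 0 else p.1 i, p.2) + ∑ i ∈ s, p.1 i * K i p := by
    intro s
    induction s using Finset.induction_on with
    | empty => exact ⟨fun _ _ => 0, fun _ => analyticAt_const, by simp⟩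
    | insert a s ha ih =>
      obtain ⟨K, hK, h⟩ := ih
      let T : (ι → ℝ) × E →L[ℝ] (ι → ℝ) × E :=
        (ContinuousLinearMap.pi fun i => if i ∈ s then 0 else
          (ContinuousLinearMap.proj i).comp (ContinuousLinearMap.fst ℝ (ι → ℝ) E)).prod
        (ContinuousLinearMap.snd ℝ (ι → ℝ) E)
      have hT : ∀ p, T p = (fun i => if i ∈ s then 0 else p.1 i, p.2) := by
        intro p; ext i
        · simp only [T, ContinuousLinearMap.prod_apply, ContinuousLinearMap.coe_pi']
          split_ifs <;> simp
        · simp [T]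
      have hfT : AnalyticAt ℝ (fun p => f (T p)) 0 := by
        apply AnalyticAt.fun_comp (g := f)
        · simpa using hf
        · exact T.analyticAt 0
      let L : (ι → ℝ) × E →L[ℝ] ℝ :=
        (ContinuousLinearMap.proj a).comp (ContinuousLinearMap.fst ℝ (ι → ℝ) E)
      obtain ⟨k, hk, hke⟩ := hfT.exists_sub_eq_mul L (Pi.single a 1, 0)
      refine ⟨fun i => if i = a then k else K i, fun i => ?_, ?_⟩
      · by_cases h : i = a <;> simp [h, hk, hK]
      · filter_upwards [h, hke] with p h1 h2
        rw [h1, Finset.sum_insert ha, ← hT, h2, hT, ← add_assoc]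
        have h3 : L p = p.1 a := rfl
        congr 1
        · simp only [if_true, h3]
          congr 2
          ext i
          · by_cases hi : i ∈ s
            · simp [hi]
            · by_cases hia : i = a
              · subst hia; simp [ha]
              · simp [hi, hia]
          · simp
        · apply Finset.sum_congr rfl
          intro i hi
          rw [if_neg]
          rintro rfl; exact ha hi
  obtain ⟨K, hK, h⟩ := key Finset.univ
  refine ⟨K, hK, ?_⟩
  filter_upwards [h] with p hp
  rw [hp]
  simp [Pi.zero_def]

/-- An analytic germ that does not vanish identically does not vanish identically along some
line through the origin. -/
theorem AnalyticAt.exists_direction {E Y : Type} [NormedAddCommGroup E] [NormedSpace ℝ E]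
    [Nontrivial E] [NormedAddCommGroup Y] [NormedSpace ℝ Y] [CompleteSpace Y]
    {f : E → Y} (hf : AnalyticAt ℝ f 0)
    (h : ¬ ∀ᶠ x in 𝓝 0, f x = 0) : ∃ v : E, v ≠ 0 ∧ ¬ ∀ᶠ z : ℝ in 𝓝 0, f (z • v) = 0 := by
  by_contra! hv
  apply h
  obtain ⟨r, hr, hfr⟩ := Metric.eventually_nhds_iff_ball.1 hf.eventually_analyticAt
  obtain ⟨w, hw⟩ := exists_ne (0 : E)
  have h0 : f 0 = 0 := by simpa using (hv w hw).self_of_nhds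
  filter_upwards [Metric.ball_mem_nhds (0 : E) hr] with x hx
  by_cases hx0 : x = 0
  · rw [hx0, h0]
  · have han : AnalyticOnNhd ℝ (fun z : ℝ => f (z • x)) (Set.Icc 0 1) := by
      intro z hz
      apply AnalyticAt.fun_comp (g := f)
      · apply hfr
        rw [mem_ball_zero_iff] at hx ⊢
        rw [norm_smul, Real.norm_of_nonneg hz.1]
        exact (mul_le_of_le_one_left (norm_nonneg _) hz.2).trans_lt hx
      · fun_prop
    have := han.eqOn_zero_of_preconnected_of_eventuallyEq_zero isPreconnected_Icc
      (Set.left_mem_Icc.2 zero_le_one) (hv x hx0) (Set.right_mem_Icc.2 zero_le_one)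
    simpa using this

theorem exists_prod_equiv {E : Type} [NormedAddCommGroup E] [NormedSpace ℝ E]
    [FiniteDimensional ℝ E] {n : ℕ} (hn : Module.finrank ℝ E = n + 1) {v : E} (hv : v ≠ 0) :
    ∃ e : ((Fin n → ℝ) × ℝ) ≃L[ℝ] E, e (0, 1) = v := by
  obtain ⟨p, hp⟩ := Submodule.exists_isCompl (Submodule.span ℝ {v})
  have h1 : Module.finrank ℝ p = n := by
    have := Submodule.finrank_add_eq_of_isCompl hp
    rw [finrank_span_singleton hv] at this
    omega
  let e1 : (Fin n → ℝ) ≃ₗ[ℝ] p := LinearEquiv.ofFinrankEq _ _ (by simp [h1])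
  let e2 : ℝ ≃ₗ[ℝ] Submodule.span ℝ {v} := LinearEquiv.toSpanNonzeroSingleton ℝ E v hv
  refine ⟨((e1.prodCongr e2).trans (Submodule.prodEquivOfIsCompl _ _ hp.symm)).toContinuousLinearEquiv, ?_⟩
  simp [e2]

/-- An analytic function of two variables, seen as an analytic function of the second variable
with values in a space of analytic germs in the first variable. -/
theorem AnalyticAt.exists_germ_valued {E V Y : Type} [NormedAddCommGroup E] [NormedSpace ℝ E]
    [FiniteDimensional ℝ E] [NormedAddCommGroup V] [NormedSpace ℝ V] [FiniteDimensional ℝ V]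
    [NormedAddCommGroup Y] [NormedSpace ℝ Y] [CompleteSpace Y] {f : V × E → Y}
    (hf : AnalyticAt ℝ f 0) :
    ∃ (X : Type) (_ : NormedAddCommGroup X) (_ : NormedSpace ℝ X) (_ : CompleteSpace X)
      (F : E → X) (ev : V → X →L[ℝ] Y), AnalyticAt ℝ F 0 ∧ AnalyticAt ℝ ev 0 ∧
      (∀ v, (∀ᶠ x in 𝓝 0, ev x v = 0) → v = 0) ∧ ∀ᶠ p in 𝓝 0, f p = ev p.1 (F p.2) := by
  induction hn : Module.finrank ℝ V generalizing V Y with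
  | zero =>
    have : Subsingleton V := Module.finrank_zero_iff.1 hn
    refine ⟨Y, inferInstance, inferInstance, inferInstance, fun t => f (0, t),
      fun _ => ContinuousLinearMap.id ℝ Y, ?_, analyticAt_const, ?_, ?_⟩
    · apply AnalyticAt.fun_comp (g := f)
      · simpa [show ((0 : V), (0 : E)) = 0 from rfl] using hf
      · fun_prop
    · intro v hv; simpa using hv
    · refine Eventually.of_forall fun p => ?_
      rw [show p = (0, p.2) from Prod.ext (Subsingleton.elim _ _) rfl]; simp
  | succ n ih =>
    have : Nontrivial V := Module.nontrivial_of_finrank_pos (R := ℝ) (by omega)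
    obtain ⟨v, hv⟩ := exists_ne (0 : V)
    obtain ⟨e, -⟩ := exists_prod_equiv hn hv
    let L : ((Fin n → ℝ) × E) × ℝ →L[ℝ] V × E :=
      (e.toContinuousLinearMap.comp
        (((ContinuousLinearMap.fst ℝ _ _).comp (ContinuousLinearMap.fst ℝ _ _)).prod
          (ContinuousLinearMap.snd ℝ _ _))).prod
        ((ContinuousLinearMap.snd ℝ _ _).comp (ContinuousLinearMap.fst ℝ _ _))
    have hL : AnalyticAt ℝ (fun p => f (L p)) 0 := by
      apply AnalyticAt.fun_comp (g := f)
      · simpa using hf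
      · exact L.analyticAt 0
    obtain ⟨r, ⟨F, hF, hFe⟩, hr0⟩ :=
      ((CoeffSpace.exists_coeff hL).and self_mem_nhdsWithin).exists
    have hr0 : 0 < r := hr0
    obtain ⟨X, i1, i2, i3, H, ev, hH, hev, hinj, heq⟩ := ih hF (by simp)
    refine ⟨X, i1, i2, i3, H, fun x => (CoeffSpace.eval ((e.symm x).2 / r)).comp
      (ev (e.symm x).1), hH, ?_, ?_, ?_⟩
    · have h1 : AnalyticAt ℝ (fun x => CoeffSpace.eval (Y := Y) ((e.symm x).2 / r)) 0 := by
        apply AnalyticAt.fun_comp (g := fun w => CoeffSpace.eval (Y := Y) w)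
        · simpa using CoeffSpace.analyticAt_eval
        · have : AnalyticAt ℝ (fun x => (e.symm x).2) 0 :=
            ((ContinuousLinearMap.snd ℝ _ _).comp e.symm.toContinuousLinearMap).analyticAt 0
          exact this.div analyticAt_const hr0.ne'
      have h2 : AnalyticAt ℝ (fun x => ev (e.symm x).1) 0 := by
        apply AnalyticAt.fun_comp (g := ev)
        · simpa using hev
        · exact ((ContinuousLinearMap.fst ℝ _ _).comp e.symm.toContinuousLinearMap).analyticAt 0
      exact AnalyticAt.fun_comp (g := fun p : (CoeffSpace Y →L[ℝ] Y) × (X →L[ℝ] CoeffSpace Y) =>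
        p.1.comp p.2) ((ContinuousLinearMap.compL ℝ X (CoeffSpace Y) Y).analyticAt_bilinear _)
        (h1.prod h2)
    · intro v hv
      apply hinj
      have h1 : Tendsto (fun p : (Fin n → ℝ) × ℝ => e (p.1, r * p.2)) (𝓝 0) (𝓝 0) := by
        apply Continuous.tendsto'
        · fun_prop
        · simp [show ((0 : Fin n → ℝ), (0 : ℝ)) = 0 from rfl]
      have h2 := h1.eventually hv
      rw [← Prod.mk_zero_zero, nhds_prod_eq] at h2
      filter_upwards [h2.curry] with x hx
      apply CoeffSpace.eq_zero_of_eval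
      filter_upwards [hx] with w hw
      simpa [mul_div_cancel_left₀ w hr0.ne'] using hw
    · have h1 : Tendsto (fun p : V × E => (((e.symm p.1).1, p.2), (e.symm p.1).2 / r))
          (𝓝 0) (𝓝 0) := by
        apply Continuous.tendsto'
        · fun_prop
        · simp
      have h2 : Tendsto (fun p : V × E => ((e.symm p.1).1, p.2)) (𝓝 0) (𝓝 0) := by
        apply Continuous.tendsto'
        · fun_prop
        · simp
      filter_upwards [h1.eventually hFe, h2.eventually heq] with p h1 h2
      simp only [h2] at h1
      rw [ContinuousLinearMap.comp_apply, ← h1]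
      congr 1
      have : r * ((e.symm p.1).2 / r) = (e.symm p.1).2 := by field_simp
      simp [L, this]

/-- Near `0`, each member of the family is a combination of finitely many fixed analytic functions
whose coefficients are obtained from the member by fixed functionals. -/
def HasDualExpansion {E X : Type} [NormedAddCommGroup E] [NormedSpace ℝ E]
    [NormedAddCommGroup X] [NormedSpace ℝ X] {m : ℕ} (f : Fin m → E → X) : Prop :=
  ∃ (J : Type) (_ : Fintype J) (l : J → X →L[ℝ] ℝ) (h : J → E → X),
    (∀ j, AnalyticAt ℝ (h j) 0) ∧ ∀ i, ∀ᶠ t in 𝓝 0, f i t = ∑ j, l j (f i t) • h j t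

theorem hasDualExpansion_of_forall_single {E X : Type} [NormedAddCommGroup E] [NormedSpace ℝ E]
    [NormedAddCommGroup X] [NormedSpace ℝ X]
    (hs : ∀ f : E → X, AnalyticAt ℝ f 0 → HasDualExpansion fun _ : Fin 1 => f)
    {m : ℕ} (f : Fin m → E → X) (hf : ∀ i, AnalyticAt ℝ (f i) 0) : HasDualExpansion f := by
  induction m with
  | zero => exact ⟨Empty, inferInstance, nofun, nofun, nofun, nofun⟩
  | succ m ih =>
    obtain ⟨J, _, l, h, hh, hl⟩ := hs (f 0) (hf 0)
    have hl := hl 0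
    let g : Fin m → E → X := fun i t => f i.succ t - ∑ j, l j (f i.succ t) • h j t
    have hla : ∀ {I : Type} {a : I → X →L[ℝ] ℝ} {b : E → X}, AnalyticAt ℝ b 0 →
        ∀ i, AnalyticAt ℝ (fun t => a i (b t)) 0 := fun hb i =>
      ((ContinuousLinearMap.analyticAt _ _).fun_comp hb)
    have hg : ∀ i, AnalyticAt ℝ (g i) 0 := fun i =>
      (hf _).fun_sub (Finset.analyticAt_fun_sum _ fun j _ => (hla (hf _) j).fun_smul (hh j))
    obtain ⟨K, _, p, k, hk, hp⟩ := ih g hg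
    refine ⟨J ⊕ K, inferInstance, Sum.elim l p,
      Sum.elim (fun j t => h j t - ∑ n, p n (h j t) • k n t) k, ?_, ?_⟩
    · rintro (j | n)
      · exact (hh j).fun_sub (Finset.analyticAt_fun_sum _ fun n _ =>
          (hla (hh j) n).fun_smul (hk n))
      · exact hk n
    · have key : ∀ i t, f i t - ∑ j, l j (f i t) • h j t =
          ∑ n, p n (f i t - ∑ j, l j (f i t) • h j t) • k n t → f i t =
          ∑ j, Sum.elim l p j (f i t) •
            Sum.elim (fun j t => h j t - ∑ n, p n (h j t) • k n t) k j t := by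
        intro i t h
        rw [sub_eq_iff_eq_add] at h
        simp only [Fintype.sum_sum_type, Sum.elim_inl, Sum.elim_inr]
        conv_lhs => rw [h]
        simp only [map_sub, map_sum, map_smul, sub_smul, smul_sub, Finset.sum_sub_distrib,
          Finset.smul_sum, Finset.sum_smul, smul_smul, smul_eq_mul]
        rw [Finset.sum_comm]
        abel
      intro i
      refine Fin.cases ?_ (fun i => ?_) i
      · filter_upwards [hl] with t ht
        apply key
        rw [← ht, sub_self]; simp
      · filter_upwards [hp i] with t ht
        exact key _ _ ht

/-- Every finite family of analytic germs with values in a Banach space has a dual expansion. -/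
theorem hasDualExpansion {E X : Type} [NormedAddCommGroup E] [NormedSpace ℝ E]
    [FiniteDimensional ℝ E] [NormedAddCommGroup X] [NormedSpace ℝ X] [CompleteSpace X] {m : ℕ}
    (f : Fin m → E → X) (hf : ∀ i, AnalyticAt ℝ (f i) 0) :
    HasDualExpansion f := by
  induction hn : Module.finrank ℝ E generalizing E m with
  | zero =>
    refine hasDualExpansion_of_forall_single (fun f _ => ?_) f hf
    have : Subsingleton E := Module.finrank_zero_iff.1 hn
    have hfE : ∀ t, f t = f 0 := fun t => congrArg f (Subsingleton.elim _ _)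
    by_cases h0 : f 0 = 0
    · exact ⟨Empty, inferInstance, nofun, nofun, nofun, fun _ => Eventually.of_forall fun t => by
        simp [hfE t, h0]⟩
    · obtain ⟨l, -, hl⟩ := exists_dual_vector ℝ (f 0) (norm_ne_zero_iff.2 h0)
      refine ⟨Unit, inferInstance, fun _ => l, fun _ _ => (‖f 0‖)⁻¹ • f 0,
        fun _ => analyticAt_const, fun _ => Eventually.of_forall fun t => ?_⟩
      have : ‖f 0‖ ≠ 0 := by simpa using h0
      simp [hfE t, hl, smul_smul, this]
  | succ n ih =>
    refine hasDualExpansion_of_forall_single (fun f hf => ?_) f hf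
    by_cases h0 : ∀ᶠ t in 𝓝 0, f t = 0
    · refine ⟨Empty, inferInstance, nofun, nofun, nofun, fun _ => ?_⟩
      filter_upwards [h0] with t ht
      simp [ht]
    have : Nontrivial E := Module.nontrivial_of_finrank_pos (R := ℝ) (by omega)
    obtain ⟨v, hv, hfv⟩ := hf.exists_direction h0
    obtain ⟨e, he⟩ := exists_prod_equiv hn hv
    have hfz : AnalyticAt ℝ (fun z : ℝ => f (z • v)) 0 := by
      apply AnalyticAt.fun_comp (g := f)
      · simpa using hf
      · fun_prop
    obtain ⟨k, g, hg, hg0, hgk⟩ := hfz.exists_eventuallyEq_pow_smul_nonzero_iff.2 hfv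
    obtain ⟨l₀, -, hl₀⟩ := exists_dual_vector ℝ (g 0) (norm_ne_zero_iff.2 hg0)
    have hfe : AnalyticAt ℝ (fun p => f (e p)) 0 := by
      apply AnalyticAt.fun_comp (g := f)
      · simpa using hf
      · exact e.toContinuousLinearMap.analyticAt 0
    have hae : AnalyticAt ℝ (fun p => l₀ (f (e p))) 0 := (l₀.analyticAt _).fun_comp hfe
    have hez : ∀ z : ℝ, e (0, z) = z • v := by
      intro z
      rw [← he, ← map_smul]; simp
    obtain ⟨Q, b, hQ, hb, hw⟩ := weierstrass_division hae hfe k (u := fun z => l₀ (g z))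
      ((l₀.analyticAt _).fun_comp hg) (by rw [hl₀]; simpa using hg0) (by
        filter_upwards [hgk] with z hz
        rw [hez, hz]; simp)
    obtain ⟨J, _, l, h, hh, hl⟩ := ih b hb (by simp)
    have hes : Tendsto e.symm (𝓝 0) (𝓝 0) := by
      apply Continuous.tendsto'
      · fun_prop
      · simp
    have hQe : AnalyticAt ℝ (fun t => Q (e.symm t)) 0 := by
      apply AnalyticAt.fun_comp (g := Q)
      · simpa using hQ
      · exact e.symm.toContinuousLinearMap.analyticAt 0
    have hhe : ∀ j, AnalyticAt ℝ (fun t => h j (e.symm t).1) 0 := by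
      intro j
      apply AnalyticAt.fun_comp (g := h j)
      · simpa using hh j
      · exact ((ContinuousLinearMap.fst ℝ _ _).comp e.symm.toContinuousLinearMap).analyticAt 0
    refine ⟨Option J, inferInstance, fun j => j.elim l₀ l, fun j => j.elim
      (fun t => Q (e.symm t) - ∑ j, l j (Q (e.symm t)) • h j (e.symm t).1)
      (fun j t => h j (e.symm t).1), ?_, fun _ => ?_⟩
    · rintro (_ | j)
      · exact hQe.fun_sub (Finset.analyticAt_fun_sum _ fun j _ =>
          (((l j).analyticAt _).fun_comp hQe).fun_smul (hhe j))
      · exact hhe j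
    · have h1 : ∀ᶠ t in 𝓝 (0 : Fin n → ℝ), ∀ i, b i t = ∑ j, l j (b i t) • h j t :=
        eventually_all.2 hl
      filter_upwards [hes.eventually hw, (hes.fst_nhds).eventually h1] with t h1 h2
      simp only [ContinuousLinearEquiv.apply_symm_apply] at h1
      set z := (e.symm t).2
      set y := (e.symm t).1
      set q := Q (e.symm t)
      have h3 : ∑ i : Fin k, z ^ (i : ℕ) • b i y = ∑ j, l j (f t - l₀ (f t) • q) • h j y := by
        have h4 : f t - l₀ (f t) • q = ∑ i : Fin k, z ^ (i : ℕ) • b i y := by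
          rw [sub_eq_iff_eq_add']; exact h1
        rw [h4]
        conv_lhs => enter [2, i]; rw [h2 i]
        simp only [Finset.smul_sum, map_sum, Finset.sum_smul, smul_smul, map_smul, smul_eq_mul]
        rw [Finset.sum_comm]
      rw [h3] at h1
      simp only [Fintype.sum_option, Option.elim_none, Option.elim_some]
      conv_lhs => rw [h1]
      simp only [map_sub, map_smul, sub_smul, smul_sub, Finset.sum_sub_distrib, Finset.smul_sum,
        smul_smul, smul_eq_mul]
      abel

theorem Ultrafilter.exists_normalized_limit {W : Type} [NormedAddCommGroup W] [NormedSpace ℝ W]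
    [FiniteDimensional ℝ W] (𝒰 : Ultrafilter ℕ) (a : ℕ → W) :
    ∃ (s : W) (σ : ℕ → W), Tendsto σ 𝒰 (𝓝 0) ∧ (∀ k, a k = ‖a k‖ • (s + σ k)) ∧
      ((∀ᶠ k in 𝒰, a k ≠ 0) → s ≠ 0) := by
  have : ProperSpace W := FiniteDimensional.proper_real W
  let u : ℕ → W := fun k => ‖a k‖⁻¹ • a k
  have hu : ∀ k, u k ∈ closedBall (0 : W) 1 := by
    intro k
    rw [mem_closedBall_zero_iff, norm_smul, norm_inv, norm_norm]
    exact inv_mul_le_one_of_le₀ le_rfl (norm_nonneg _)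
  obtain ⟨s, -, hs⟩ := (isCompact_closedBall (0 : W) 1).ultrafilter_le_nhds (𝒰.map u)
    (by
      rw [le_principal_iff]
      exact Filter.mem_map.2 (Eventually.of_forall hu))
  have hs : Tendsto u 𝒰 (𝓝 s) := hs
  refine ⟨s, fun k => u k - s, ?_, fun k => ?_, ?_⟩
  · simpa using hs.sub_const s
  · by_cases h : a k = 0
    · simp [h]
    · simp only [add_sub_cancel, u, smul_smul]
      rw [mul_inv_cancel₀ (norm_ne_zero_iff.2 h), one_smul]
  · rintro h rfl
    have h1 : Tendsto (fun _ : ℕ => (1 : ℝ)) 𝒰 (𝓝 0) := by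
      refine (hs.norm.congr' ?_).trans (by simp)
      filter_upwards [h] with k hk
      simp only [u, norm_smul, norm_inv, norm_norm]
      exact inv_mul_cancel₀ (norm_ne_zero_iff.2 hk)
    exact one_ne_zero (tendsto_nhds_unique tendsto_const_nhds h1)

/-- Germs at `0`, along an ultrafilter, of sequences of functions obtained from one analytic
function by letting the parameters tend to `0`, up to scalar factors. -/
def IsAnalyticFamily (𝒰 : Ultrafilter ℕ) {V : Type} [NormedAddCommGroup V] [NormedSpace ℝ V]
    (g : Germ ((𝒰 : Filter ℕ) ×ˢ 𝓝 (0 : V)) ℝ) : Prop :=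
  ∃ (E : Type) (_ : NormedAddCommGroup E) (_ : NormedSpace ℝ E) (_ : FiniteDimensional ℝ E)
    (f : V × E → ℝ) (t : ℕ → E) (c : ℕ → ℝ), AnalyticAt ℝ f 0 ∧ Tendsto t 𝒰 (𝓝 0) ∧
    g = ((fun p => c p.1 * f (p.2, t p.1) : ℕ × V → ℝ) : Germ _ ℝ)

namespace IsAnalyticFamily

variable {𝒰 : Ultrafilter ℕ} {V : Type} [NormedAddCommGroup V] [NormedSpace ℝ V]
  {g h : Germ ((𝒰 : Filter ℕ) ×ˢ 𝓝 (0 : V)) ℝ}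

theorem of_const (c : ℕ → ℝ) : IsAnalyticFamily 𝒰
    (((fun p => c p.1 : ℕ × V → ℝ) : Germ ((𝒰 : Filter ℕ) ×ˢ 𝓝 (0 : V)) ℝ)) :=
  ⟨ℝ, inferInstance, inferInstance, inferInstance, fun _ => 1, fun _ => 0, c, analyticAt_const,
    tendsto_const_nhds, by simp⟩

theorem analyticAt_left {E E' : Type} [NormedAddCommGroup E] [NormedSpace ℝ E]
    [NormedAddCommGroup E'] [NormedSpace ℝ E'] {f : V × E → ℝ} (hf : AnalyticAt ℝ f 0)
    (L : E' →L[ℝ] E) : AnalyticAt ℝ (fun p : V × E' => f (p.1, L p.2)) 0 := by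
  apply AnalyticAt.fun_comp (g := f)
  · simpa [show ((0 : V), (0 : E)) = 0 from rfl] using hf
  · exact analyticAt_fst.prod ((L.analyticAt _).fun_comp analyticAt_snd)

theorem mul (hg : IsAnalyticFamily 𝒰 g) (hh : IsAnalyticFamily 𝒰 h) :
    IsAnalyticFamily 𝒰 (g * h) := by
  obtain ⟨E, _, _, _, f, t, c, hf, ht, rfl⟩ := hg
  obtain ⟨E', _, _, _, f', t', c', hf', ht', rfl⟩ := hh
  refine ⟨E × E', inferInstance, inferInstance, inferInstance,
    fun p => f (p.1, p.2.1) * f' (p.1, p.2.2), fun k => (t k, t' k), fun k => c k * c' k,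
    (analyticAt_left hf (ContinuousLinearMap.fst ℝ E E')).mul
      (analyticAt_left hf' (ContinuousLinearMap.snd ℝ E E')), ht.prodMk_nhds ht', ?_⟩
  rw [← Germ.coe_mul]
  congr 1
  ext p
  simp only [Pi.mul_apply]; ring

theorem add (hg : IsAnalyticFamily 𝒰 g) (hh : IsAnalyticFamily 𝒰 h) :
    IsAnalyticFamily 𝒰 (g + h) := by
  obtain ⟨E, _, _, _, f, t, c, hf, ht, rfl⟩ := hg
  obtain ⟨E', _, _, _, f', t', c', hf', ht', rfl⟩ := hh
  obtain ⟨s, σ, hσ, hs, -⟩ := 𝒰.exists_normalized_limit fun k => (c k, c' k)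
  have h1 : AnalyticAt ℝ (fun p : V × (E × E') × (ℝ × ℝ) => s.1 + p.2.2.1) 0 := by
    have := ((ContinuousLinearMap.fst ℝ ℝ ℝ).comp ((ContinuousLinearMap.snd ℝ (E × E') (ℝ × ℝ)).comp
      (ContinuousLinearMap.snd ℝ V _))).analyticAt 0
    exact analyticAt_const.fun_add this
  have h2 : AnalyticAt ℝ (fun p : V × (E × E') × (ℝ × ℝ) => s.2 + p.2.2.2) 0 := by
    have := ((ContinuousLinearMap.snd ℝ ℝ ℝ).comp ((ContinuousLinearMap.snd ℝ (E × E') (ℝ × ℝ)).comp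
      (ContinuousLinearMap.snd ℝ V _))).analyticAt 0
    exact analyticAt_const.fun_add this
  refine ⟨(E × E') × (ℝ × ℝ), inferInstance, inferInstance, inferInstance,
    fun p => (s.1 + p.2.2.1) * f (p.1, p.2.1.1) + (s.2 + p.2.2.2) * f' (p.1, p.2.1.2),
    fun k => ((t k, t' k), σ k), fun k => ‖(c k, c' k)‖,
    (h1.fun_mul (analyticAt_left hf ((ContinuousLinearMap.fst ℝ E E').comp
      (ContinuousLinearMap.fst ℝ (E × E') (ℝ × ℝ))))).fun_add
      (h2.fun_mul (analyticAt_left hf' ((ContinuousLinearMap.snd ℝ E E').comp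
      (ContinuousLinearMap.fst ℝ (E × E') (ℝ × ℝ))))), (ht.prodMk_nhds ht').prodMk_nhds hσ, ?_⟩
  rw [← Germ.coe_add]
  congr 1
  ext p
  have h3 := hs p.1
  have h4 := congrArg Prod.fst h3
  have h5 := congrArg Prod.snd h3
  simp only [Prod.smul_fst, Prod.smul_snd, Prod.fst_add, Prod.snd_add, smul_eq_mul] at h4 h5
  simp only [Pi.add_apply]
  rw [mul_add, ← mul_assoc, ← mul_assoc, ← h4, ← h5]

/-- A nonzero germ has a representative whose limit does not vanish identically. -/
theorem exists_nonvanishing [FiniteDimensional ℝ V] (hg : IsAnalyticFamily 𝒰 g) (h0 : g ≠ 0) :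
    ∃ (E : Type) (_ : NormedAddCommGroup E) (_ : NormedSpace ℝ E) (_ : FiniteDimensional ℝ E)
      (f : V × E → ℝ) (t : ℕ → E) (c : ℕ → ℝ), AnalyticAt ℝ f 0 ∧ Tendsto t 𝒰 (𝓝 0) ∧
      g = ((fun p => c p.1 * f (p.2, t p.1) : ℕ × V → ℝ) : Germ _ ℝ) ∧
      (∀ᶠ k in 𝒰, c k ≠ 0) ∧ ¬ ∀ᶠ x in 𝓝 0, f (x, 0) = 0 := by
  obtain ⟨E, _, _, _, f, t, c, hf, ht, rfl⟩ := hg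
  obtain ⟨X, _, _, _, F, ev, hF, hev, hinj, hfe⟩ := hf.exists_germ_valued
  obtain ⟨J, _, l, h, hh, hl⟩ := hasDualExpansion (fun _ : Fin 1 => F) fun _ => hF
  have hl := hl 0
  let a : ℕ → J → ℝ := fun k j => l j (F (t k))
  obtain ⟨s, σ, hσ, hs, hs0⟩ := 𝒰.exists_normalized_limit a
  let v : E × (J → ℝ) → X := fun q => ∑ j, (s j + q.2 j) • h j q.1
  have hv : AnalyticAt ℝ v 0 := by
    apply Finset.analyticAt_fun_sum
    intro j _
    apply AnalyticAt.fun_smul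
    · exact analyticAt_const.fun_add (((ContinuousLinearMap.proj j).comp
        (ContinuousLinearMap.snd ℝ E (J → ℝ))).analyticAt 0)
    · exact AnalyticAt.fun_comp (f := Prod.fst) (x := (0 : E × (J → ℝ))) (hh j) analyticAt_fst
  have htσ : Tendsto (fun k => (t k, σ k)) 𝒰 (𝓝 0) := ht.prodMk_nhds hσ
  have hFv : ∀ᶠ k in 𝒰, F (t k) = ‖a k‖ • v (t k, σ k) := by
    filter_upwards [ht.eventually hl] with k hk
    rw [hk, Finset.smul_sum]
    refine Finset.sum_congr rfl fun j _ => ?_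
    rw [smul_smul]
    congr 1
    exact congrFun (hs k) j
  have hG : ((fun p => c p.1 * f (p.2, t p.1) : ℕ × V → ℝ) :
      Germ ((𝒰 : Filter ℕ) ×ˢ 𝓝 (0 : V)) ℝ) =
      ((fun p => (c p.1 * ‖a p.1‖) * ev p.2 (v (t p.1, σ p.1)) : ℕ × V → ℝ) : Germ _ ℝ) := by
    apply Germ.coe_eq.2
    have h1 : Tendsto (fun p : ℕ × V => (p.2, t p.1)) ((𝒰 : Filter ℕ) ×ˢ 𝓝 (0 : V)) (𝓝 0) :=
      tendsto_snd.prodMk_nhds (ht.comp tendsto_fst)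
    filter_upwards [h1.eventually hfe, tendsto_fst.eventually hFv] with p h1 h2
    rw [h1, h2, map_smul, smul_eq_mul, mul_assoc]
  have hne : ∀ᶠ k in 𝒰, c k * ‖a k‖ ≠ 0 := by
    rw [Ultrafilter.eventually_not]
    intro h
    apply h0
    rw [hG]
    apply Germ.coe_eq.2
    filter_upwards [tendsto_fst.eventually h] with p hp
    simp [hp]
  refine ⟨E × (J → ℝ), inferInstance, inferInstance, inferInstance, fun p => ev p.1 (v p.2),
    fun k => (t k, σ k), fun k => c k * ‖a k‖, ?_, htσ, hG, hne, ?_⟩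
  · exact AnalyticAt.clm_apply (AnalyticAt.fun_comp (f := Prod.fst)
      (x := (0 : V × (E × (J → ℝ)))) hev analyticAt_fst)
      (AnalyticAt.fun_comp (f := Prod.snd) (x := (0 : V × (E × (J → ℝ)))) hv analyticAt_snd)
  · intro hvan
    have hv0 := hinj (v 0) hvan
    have hane : ∀ᶠ k in 𝒰, a k ≠ 0 := by
      filter_upwards [hne] with k hk hk2
      simp [hk2] at hk
    apply hs0 hane
    ext i
    have h1 : Tendsto (fun k => s i + σ k i) 𝒰 (𝓝 (s i + 0)) :=
      tendsto_const_nhds.add ((tendsto_pi_nhds.1 hσ) i)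
    have h2 : Tendsto (fun k => l i (v (t k, σ k))) 𝒰 (𝓝 (l i (v 0))) :=
      ((l i).continuous.tendsto _).comp (hv.continuousAt.tendsto.comp htσ)
    have h3 : (fun k => s i + σ k i) =ᶠ[𝒰] fun k => l i (v (t k, σ k)) := by
      filter_upwards [hane, hFv] with k hk hk2
      have h4 : a k i = ‖a k‖ * (s i + σ k i) := congrFun (hs k) i
      have h5 : a k i = ‖a k‖ * l i (v (t k, σ k)) := by
        change l i (F (t k)) = _
        rw [hk2, map_smul, smul_eq_mul]
      rw [h4] at h5
      exact mul_left_cancel₀ (norm_ne_zero_iff.2 hk) h5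
    have h6 := tendsto_nhds_unique (h1.congr' h3) h2
    rw [add_zero] at h6
    rw [h6, hv0, map_zero]; rfl

end IsAnalyticFamily

/-- The ring of germs of analytic families. -/
def analyticFamilies (𝒰 : Ultrafilter ℕ) (V : Type) [NormedAddCommGroup V] [NormedSpace ℝ V] :
    Subring (Germ ((𝒰 : Filter ℕ) ×ˢ 𝓝 (0 : V)) ℝ) where
  carrier := {g | IsAnalyticFamily 𝒰 g}
  mul_mem' := IsAnalyticFamily.mul
  one_mem' := IsAnalyticFamily.of_const fun _ => 1
  add_mem' := IsAnalyticFamily.add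
  zero_mem' := IsAnalyticFamily.of_const fun _ => 0
  neg_mem' := fun {g} hg => by
    have := (IsAnalyticFamily.of_const (𝒰 := 𝒰) (V := V) fun _ => -1).mul hg
    rwa [show (((fun _ => -1 : ℕ × V → ℝ) : Germ ((𝒰 : Filter ℕ) ×ˢ 𝓝 (0 : V)) ℝ)) = -1 from rfl,
      neg_one_mul] at this

theorem isNoetherianRing_of_division {A B : Type*} [CommRing A] [CommRing B] [IsNoetherianRing B]
    (h : ∀ g : A, g ≠ 0 → ∃ (φ : B →+* A) (k : ℕ) (z : Fin k → A), ∀ a,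
      ∃ (q : A) (r : Fin k → B), a = q * g + ∑ i, z i * φ (r i)) : IsNoetherianRing A := by
  classical
  rw [isNoetherianRing_iff_ideal_fg]
  intro I
  by_cases hI : I = ⊥
  · rw [hI]; exact Submodule.fg_bot
  obtain ⟨g, hgI, hg⟩ := Submodule.exists_mem_ne_zero_of_ne_bot hI
  obtain ⟨φ, k, z, hz⟩ := h g hg
  let ψ : (Fin k → B) → A := fun r => ∑ i, z i * φ (r i)
  have hψa : ∀ r s, ψ (r + s) = ψ r + ψ s := by
    intro r s; simp [ψ, mul_add, Finset.sum_add_distrib]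
  have hψs : ∀ c r, ψ (c • r) = φ c * ψ r := by
    intro c r
    simp only [ψ, Pi.smul_apply, smul_eq_mul, map_mul, Finset.mul_sum]
    exact Finset.sum_congr rfl fun i _ => by ring
  let N : Submodule B (Fin k → B) :=
    { carrier := {r | ψ r ∈ I}
      add_mem' := fun {r s} hr hs => by
        rw [Set.mem_ofPred_eq, hψa]; exact I.add_mem hr hs
      zero_mem' := by simp [ψ]
      smul_mem' := fun c r hr => by
        rw [Set.mem_ofPred_eq, hψs]; exact I.mul_mem_left _ hr }
  obtain ⟨S, hS⟩ : N.FG := IsNoetherian.noetherian N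
  refine ⟨insert g (S.image ψ), le_antisymm ?_ ?_⟩
  · rw [Submodule.span_le]
    intro a ha
    rw [Finset.coe_insert, Finset.coe_image, Set.mem_insert_iff] at ha
    rcases ha with rfl | ⟨s, hs, rfl⟩
    · exact hgI
    · have : s ∈ N := by rw [← hS]; exact Submodule.subset_span hs
      exact this
  · intro a ha
    obtain ⟨q, r, hqr⟩ := hz a
    have hrN : r ∈ N := by
      change ψ r ∈ I
      rw [show ψ r = a - q * g by rw [hqr]; simp [ψ]]
      exact I.sub_mem ha (I.mul_mem_left _ hgI)
    have hmem : ∀ r ∈ N, ψ r ∈ Submodule.span A (↑(insert g (S.image ψ)) : Set A) := by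
      intro r hr
      rw [← hS] at hr
      induction hr using Submodule.span_induction with
      | mem x hx =>
        apply Submodule.subset_span
        rw [Finset.coe_insert, Finset.coe_image]
        exact Set.mem_insert_of_mem _ ⟨x, hx, rfl⟩
      | zero => simp [ψ]
      | add x y _ _ hx hy => rw [hψa]; exact add_mem hx hy
      | smul c x _ hx => rw [hψs]; exact Submodule.smul_mem _ _ hx
    rw [hqr]
    refine add_mem (Submodule.smul_mem _ q (Submodule.subset_span ?_)) (hmem r hrN)
    simp

namespace analyticFamilies

variable {𝒰 : Ultrafilter ℕ} {V V' : Type} [NormedAddCommGroup V] [NormedSpace ℝ V]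
  [NormedAddCommGroup V'] [NormedSpace ℝ V']

theorem tendsto_prodMap (L : V →L[ℝ] V') : Tendsto (fun p : ℕ × V => (p.1, L p.2))
    ((𝒰 : Filter ℕ) ×ˢ 𝓝 (0 : V)) ((𝒰 : Filter ℕ) ×ˢ 𝓝 (0 : V')) := by
  refine tendsto_fst.prodMk (Tendsto.comp ?_ tendsto_snd)
  exact L.continuous.tendsto' _ _ (map_zero L)

/-- Pulling back germs along a linear map. -/
noncomputable def pullback (L : V →L[ℝ] V') :
    analyticFamilies 𝒰 V' →+* analyticFamilies 𝒰 V where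
  toFun g := ⟨g.1.compTendsto _ (tendsto_prodMap L), by
    obtain ⟨_, E, _, _, _, f, t, c, hf, ht, rfl⟩ := g
    refine ⟨E, inferInstance, inferInstance, inferInstance, fun p => f (L p.1, p.2), t, c,
      ?_, ht, rfl⟩
    apply AnalyticAt.fun_comp (g := f)
    · simpa [show ((0 : V'), (0 : E)) = 0 from rfl] using hf
    · exact ((L.analyticAt _).fun_comp analyticAt_fst).prod analyticAt_snd⟩
  map_one' := rfl
  map_zero' := rfl
  map_mul' := by
    rintro ⟨a, ha⟩ ⟨b, hb⟩
    induction a using Germ.inductionOn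
    induction b using Germ.inductionOn
    rfl
  map_add' := by
    rintro ⟨a, ha⟩ ⟨b, hb⟩
    induction a using Germ.inductionOn
    induction b using Germ.inductionOn
    rfl

theorem isNoetherianRing (𝒰 : Ultrafilter ℕ) (V : Type) [NormedAddCommGroup V] [NormedSpace ℝ V]
    [FiniteDimensional ℝ V] : IsNoetherianRing (analyticFamilies 𝒰 V) := by
  induction hn : Module.finrank ℝ V generalizing V with
  | zero =>
    have : Subsingleton V := Module.finrank_zero_iff.1 hn
    refine isNoetherianRing_of_division (B := ℤ) fun g hg =>
      ⟨Int.castRingHom _, 0, nofun, fun a => ?_⟩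
    obtain ⟨E, _, _, _, f, t, c, hf, ht, hgf, hc, hfv⟩ :=
      IsAnalyticFamily.exists_nonvanishing g.2 fun h => hg (Subtype.ext h)
    have hf0 : f 0 ≠ 0 := by
      intro h
      apply hfv
      refine Eventually.of_forall fun x => ?_
      rwa [Subsingleton.elim x 0]
    have ht0 : Tendsto (fun k => ((0 : V), t k)) 𝒰 (𝓝 0) := tendsto_const_nhds.prodMk_nhds ht
    refine ⟨a * ⟨_, IsAnalyticFamily.of_const fun k => (c k * f (0, t k))⁻¹⟩, nofun, ?_⟩
    rw [Fintype.sum_empty, add_zero, mul_assoc]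
    conv_lhs => rw [← mul_one a]
    congr 1
    apply Subtype.ext
    rw [Subring.coe_mul, hgf, ← Germ.coe_mul]
    apply Germ.coe_eq.2
    filter_upwards [tendsto_fst.eventually hc, tendsto_fst.eventually (ht0.eventually
      (hf.continuousAt.eventually_ne hf0))] with p h1 h2
    rw [Pi.mul_apply, Subsingleton.elim p.2 0, inv_mul_cancel₀ (mul_ne_zero h1 h2)]
  | succ n ih =>
    have : Nontrivial V := Module.nontrivial_of_finrank_pos (R := ℝ) (by omega)
    have hB := ih (Fin n → ℝ) (by simp)
    refine isNoetherianRing_of_division (B := analyticFamilies 𝒰 (Fin n → ℝ)) fun g hg => ?_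
    obtain ⟨E, _, _, _, f, t, c, hf, ht, hgf, hc, hfv⟩ :=
      IsAnalyticFamily.exists_nonvanishing g.2 fun h => hg (Subtype.ext h)
    have hf0 : AnalyticAt ℝ (fun x => f (x, 0)) 0 := by
      apply AnalyticAt.fun_comp (g := f)
      · simpa [show ((0 : V), (0 : E)) = 0 from rfl] using hf
      · exact analyticAt_id.prod analyticAt_const
    obtain ⟨v, hv, hfz⟩ := hf0.exists_direction hfv
    obtain ⟨e, he⟩ := exists_prod_equiv hn hv
    have hez : ∀ z : ℝ, e (0, z) = z • v := by
      intro z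
      rw [← he, ← map_smul]; simp
    have hfza : AnalyticAt ℝ (fun z : ℝ => f (z • v, 0)) 0 := by
      apply AnalyticAt.fun_comp (g := fun x => f (x, 0))
      · simpa using hf0
      · fun_prop
    obtain ⟨k, u, hu, hu0, huk⟩ := hfza.exists_eventuallyEq_pow_smul_nonzero_iff.2 hfz
    let L : V →L[ℝ] (Fin n → ℝ) := (ContinuousLinearMap.fst ℝ _ _).comp e.symm.toContinuousLinearMap
    let M : V →L[ℝ] ℝ := (ContinuousLinearMap.snd ℝ _ _).comp e.symm.toContinuousLinearMap
    refine ⟨pullback L, k, fun i => ⟨((fun p => M p.2 ^ (i : ℕ) : ℕ × V → ℝ) : Germ _ ℝ), ?_⟩, ?_⟩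
    · refine ⟨ℝ, inferInstance, inferInstance, inferInstance, fun p => M p.1 ^ (i : ℕ), fun _ => 0,
        fun _ => 1, ?_, tendsto_const_nhds, by simp⟩
      exact ((M.analyticAt _).fun_comp analyticAt_fst).fun_pow _
    rintro ⟨_, E', _, _, _, f', t', c', hf', ht', rfl⟩
    let P : ((Fin n → ℝ) × (E × E')) × ℝ →L[ℝ] V := e.toContinuousLinearMap.comp
      (((ContinuousLinearMap.fst ℝ _ _).comp (ContinuousLinearMap.fst ℝ _ _)).prod
        (ContinuousLinearMap.snd ℝ _ _))
    let T : ((Fin n → ℝ) × (E × E')) × ℝ →L[ℝ] E × E' :=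
      (ContinuousLinearMap.snd ℝ _ _).comp (ContinuousLinearMap.fst ℝ _ _)
    have hfP : AnalyticAt ℝ (fun p => f (P p, (T p).1)) 0 := by
      apply AnalyticAt.fun_comp (g := f)
      · simpa [show ((0 : V), (0 : E)) = 0 from rfl] using hf
      · exact (P.prod ((ContinuousLinearMap.fst ℝ E E').comp T)).analyticAt 0
    have hfP' : AnalyticAt ℝ (fun p => f' (P p, (T p).2)) 0 := by
      apply AnalyticAt.fun_comp (g := f')
      · simpa [show ((0 : V), (0 : E')) = 0 from rfl] using hf'
      · exact (P.prod ((ContinuousLinearMap.snd ℝ E E').comp T)).analyticAt 0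
    obtain ⟨Q, b, hQ, hb, hw⟩ := weierstrass_division hfP hfP' k hu hu0 (by
      filter_upwards [huk] with z hz
      simpa [P, T, hez] using hz)
    have htt : Tendsto (fun k => (t k, t' k)) 𝒰 (𝓝 0) := ht.prodMk_nhds ht'
    refine ⟨⟨_, E × E', inferInstance, inferInstance, inferInstance,
        fun p => Q ((L p.1, p.2), M p.1), fun k => (t k, t' k), fun k => c' k / c k, ?_, htt, rfl⟩,
      fun i => ⟨_, E × E', inferInstance, inferInstance, inferInstance, b i,
        fun k => (t k, t' k), c', hb i, htt, rfl⟩, ?_⟩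
    · apply AnalyticAt.fun_comp (g := Q)
      · simp only [map_zero, Prod.fst_zero, Prod.snd_zero, Prod.mk_zero_zero]
        exact hQ
      · exact (((L.analyticAt _).fun_comp analyticAt_fst).prod analyticAt_snd).prod
          ((M.analyticAt _).fun_comp analyticAt_fst)
    · apply Subtype.ext
      simp only [Subring.coe_add, Subring.coe_mul, AddSubmonoidClass.coe_finsetSum, hgf]
      have hsum : ∀ F : Fin k → ℕ × V → ℝ, (∑ i, ((F i : ℕ × V → ℝ) :
          Germ ((𝒰 : Filter ℕ) ×ˢ 𝓝 (0 : V)) ℝ)) = ((∑ i, F i : ℕ × V → ℝ) : Germ _ ℝ) := fun F =>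
        (map_sum (Germ.coeAddHom (M := ℝ) ((𝒰 : Filter ℕ) ×ˢ 𝓝 (0 : V))) F Finset.univ).symm
      have hpull : ∀ i, (pullback (𝒰 := 𝒰) L ⟨_, E × E', inferInstance, inferInstance,
          inferInstance, b i, fun k => (t k, t' k), c', hb i, htt, rfl⟩).1 =
          ((fun p => c' p.1 * b i (L p.2, (t p.1, t' p.1)) : ℕ × V → ℝ) : Germ _ ℝ) := fun i => rfl
      simp only [hpull, ← Germ.coe_mul, hsum, ← Germ.coe_add]
      apply Germ.coe_eq.2
      have hT : Tendsto (fun p : ℕ × V => ((L p.2, (t p.1, t' p.1)), M p.2))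
          ((𝒰 : Filter ℕ) ×ˢ 𝓝 (0 : V)) (𝓝 0) :=
        (((L.continuous.tendsto' _ _ (map_zero L)).comp tendsto_snd).prodMk_nhds
          (htt.comp tendsto_fst)).prodMk_nhds
          ((M.continuous.tendsto' _ _ (map_zero M)).comp tendsto_snd)
      filter_upwards [hT.eventually hw, tendsto_fst.eventually hc] with p h1 h2
      have hP : P ((L p.2, (t p.1, t' p.1)), M p.2) = p.2 := by simp [P, L, M]
      rw [hP] at h1
      simp only [T, ContinuousLinearMap.comp_apply, ContinuousLinearMap.coe_fst',
        ContinuousLinearMap.coe_snd', smul_eq_mul] at h1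
      simp only [Pi.add_apply, Pi.mul_apply, Finset.sum_apply]
      rw [h1, mul_add, Finset.mul_sum]
      congr 1
      · field_simp
      · exact Finset.sum_congr rfl fun i _ => by ring

end analyticFamilies

namespace analyticFamilies

variable {𝒰 : Ultrafilter ℕ}

theorem tendsto_graph {V : Type} [NormedAddCommGroup V] {p : ℕ → V} (hp : Tendsto p 𝒰 (𝓝 0)) :
    Tendsto (fun k => (k, p k)) (𝒰 : Filter ℕ) ((𝒰 : Filter ℕ) ×ˢ 𝓝 (0 : V)) :=
  tendsto_id.prodMk hp

/-- Evaluation along a sequence of points tending to `0`. -/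
noncomputable def evalAt {V : Type} [NormedAddCommGroup V] [NormedSpace ℝ V] {p : ℕ → V}
    (hp : Tendsto p 𝒰 (𝓝 0)) : analyticFamilies 𝒰 V →+* Germ (𝒰 : Filter ℕ) ℝ where
  toFun g := g.1.compTendsto _ (tendsto_graph hp)
  map_one' := rfl
  map_zero' := rfl
  map_mul' := by
    rintro ⟨a, ha⟩ ⟨b, hb⟩
    induction a using Germ.inductionOn
    induction b using Germ.inductionOn
    rfl
  map_add' := by
    rintro ⟨a, ha⟩ ⟨b, hb⟩
    induction a using Germ.inductionOn
    induction b using Germ.inductionOn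
    rfl

variable {ι : Type} [Fintype ι]

theorem germ_sum {Φ : Filter (ℕ × (ι → ℝ))} (F : ι → ℕ × (ι → ℝ) → ℝ) :
    (∑ i, ((F i : ℕ × (ι → ℝ) → ℝ) : Germ Φ ℝ)) = ((∑ i, F i : ℕ × (ι → ℝ) → ℝ) : Germ Φ ℝ) :=
  (map_sum (Germ.coeAddHom (M := ℝ) Φ) F Finset.univ).symm

/-- The coordinate function `x_l - p_l`. -/
noncomputable def coordSub (𝒰 : Ultrafilter ℕ) (p : ℕ → ι → ℝ) (l : ι) :
    analyticFamilies 𝒰 (ι → ℝ) :=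
  ⟨((fun q => q.2 l : ℕ × (ι → ℝ) → ℝ) : Germ _ ℝ), by
    refine ⟨ℝ, inferInstance, inferInstance, inferInstance, fun p => p.1 l, fun _ => 0,
      fun _ => 1, ?_, tendsto_const_nhds, by simp⟩
    exact ((ContinuousLinearMap.proj (R := ℝ) (φ := fun _ : ι => ℝ) l).comp
      (ContinuousLinearMap.fst ℝ (ι → ℝ) ℝ)).analyticAt 0⟩ -
  ⟨_, IsAnalyticFamily.of_const fun k => p k l⟩

theorem coordSub_coe (p : ℕ → ι → ℝ) (l : ι) :
    (coordSub 𝒰 p l).1 = ((fun q => q.2 l - p q.1 l : ℕ × (ι → ℝ) → ℝ) : Germ _ ℝ) := rfl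

variable [DecidableEq ι]

/-- A family vanishing at a sequence of points lies in the ideal of that sequence. -/
theorem exists_eq_sum_of_evalAt_eq_zero {p : ℕ → ι → ℝ} (hp : Tendsto p 𝒰 (𝓝 0))
    {g : analyticFamilies 𝒰 (ι → ℝ)} (hg : evalAt hp g = 0) :
    ∃ κ : ι → analyticFamilies 𝒰 (ι → ℝ), g = ∑ l, coordSub 𝒰 p l * κ l := by
  obtain ⟨_, E, _, _, _, f, t, c, hf, ht, rfl⟩ := g
  have hg0 : ∀ᶠ k in 𝒰, c k * f (p k, t k) = 0 := Germ.coe_eq.1 hg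
  let S : (ι → ℝ) × ((ι → ℝ) × E) →L[ℝ] (ι → ℝ) × E :=
    (ContinuousLinearMap.fst ℝ (ι → ℝ) ((ι → ℝ) × E) +
      (ContinuousLinearMap.fst ℝ (ι → ℝ) E).comp
        (ContinuousLinearMap.snd ℝ (ι → ℝ) ((ι → ℝ) × E))).prod
      ((ContinuousLinearMap.snd ℝ (ι → ℝ) E).comp
        (ContinuousLinearMap.snd ℝ (ι → ℝ) ((ι → ℝ) × E)))
  have hfS : AnalyticAt ℝ (fun q => f (S q)) 0 := by
    apply AnalyticAt.fun_comp (g := f)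
    · simpa using hf
    · exact S.analyticAt 0
  obtain ⟨K, hK, hKe⟩ := hfS.exists_hadamard
  have hpt : Tendsto (fun k => (p k, t k)) 𝒰 (𝓝 0) := hp.prodMk_nhds ht
  let D : (ι → ℝ) × ((ι → ℝ) × E) →L[ℝ] (ι → ℝ) × ((ι → ℝ) × E) :=
    (ContinuousLinearMap.fst ℝ (ι → ℝ) ((ι → ℝ) × E) -
      (ContinuousLinearMap.fst ℝ (ι → ℝ) E).comp
        (ContinuousLinearMap.snd ℝ (ι → ℝ) ((ι → ℝ) × E))).prod
      (ContinuousLinearMap.snd ℝ (ι → ℝ) ((ι → ℝ) × E))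
  refine ⟨fun l => ⟨_, (ι → ℝ) × E, inferInstance, inferInstance, inferInstance,
    fun q => K l (D q), fun k => (p k, t k), c, ?_, hpt, rfl⟩, ?_⟩
  · apply AnalyticAt.fun_comp (g := K l)
    · simpa using hK l
    · exact D.analyticAt 0
  · apply Subtype.ext
    simp only [AddSubmonoidClass.coe_finsetSum, Subring.coe_mul, coordSub_coe, ← Germ.coe_mul,
      germ_sum]
    apply Germ.coe_eq.2
    have hT : Tendsto (fun q : ℕ × (ι → ℝ) => D (q.2, (p q.1, t q.1)))
        ((𝒰 : Filter ℕ) ×ˢ 𝓝 (0 : ι → ℝ)) (𝓝 0) :=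
      (D.continuous.tendsto' 0 0 (map_zero D)).comp
        (tendsto_snd.prodMk_nhds (hpt.comp tendsto_fst))
    filter_upwards [hT.eventually hKe, tendsto_fst.eventually hg0] with q h1 h2
    have h3 : S (D (q.2, (p q.1, t q.1))) = (q.2, t q.1) := by simp [S, D]
    have h4 : S (0, (D (q.2, (p q.1, t q.1))).2) = (p q.1, t q.1) := by simp [S, D]
    rw [h3, h4] at h1
    simp only [Finset.sum_apply, Pi.mul_apply]
    rw [h1, mul_add, h2, zero_add, Finset.mul_sum]
    refine Finset.sum_congr rfl fun l _ => ?_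
    simp only [D, ContinuousLinearMap.prod_apply, sub_apply,
      ContinuousLinearMap.comp_apply, ContinuousLinearMap.coe_fst', ContinuousLinearMap.coe_snd',
      Pi.sub_apply]
    ring

end analyticFamilies

/-- Hadamard's lemma at a moving base point. -/
theorem AnalyticAt.exists_hadamard_fderiv {ι : Type} [Fintype ι] [DecidableEq ι]
    {f : (ι → ℝ) → ℝ} (hf : AnalyticAt ℝ f 0) :
    ∃ K : ι → (ι → ℝ) × (ι → ℝ) → ℝ, (∀ i, AnalyticAt ℝ (K i) 0) ∧
      (∀ᶠ q in 𝓝 0, f (q.2 + q.1) = f q.2 + ∑ i, q.1 i * K i q) ∧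
      ∀ᶠ p in 𝓝 0, ∀ i, K i (0, p) = fderiv ℝ f p (Pi.single i 1) := by
  have hfS : AnalyticAt ℝ (fun q : (ι → ℝ) × (ι → ℝ) => f (q.2 + q.1)) 0 := by
    apply AnalyticAt.fun_comp (g := f)
    · simpa using hf
    · exact analyticAt_snd.fun_add analyticAt_fst
  obtain ⟨K, hK, hKe⟩ := hfS.exists_hadamard
  refine ⟨K, hK, ?_, ?_⟩
  · filter_upwards [hKe] with q hq
    simpa using hq
  · have h1 : ∀ᶠ p in 𝓝 (0 : ι → ℝ), ∀ i, AnalyticAt ℝ (K i) (0, p) := by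
      rw [eventually_all]
      intro i
      have : Tendsto (fun p : ι → ℝ => ((0 : ι → ℝ), p)) (𝓝 0) (𝓝 0) := by
        apply Continuous.tendsto'
        · fun_prop
        · rfl
      exact this.eventually (hK i).eventually_analyticAt
    have h2 : ∀ᶠ p in 𝓝 (0 : ι → ℝ), ∀ᶠ y in 𝓝 (0 : ι → ℝ),
        f (p + y) = f p + ∑ i, y i * K i (y, p) := by
      have h3 : ∀ᶠ q : (ι → ℝ) × (ι → ℝ) in 𝓝 0 ×ˢ 𝓝 0,
          f (q.1 + q.2) = f q.1 + ∑ i, q.2 i * K i (q.2, q.1) := by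
        have h4 : Tendsto (fun q : (ι → ℝ) × (ι → ℝ) => (q.2, q.1)) (𝓝 0 ×ˢ 𝓝 0) (𝓝 0) := by
          rw [← nhds_prod_eq]
          apply Continuous.tendsto'
          · fun_prop
          · rfl
        filter_upwards [h4.eventually hKe] with q hq
        simpa using hq
      exact h3.curry
    filter_upwards [h1, h2, hf.eventually_analyticAt] with p h1 h2 h3 i
    have hd : HasFDerivAt (fun y => f p + ∑ i, y i * K i (y, p))
        (∑ i, K i (0, p) • ContinuousLinearMap.proj (R := ℝ) (φ := fun _ : ι => ℝ) i) 0 := by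
      apply HasFDerivAt.const_add
      apply HasFDerivAt.fun_sum
      intro i _
      have h4 : DifferentiableAt ℝ (fun y => K i (y, p)) 0 := by
        have : AnalyticAt ℝ (fun y => K i (y, p)) 0 :=
          AnalyticAt.fun_comp (g := K i) (h1 i) (analyticAt_id.prod analyticAt_const)
        exact this.differentiableAt
      have h5 := (ContinuousLinearMap.proj (R := ℝ) (φ := fun _ : ι => ℝ) i).hasFDerivAt
        (x := (0 : ι → ℝ)) |>.fun_mul h4.hasFDerivAt
      simpa using h5
    have hd2 : HasFDerivAt (fun y => f (p + y)) (fderiv ℝ f p) 0 := by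
      have h4 : HasFDerivAt f (fderiv ℝ f p) (p + 0) := by
        rw [add_zero]; exact h3.differentiableAt.hasFDerivAt
      exact (hasFDerivAt_comp_add_left p).2 h4
    have h6 := (hd2.congr_of_eventuallyEq (h2.mono fun _ h => h.symm)).unique hd
    rw [h6]
    simp [Pi.single_apply]

namespace analyticFamilies

variable {𝒰 : Ultrafilter ℕ} {ι : Type} [Fintype ι]

theorem evalAt_coordSub {p p' : ℕ → ι → ℝ} (hp : Tendsto p 𝒰 (𝓝 0)) (l : ι) :
    evalAt hp (coordSub 𝒰 p' l) = ((fun k => p k l - p' k l : ℕ → ℝ) : Germ (𝒰 : Filter ℕ) ℝ) :=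
  rfl

/-- The family `F - y`. -/
noncomputable def subConst (𝒰 : Ultrafilter ℕ) {f : (ι → ℝ) → ℝ} (hf : AnalyticAt ℝ f 0)
    (y : ℕ → ℝ) : analyticFamilies 𝒰 (ι → ℝ) :=
  ⟨((fun q => f q.2 : ℕ × (ι → ℝ) → ℝ) : Germ _ ℝ), by
    refine ⟨ℝ, inferInstance, inferInstance, inferInstance, fun p => f p.1, fun _ => 0,
      fun _ => 1, ?_, tendsto_const_nhds, by simp⟩
    exact AnalyticAt.fun_comp (g := f) hf analyticAt_fst⟩ -
  ⟨_, IsAnalyticFamily.of_const y⟩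

theorem subConst_coe {f : (ι → ℝ) → ℝ} (hf : AnalyticAt ℝ f 0) (y : ℕ → ℝ) :
    (subConst 𝒰 hf y).1 = ((fun q => f q.2 - y q.1 : ℕ × (ι → ℝ) → ℝ) : Germ _ ℝ) := rfl

/-- The ideal of a sequence of nondegenerate solutions of `F = y` is a minimal prime over
the ideal generated by `F - y`. -/
theorem ker_evalAt_mem_minimalPrimes [DecidableEq ι] {F : (ι → ℝ) → ι → ℝ}
    (hF : ∀ i, AnalyticAt ℝ (fun x => F x i) 0) {y p : ℕ → ι → ℝ} (hp : Tendsto p 𝒰 (𝓝 0))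
    (hy : ∀ᶠ k in 𝒰, F (p k) = y k)
    (hdet : ∀ᶠ k in 𝒰,
      (Matrix.of fun i l => fderiv ℝ (fun x => F x i) (p k) (Pi.single l 1)).det ≠ 0) :
    RingHom.ker (evalAt hp) ∈
      (Ideal.span (Set.range fun i => subConst 𝒰 (hF i) fun k => y k i)).minimalPrimes := by
  refine ⟨⟨RingHom.ker_isPrime _, ?_⟩, ?_⟩
  · rw [Ideal.span_le]
    rintro _ ⟨i, rfl⟩
    rw [SetLike.mem_coe, RingHom.mem_ker]
    refine Germ.coe_eq.2 ?_
    filter_upwards [hy] with k hk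
    simp [hk]
  · rintro q ⟨hq, hIq⟩ hqm
    choose K hK hKe hKd using fun i => (hF i).exists_hadamard_fderiv
    let a : Matrix ι ι (analyticFamilies 𝒰 (ι → ℝ)) := Matrix.of fun i l =>
      ⟨_, (ι → ℝ), inferInstance, inferInstance, inferInstance,
        fun r => K i l (r.1 - r.2, r.2), p, fun _ => 1, by
          apply AnalyticAt.fun_comp (g := K i l)
          · simpa [← Prod.zero_eq_mk] using hK i l
          · exact (analyticAt_fst.fun_sub analyticAt_snd).prod analyticAt_snd, hp, rfl⟩
    let X := coordSub 𝒰 p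
    let φ := fun i => subConst 𝒰 (hF i) fun k => y k i
    have hφ : a.mulVec X = φ := by
      funext i
      apply Subtype.ext
      simp only [Matrix.mulVec, dotProduct, a, X, φ, Matrix.of_apply,
        AddSubmonoidClass.coe_finsetSum, Subring.coe_mul, coordSub_coe, subConst_coe,
        ← Germ.coe_mul, germ_sum]
      apply Germ.coe_eq.2
      have hT : Tendsto (fun q : ℕ × (ι → ℝ) => (q.2 - p q.1, p q.1))
          ((𝒰 : Filter ℕ) ×ˢ 𝓝 (0 : ι → ℝ)) (𝓝 0) := by
        have h1 := hp.comp (tendsto_fst (f := (𝒰 : Filter ℕ)) (g := 𝓝 (0 : ι → ℝ)))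
        have h2 := (tendsto_snd (f := (𝒰 : Filter ℕ)) (g := 𝓝 (0 : ι → ℝ))).sub h1
        rw [sub_zero] at h2
        exact h2.prodMk_nhds h1
      filter_upwards [hT.eventually (hKe i), tendsto_fst.eventually hy] with q h1 h2
      simp only [add_sub_cancel] at h1
      rw [h1, h2]
      simp [mul_comm]
    have hmem : ∀ l, a.det * X l ∈ q := by
      intro l
      have h1 : a.det • X = a.adjugate.mulVec φ := by
        rw [← hφ, Matrix.mulVec_mulVec, Matrix.adjugate_mul, Matrix.smul_mulVec,
          Matrix.one_mulVec]
      have h2 := congrFun h1 l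
      rw [Pi.smul_apply, smul_eq_mul] at h2
      rw [h2]
      exact q.sum_mem fun i _ => q.mul_mem_left _ (hIq (Ideal.subset_span ⟨i, rfl⟩))
    have hdetq : a.det ∉ q := by
      intro h
      have h1 : evalAt hp a.det = 0 := hqm h
      rw [RingHom.map_det] at h1
      have h2 : (evalAt hp).mapMatrix a = (Germ.coeRingHom (R := ℝ) (𝒰 : Filter ℕ)).mapMatrix
          (Matrix.of fun i l => fun k => 1 * K i l (p k - p k, p k)) := by
        ext i l
        rfl
      rw [h2, ← RingHom.map_det] at h1
      have h3 : ∀ᶠ k in 𝒰, (Matrix.of fun i l => fun k => 1 * K i l (p k - p k, p k)).det k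
          = (0 : ℝ) := Germ.coe_eq.1 h1
      have h4 : ∀ᶠ k in 𝒰, ∀ i l, K i l (0, p k) =
          fderiv ℝ (fun x => F x i) (p k) (Pi.single l 1) := by
        rw [eventually_all]
        exact fun i => hp.eventually (hKd i)
      obtain ⟨k, h3, h4, h5⟩ := (h3.and (h4.and hdet)).exists
      apply h5
      rw [← h3]
      have h6 := (Pi.evalRingHom (fun _ : ℕ => ℝ) k).map_det
        (Matrix.of fun i l => fun k => 1 * K i l (p k - p k, p k))
      refine Eq.trans ?_ h6.symm
      congr 1
      ext i l
      simp [h4]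
    intro g hg
    obtain ⟨κ, rfl⟩ := exists_eq_sum_of_evalAt_eq_zero hp hg
    exact q.sum_mem fun l _ =>
      q.mul_mem_right _ ((hq.mem_or_mem (hmem l)).resolve_left hdetq)

end analyticFamilies

open analyticFamilies in
/-- The number of nondegenerate solutions of an analytic system `F x = y` near `0` is bounded
uniformly in `y`. -/
theorem exists_card_fiber_le {ι : Type} [Fintype ι] [DecidableEq ι] {F : (ι → ℝ) → ι → ℝ}
    (hF : ∀ i, AnalyticAt ℝ (fun x => F x i) 0) :
    ∃ N : ℕ, ∃ V ∈ 𝓝 (0 : ι → ℝ), ∀ y, ∀ s : Finset (ι → ℝ),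
      (∀ x ∈ s, x ∈ V ∧ F x = y ∧
        (Matrix.of fun i l => fderiv ℝ (fun x => F x i) x (Pi.single l 1)).det ≠ 0) →
      s.card ≤ N := by
  by_contra! h
  choose y s hs hcard using fun k : ℕ =>
    h k (ball 0 (1 / ((k : ℝ) + 1))) (ball_mem_nhds _ Nat.one_div_pos_of_nat)
  let p : ℕ → ℕ → ι → ℝ := fun j k =>
    if h : j < (s k).card then ((s k).equivFin.symm ⟨j, h⟩ : ι → ℝ) else 0
  have hps : ∀ {j k}, j ≤ k → p j k ∈ s k := by
    intro j k hjk
    have h1 : j < (s k).card := lt_of_le_of_lt hjk (hcard k)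
    simp only [p, h1, dif_pos]
    exact Subtype.prop _
  have hinj : ∀ {i j k}, i ≤ k → j ≤ k → p i k = p j k → i = j := by
    intro i j k hik hjk hij
    have h1 : i < (s k).card := lt_of_le_of_lt hik (hcard k)
    have h2 : j < (s k).card := lt_of_le_of_lt hjk (hcard k)
    simp only [p, h1, h2, dif_pos] at hij
    simpa using (s k).equivFin.symm.injective (Subtype.ext hij)
  let 𝒰 : Ultrafilter ℕ := hyperfilter ℕ
  have h𝒰 : (𝒰 : Filter ℕ) ≤ atTop := Nat.hyperfilter_le_atTop
  have hge : ∀ j, ∀ᶠ k in (𝒰 : Filter ℕ), j ≤ k := fun j => h𝒰 (eventually_ge_atTop j)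
  have hp : ∀ j, Tendsto (p j) 𝒰 (𝓝 0) := by
    intro j
    refine Tendsto.mono_left ?_ h𝒰
    rw [tendsto_zero_iff_norm_tendsto_zero]
    refine squeeze_zero' (Eventually.of_forall fun _ => norm_nonneg _) ?_
      tendsto_one_div_add_atTop_nhds_zero_nat
    filter_upwards [eventually_ge_atTop j] with k hk
    exact (mem_ball_zero_iff.1 (hs k _ (hps hk)).1).le
  have hmin : ∀ j, RingHom.ker (evalAt (hp j)) ∈
      (Ideal.span (Set.range fun i => subConst 𝒰 (hF i) fun k => y k i)).minimalPrimes := by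
    intro j
    apply ker_evalAt_mem_minimalPrimes hF (hp j)
    · filter_upwards [hge j] with k hk using (hs k _ (hps hk)).2.1
    · filter_upwards [hge j] with k hk using (hs k _ (hps hk)).2.2
  have hne : Function.Injective fun j => RingHom.ker (evalAt (hp j)) := by
    intro i j hij
    have h1 : ∀ l, evalAt (hp i) (coordSub 𝒰 (p j) l) = 0 := by
      intro l
      rw [← RingHom.mem_ker, show RingHom.ker (evalAt (hp i)) = _ from hij, RingHom.mem_ker,
        evalAt_coordSub]
      exact Germ.coe_eq.2 (Eventually.of_forall fun k => sub_self _)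
    have h2 : ∀ᶠ k in 𝒰, ∀ l, p i k l - p j k l = 0 := by
      rw [eventually_all]
      exact fun l => Germ.coe_eq.1 (h1 l)
    obtain ⟨k, h2, h3, h4⟩ := (h2.and ((hge i).and (hge j))).exists
    exact hinj h3 h4 (funext fun l => sub_eq_zero.1 (h2 l))
  have := analyticFamilies.isNoetherianRing 𝒰 (ι → ℝ)
  exact Set.infinite_of_injective_forall_mem hne hmin
    (Ideal.finite_minimalPrimes_of_isNoetherianRing _ _)

/-- The Jacobian determinant of a family of functions. -/
noncomputable def jacobian {ι : Type} [Fintype ι] [DecidableEq ι] (f : ι → (ι → ℝ) → ℝ)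
    (x : ι → ℝ) : ℝ :=
  (Matrix.of fun r k => fderiv ℝ (f k) x (Pi.single r 1)).det

section

variable {ι : Type} [Fintype ι] [DecidableEq ι]

theorem jacobian_eq_det (f : ι → (ι → ℝ) → ℝ) (x : ι → ℝ) :
    jacobian f x = (ContinuousLinearMap.pi fun i => fderiv ℝ (f i) x).det := by
  rw [ContinuousLinearMap.det, ← LinearMap.det_toMatrix', ← Matrix.det_transpose, jacobian]
  congr 1

theorem AnalyticAt.jacobian {f : ι → (ι → ℝ) → ℝ} {x : ι → ℝ} (hf : ∀ i, AnalyticAt ℝ (f i) x) :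
    AnalyticAt ℝ (jacobian f) x := by
  have : _root_.jacobian f = fun x => ∑ σ : Equiv.Perm ι, ((Equiv.Perm.sign σ : ℤ) : ℝ) *
      ∏ i, fderiv ℝ (f i) x (Pi.single (σ i) 1) := by
    funext x
    rw [_root_.jacobian, Matrix.det_apply']
    rfl
  rw [this]
  refine Finset.analyticAt_fun_sum _ fun σ _ => analyticAt_const.fun_mul ?_
  refine Finset.analyticAt_fun_prod _ fun i _ => ?_
  exact (hf i).fderiv.clm_apply analyticAt_const

theorem ContinuousLinearMap.exists_approximatesLinearOn_injOn {E : Type*} [NormedAddCommGroup E]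
    [NormedSpace ℝ E] [FiniteDimensional ℝ E] (A : E →L[ℝ] E) :
    ∃ r : ℝ≥0, r ≠ 0 ∧ (A.det ≠ 0 → ∀ (f : E → E) (s : Set E),
      ApproximatesLinearOn f A s r → Set.InjOn f s) := by
  by_cases hA : A.det ≠ 0
  · rcases subsingleton_or_nontrivial E with hE | hE
    · exact ⟨1, one_ne_zero, fun _ f s _ => Set.injOn_of_injective (Function.injective_of_subsingleton f)⟩
    · set e := A.toContinuousLinearEquivOfDetNeZero hA with he
      have hpos : 0 < ‖(e.symm : E →L[ℝ] E)‖₊⁻¹ := inv_pos.2 e.nnnorm_symm_pos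
      refine ⟨_, (half_pos hpos).ne', fun _ f s h => ?_⟩
      refine ApproximatesLinearOn.injOn (f' := e) ?_ (Or.inr (half_lt_self hpos))
      simpa [he] using h
  · exact ⟨1, one_ne_zero, fun h => absurd h hA⟩

/-- If the nondegenerate fibres of `f` in the open set `V` have at most `N` points, the change of
variables formula holds as an inequality with a factor `N`. -/
theorem lintegral_comp_mul_jacobian_le_of_card_fiber_le {f : ι → (ι → ℝ) → ℝ} {V : Set (ι → ℝ)}
    (hV : IsOpen V) (hf : ∀ i, AnalyticOnNhd ℝ (f i) V) {N : ℕ}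
    (hN : ∀ y, ∀ s : Finset (ι → ℝ), (∀ x ∈ s, x ∈ V ∧ (fun i => f i x) = y ∧ jacobian f x ≠ 0) →
      s.card ≤ N) {ψ : (ι → ℝ) → ℝ≥0∞} (hψ : Measurable ψ) :
    ∫⁻ x in V, ψ (fun i => f i x) * ENNReal.ofReal |jacobian f x| ≤ N * ∫⁻ y, ψ y := by
  let F : (ι → ℝ) → ι → ℝ := fun x i => f i x
  let F' : (ι → ℝ) → (ι → ℝ) →L[ℝ] (ι → ℝ) := fun x => ContinuousLinearMap.pi fun i => fderiv ℝ (f i) x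
  have hF' : ∀ x ∈ V, HasFDerivAt F (F' x) x := fun x hx =>
    hasFDerivAt_pi.2 fun i => (hf i x hx).differentiableAt.hasFDerivAt
  have hJc : ContinuousOn (jacobian f) V := fun x hx =>
    (AnalyticAt.jacobian fun i => hf i x hx).continuousAt.continuousWithinAt
  let T := V ∩ jacobian f ⁻¹' {0}ᶜ
  have hTo : IsOpen T := hJc.isOpen_inter_preimage hV isOpen_compl_singleton
  choose r hr0 hr using fun A : (ι → ℝ) →L[ℝ] (ι → ℝ) => A.exists_approximatesLinearOn_injOn
  obtain ⟨t, A, htd, htm, htT, htA, hA⟩ := exists_partition_approximatesLinearOn_of_hasFDerivWithinAt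
    F T F' (fun x hx => (hF' x hx.1).hasFDerivWithinAt) r hr0
  have hinj : ∀ n, Set.InjOn F (T ∩ t n) := by
    intro n
    rcases T.eq_empty_or_nonempty with h | h
    · simp [h]
    · obtain ⟨y, hy, hAy⟩ := hA h n
      refine hr (A n) ?_ F _ (htA n)
      rw [hAy, ← jacobian_eq_det]
      exact hy.2
  have hTm : ∀ n, MeasurableSet (T ∩ t n) := fun n => hTo.measurableSet.inter (htm n)
  have hder : ∀ n, ∀ x ∈ T ∩ t n, HasFDerivWithinAt F (F' x) (T ∩ t n) x := fun n x hx =>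
    (hF' x hx.1.1).hasFDerivWithinAt
  have him : ∀ n, MeasurableSet (F '' (T ∩ t n)) := fun n =>
    measurable_image_of_fderivWithin (hTm n) (hder n) (hinj n)
  have h1 : ∫⁻ x in V, ψ (F x) * ENNReal.ofReal |jacobian f x| =
      ∫⁻ x in T, ψ (F x) * ENNReal.ofReal |jacobian f x| := by
    rw [← lintegral_indicator hV.measurableSet, ← lintegral_indicator hTo.measurableSet]
    congr 1
    funext x
    by_cases hx : x ∈ V
    · by_cases hx2 : jacobian f x = 0
      · simp [Set.indicator, hx2]
      · have : x ∈ T := ⟨hx, hx2⟩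
        simp [hx, this]
    · have : x ∉ T := fun h => hx h.1
      simp [hx, this]
  have h2 : T = ⋃ n, T ∩ t n := by
    rw [← Set.inter_iUnion, Set.inter_eq_left.2 htT]
  have h3 : ∀ n, ∫⁻ x in T ∩ t n, ψ (F x) * ENNReal.ofReal |jacobian f x| =
      ∫⁻ y, (F '' (T ∩ t n)).indicator ψ y := by
    intro n
    rw [lintegral_indicator (him n),
      lintegral_image_eq_lintegral_abs_det_fderiv_mul volume (hTm n) (hder n) (hinj n)]
    refine lintegral_congr fun x => ?_
    rw [jacobian_eq_det, mul_comm]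
  calc ∫⁻ x in V, ψ (F x) * ENNReal.ofReal |jacobian f x|
      = ∑' n, ∫⁻ y, (F '' (T ∩ t n)).indicator ψ y := by
        rw [h1]
        nth_rw 1 [h2]
        rw [lintegral_iUnion hTm fun i j hij => ((htd hij).mono Set.inter_subset_right
          Set.inter_subset_right)]
        exact tsum_congr h3
    _ = ∫⁻ y, ∑' n, (F '' (T ∩ t n)).indicator ψ y :=
        (lintegral_tsum fun n => (hψ.indicator (him n)).aemeasurable).symm
    _ ≤ ∫⁻ y, N * ψ y := by
        refine lintegral_mono fun y => ?_
        refine ENNReal.summable.tsum_le_of_sum_le fun J => ?_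
        classical
        rw [Finset.sum_indicator_eq_sum_filter, Finset.sum_const, nsmul_eq_mul]
        gcongr
        have hmem : ∀ n ∈ J.filter (fun n => y ∈ F '' (T ∩ t n)), y ∈ F '' (T ∩ t n) :=
          fun n hn => (Finset.mem_filter.1 hn).2
        choose! x hx hxy using hmem
        rw [← Finset.card_image_of_injOn (f := x)]
        · refine hN y _ ?_
          intro z hz
          obtain ⟨n, hn, rfl⟩ := Finset.mem_image.1 hz
          exact ⟨(hx n hn).1.1, hxy n hn, (hx n hn).1.2⟩
        · intro i hi j hj hij
          by_contra hne
          refine Set.disjoint_left.1 (htd hne) (hx i hi).2 ?_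
          rw [hij]
          exact (hx j hj).2
    _ = N * ∫⁻ y, ψ y := lintegral_const_mul _ hψ

/-- The change of variables inequality for an analytic map on a compact set. -/
theorem exists_lintegral_comp_mul_jacobian_le {f : ι → (ι → ℝ) → ℝ} {B : Set (ι → ℝ)}
    (hB : IsCompact B) (hf : ∀ i, AnalyticOnNhd ℝ (f i) B) :
    ∃ N : ℕ, ∀ ψ : (ι → ℝ) → ℝ≥0∞, Measurable ψ →
      ∫⁻ x in B, ψ (fun i => f i x) * ENNReal.ofReal |jacobian f x| ≤ N * ∫⁻ y, ψ y := by
  refine hB.induction_on (p := fun S => ∃ N : ℕ, ∀ ψ : (ι → ℝ) → ℝ≥0∞, Measurable ψ →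
      ∫⁻ x in S, ψ (fun i => f i x) * ENNReal.ofReal |jacobian f x| ≤ N * ∫⁻ y, ψ y) ?_ ?_ ?_ ?_
  · exact ⟨0, fun ψ _ => by simp⟩
  · rintro s t hst ⟨N, hN⟩
    exact ⟨N, fun ψ hψ => (lintegral_mono_set hst).trans (hN ψ hψ)⟩
  · rintro s t ⟨N, hN⟩ ⟨M, hM⟩
    refine ⟨N + M, fun ψ hψ => (lintegral_union_le _ _ _).trans ?_⟩
    push_cast
    rw [add_mul]
    exact add_le_add (hN ψ hψ) (hM ψ hψ)
  · intro x₀ hx₀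
    have h0 : ∀ i, AnalyticAt ℝ (fun x => f i (x₀ + x)) 0 := by
      intro i
      apply AnalyticAt.fun_comp (g := f i)
      · simpa using hf i x₀ hx₀
      · exact analyticAt_const.fun_add analyticAt_id
    obtain ⟨N, V, hV, hN⟩ := exists_card_fiber_le (F := fun x i => f i (x₀ + x)) h0
    have hV' : ∀ᶠ x in 𝓝 x₀, x - x₀ ∈ V := by
      have : Tendsto (fun x => x - x₀) (𝓝 x₀) (𝓝 0) := by
        apply Continuous.tendsto'
        · fun_prop
        · simp
      exact this.eventually hV
    have ha : ∀ᶠ x in 𝓝 x₀, ∀ i, AnalyticAt ℝ (f i) x := by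
      rw [eventually_all]
      exact fun i => (hf i x₀ hx₀).eventually_analyticAt
    obtain ⟨W, hW, hWo, hxW⟩ := _root_.eventually_nhds_iff.1 (hV'.and ha)
    refine ⟨W, mem_nhdsWithin_of_mem_nhds (hWo.mem_nhds hxW), N, fun ψ hψ => ?_⟩
    refine lintegral_comp_mul_jacobian_le_of_card_fiber_le hWo (fun i x hx => (hW x hx).2 i) ?_ hψ
    intro y s hs
    rw [← Finset.card_image_of_injective s (sub_left_injective (b := x₀))]
    refine hN y _ ?_
    intro z hz
    obtain ⟨x, hx, rfl⟩ := Finset.mem_image.1 hz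
    obtain ⟨hxW, hxy, hxJ⟩ := hs x hx
    refine ⟨(hW x hxW).1, by simpa using hxy, ?_⟩
    rw [← Matrix.det_transpose]
    convert hxJ using 1
    rw [jacobian]
    congr 1
    ext r k
    simp [fderiv_comp_add_left]

end

theorem fderiv_eq_zero_of_eqOn_zero_compl {E : Type*} [NormedAddCommGroup E]
    [NormedSpace ℝ E] {P : E → ℝ} {A : Set E} (hA : IsClosed A)
    (h0 : ∀ x ∉ A, P x = 0) {x : E} (hx : x ∉ A) : fderiv ℝ P x = 0 := by
  have : P =ᶠ[𝓝 x] fun _ => 0 := by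
    filter_upwards [hA.isOpen_compl.mem_nhds hx] with y hy using h0 y hy
  rw [this.fderiv_eq]
  simp

section

variable {ι : Type} [Fintype ι]

theorem HasCompactSupport.integral_fderiv_apply_eq_zero {P : (ι → ℝ) → ℝ} (hP : ContDiff ℝ 1 P)
    (hc : HasCompactSupport P) (v : ι → ℝ) : ∫ x, fderiv ℝ P x v = 0 := by
  have hi : Integrable fun x => fderiv ℝ P x v := by
    apply Continuous.integrable_of_hasCompactSupport
    · exact (hP.continuous_fderiv one_ne_zero).clm_apply continuous_const
    · exact (hc.fderiv (𝕜 := ℝ)).comp_left (g := fun ℓ : (ι → ℝ) →L[ℝ] ℝ => ℓ v) rfl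
  have := integral_mul_fderiv_eq_neg_fderiv_mul_of_integrable (μ := volume) (f := fun _ => (1 : ℝ))
    (g := P) (v := v) (by simp) (by simpa using hi)
    (by simpa using hP.continuous.integrable_of_hasCompactSupport hc)
    (fun x _ => differentiableAt_const 1) (fun x _ => (hP.differentiable one_ne_zero) x)
  simpa using this

theorem contDiff_of_eqOn_zero_compl {P : (ι → ℝ) → ℝ} {A : Set (ι → ℝ)} (hA : IsClosed A)
    (h0 : ∀ x ∉ A, P x = 0) {n : ℕ∞} (hP : ∀ x ∈ A, ContDiffAt ℝ n P x) : ContDiff ℝ n P := by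
  rw [contDiff_iff_contDiffAt]
  intro x
  by_cases hx : x ∈ A
  · exact hP x hx
  · have : P =ᶠ[𝓝 x] fun _ => 0 := by
      filter_upwards [hA.isOpen_compl.mem_nhds hx] with y hy using h0 y hy
    exact contDiffAt_const.congr_of_eventuallyEq this

variable [DecidableEq ι]

theorem exists_jacobian_update_eq (f : ι → (ι → ℝ) → ℝ) (k : ι) (x : ι → ℝ) :
    ∃ Λ : ((ι → ℝ) →L[ℝ] ℝ) →ₗ[ℝ] ℝ, ∀ g : (ι → ℝ) → ℝ,
      jacobian (Function.update f k g) x = Λ (fderiv ℝ g x) := by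
  let M : Matrix ι ι ℝ := Matrix.of fun r k => fderiv ℝ (f k) x (Pi.single r 1)
  let L : ((ι → ℝ) →L[ℝ] ℝ) →ₗ[ℝ] (ι → ℝ) :=
    { toFun := fun ℓ r => ℓ (Pi.single r 1)
      map_add' := fun _ _ => rfl
      map_smul' := fun _ _ => rfl }
  refine ⟨(LinearMap.proj k).comp (M.cramer.comp L), fun g => ?_⟩
  simp only [LinearMap.comp_apply, LinearMap.proj_apply, Matrix.cramer_apply, jacobian]
  congr 1
  ext r j
  rw [Matrix.updateCol_apply, Matrix.of_apply, Function.update_apply]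
  split_ifs <;> rfl

/-- The Jacobian is a null Lagrangian: this is its divergence form. -/
theorem jacobian_update_eq_sum_fderiv {f : ι → (ι → ℝ) → ℝ} {g : (ι → ℝ) → ℝ} {x : ι → ℝ} (k : ι)
    (hf : ∀ i, AnalyticAt ℝ (f i) x) (hg : DifferentiableAt ℝ g x) :
    jacobian (Function.update f k g) x = ∑ σ : Equiv.Perm ι, ((Equiv.Perm.sign σ : ℤ) : ℝ) *
      fderiv ℝ (fun y => g y * ∏ j ∈ Finset.univ.erase k, fderiv ℝ (f j) y (Pi.single (σ j) 1)) x
        (Pi.single (σ k) 1) := by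
  have hd : ∀ (j : ι) (v : ι → ℝ), HasFDerivAt (fun y => fderiv ℝ (f j) y v)
      ((fderiv ℝ (fderiv ℝ (f j)) x).flip v) x := by
    intro j v
    have := ((hf j).fderiv.differentiableAt.hasFDerivAt).clm_apply (hasFDerivAt_const v x)
    simpa using this
  have hsym : ∀ (j : ι) (v w : ι → ℝ),
      fderiv ℝ (fderiv ℝ (f j)) x v w = fderiv ℝ (fderiv ℝ (f j)) x w v := fun j v w =>
    (hf j).contDiffAt.isSymmSndFDerivAt_of_omega v w
  have hP : ∀ σ : Equiv.Perm ι, fderiv ℝ (fun y => g y * ∏ j ∈ Finset.univ.erase k,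
      fderiv ℝ (f j) y (Pi.single (σ j) 1)) x (Pi.single (σ k) 1) =
      g x * (∑ l ∈ Finset.univ.erase k, (∏ j ∈ (Finset.univ.erase k).erase l,
        fderiv ℝ (f j) x (Pi.single (σ j) 1)) *
        fderiv ℝ (fderiv ℝ (f l)) x (Pi.single (σ k) 1) (Pi.single (σ l) 1)) +
      (∏ j ∈ Finset.univ.erase k, fderiv ℝ (f j) x (Pi.single (σ j) 1)) *
        fderiv ℝ g x (Pi.single (σ k) 1) := by
    intro σ
    have h1 := HasFDerivAt.finsetProd (u := Finset.univ.erase k)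
      (fun j _ => hd j (Pi.single (σ j) (1 : ℝ)))
    rw [(hg.hasFDerivAt.fun_mul h1).fderiv]
    simp
  have hJ : jacobian (Function.update f k g) x = ∑ σ : Equiv.Perm ι,
      ((Equiv.Perm.sign σ : ℤ) : ℝ) *
      ((∏ j ∈ Finset.univ.erase k, fderiv ℝ (f j) x (Pi.single (σ j) 1)) *
        fderiv ℝ g x (Pi.single (σ k) 1)) := by
    rw [jacobian, Matrix.det_apply']
    refine Finset.sum_congr rfl fun σ _ => ?_
    rw [← Finset.prod_erase_mul _ _ (Finset.mem_univ k)]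
    congr 2
    · refine Finset.prod_congr rfl fun j hj => ?_
      rw [Matrix.of_apply, Function.update_of_ne (Finset.ne_of_mem_erase hj)]
    · rw [Matrix.of_apply, Function.update_self]
  rw [hJ]
  simp_rw [hP, mul_add, Finset.sum_add_distrib]
  rw [right_eq_add]
  simp_rw [Finset.mul_sum]
  rw [Finset.sum_comm]
  refine Finset.sum_eq_zero fun l hl => ?_
  have hkl : k ≠ l := (Finset.ne_of_mem_erase hl).symm
  rw [← add_self_eq_zero]
  nth_rw 1 [← Equiv.sum_comp (Equiv.mulRight (Equiv.swap k l))]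
  rw [← Finset.sum_add_distrib]
  refine Finset.sum_eq_zero fun σ _ => ?_
  have h1 : ∏ j ∈ (Finset.univ.erase k).erase l,
      fderiv ℝ (f j) x (Pi.single ((σ * Equiv.swap k l) j) 1) =
      ∏ j ∈ (Finset.univ.erase k).erase l, fderiv ℝ (f j) x (Pi.single (σ j) 1) := by
    refine Finset.prod_congr rfl fun j hj => ?_
    rw [Finset.mem_erase, Finset.mem_erase] at hj
    rw [Equiv.Perm.mul_apply, Equiv.swap_apply_of_ne_of_ne hj.2.1 hj.1]
  simp only [Equiv.coe_mulRight]
  rw [h1]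
  simp only [Equiv.Perm.mul_apply, Equiv.swap_apply_left, Equiv.swap_apply_right,
    Equiv.Perm.sign_mul, Equiv.Perm.sign_swap hkl]
  rw [hsym l (Pi.single (σ l) 1)]
  push_cast
  ring

theorem integrable_jacobian_update_and_integral_eq_zero {f : ι → (ι → ℝ) → ℝ} {g : (ι → ℝ) → ℝ}
    {A : Set (ι → ℝ)} (k : ι) (hA : IsCompact A) (hf : ∀ i, AnalyticOnNhd ℝ (f i) A)
    (hg : ContDiff ℝ 1 g) (hgA : ∀ x ∉ A, g x = 0) :
    Integrable (jacobian (Function.update f k g)) ∧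
      ∫ x, jacobian (Function.update f k g) x = 0 := by
  let P : Equiv.Perm ι → (ι → ℝ) → ℝ := fun σ y =>
    g y * ∏ j ∈ Finset.univ.erase k, fderiv ℝ (f j) y (Pi.single (σ j) 1)
  have hP0 : ∀ σ, ∀ x ∉ A, P σ x = 0 := fun σ x hx => by simp [P, hgA x hx]
  have hPc : ∀ σ, ContDiff ℝ 1 (P σ) := by
    intro σ
    refine contDiff_of_eqOn_zero_compl hA.isClosed (hP0 σ) fun x hx => ?_
    refine hg.contDiffAt.mul (contDiffAt_prod fun j _ => ?_)
    exact ((hf j x hx).fderiv.clm_apply analyticAt_const).contDiffAt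
  have hPs : ∀ σ, HasCompactSupport (P σ) := fun σ => HasCompactSupport.intro hA (hP0 σ)
  have hJ : ∀ x, jacobian (Function.update f k g) x = ∑ σ : Equiv.Perm ι,
      ((Equiv.Perm.sign σ : ℤ) : ℝ) * fderiv ℝ (P σ) x (Pi.single (σ k) 1) := by
    intro x
    by_cases hx : x ∈ A
    · exact jacobian_update_eq_sum_fderiv k (fun i => hf i x hx) (hg.differentiable one_ne_zero x)
    · obtain ⟨Λ, hΛ⟩ := exists_jacobian_update_eq f k x
      rw [hΛ, fderiv_eq_zero_of_eqOn_zero_compl hA.isClosed hgA hx, map_zero]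
      refine (Finset.sum_eq_zero fun σ _ => ?_).symm
      rw [fderiv_eq_zero_of_eqOn_zero_compl hA.isClosed (hP0 σ) hx]
      simp
  have hi : ∀ σ : Equiv.Perm ι, Integrable fun x =>
      ((Equiv.Perm.sign σ : ℤ) : ℝ) * fderiv ℝ (P σ) x (Pi.single (σ k) 1) := by
    intro σ
    apply Integrable.const_mul
    apply Continuous.integrable_of_hasCompactSupport
    · exact ((hPc σ).continuous_fderiv one_ne_zero).clm_apply continuous_const
    · exact ((hPs σ).fderiv (𝕜 := ℝ)).comp_left
        (g := fun ℓ : (ι → ℝ) →L[ℝ] ℝ => ℓ (Pi.single (σ k) 1)) rfl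
  rw [funext hJ]
  refine ⟨integrable_finsetSum _ fun σ _ => hi σ, ?_⟩
  rw [integral_finsetSum _ fun σ _ => hi σ]
  refine Finset.sum_eq_zero fun σ _ => ?_
  rw [integral_const_mul, (hPs σ).integral_fderiv_apply_eq_zero (hPc σ), mul_zero]

end

section

variable {ι : Type} [Fintype ι]

theorem lintegral_prod_apply_eq_prod {ψ : ι → ℝ → ℝ≥0∞} (hψ : ∀ j, Measurable (ψ j)) :
    ∫⁻ y : ι → ℝ, ∏ j, ψ j (y j) = ∏ j, ∫⁻ s, ψ j s := by
  classical
  have key : ∀ s : Finset ι, lmarginal (fun _ : ι => (volume : Measure ℝ)) s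
      (fun y => ∏ j ∈ s, ψ j (y j)) = fun _ => ∏ j ∈ s, ∫⁻ t, ψ j t := by
    intro s
    induction s using Finset.induction_on with
    | empty => simp
    | insert i s hi ih =>
      rw [lmarginal_insert' _ (by fun_prop) hi]
      have h1 : (fun x : ι → ℝ => ∫⁻ t, ∏ j ∈ insert i s, ψ j (Function.update x i t j)) =
          fun x => (∫⁻ t, ψ i t) * ∏ j ∈ s, ψ j (x j) := by
        funext x
        rw [← lintegral_mul_const _ (hψ i)]
        refine lintegral_congr fun t => ?_
        rw [Finset.prod_insert hi, Function.update_self]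
        congr 1
        refine Finset.prod_congr rfl fun j hj => ?_
        rw [Function.update_of_ne (ne_of_mem_of_not_mem hj hi)]
      rw [h1]
      funext x
      rw [Finset.prod_insert hi, ← congrFun ih x, lmarginal, lmarginal, lintegral_const_mul]
      fun_prop
  rw [volume_pi, lintegral_eq_lmarginal_univ (fun _ => 0), key]

/-- The Dirichlet-type tail `∫_{|y| ≥ c} y⁻² dy`. -/
theorem setLIntegral_inv_sq_le {c : ℝ} (hc : 0 < c) :
    ∫⁻ y in {y : ℝ | c ≤ |y|}, ENNReal.ofReal ((y ^ 2)⁻¹) ≤ 2 * ENNReal.ofReal c⁻¹ := by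
  have hset : {y : ℝ | c ≤ |y|} = Set.Ici c ∪ Set.Iic (-c) := by
    ext y
    simp only [Set.mem_ofPred_eq, le_abs, Set.mem_union, Set.mem_Ici, Set.mem_Iic, le_neg]
  have hd : ∀ y : ℝ, y ≠ 0 → HasDerivAt (fun y => -y⁻¹) ((y ^ 2)⁻¹) y := fun y hy => by
    simpa using (hasDerivAt_inv hy).fun_neg
  rw [hset, two_mul]
  refine (lintegral_union_le _ _ _).trans (add_le_add ?_ ?_)
  · rw [lintegral_deriv_eq_volume_image_of_monotoneOn (f := fun y => -y⁻¹) measurableSet_Ici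
      (fun y hy => (hd y (hc.trans_le hy).ne').hasDerivWithinAt)]
    · refine (measure_mono (t := Set.Icc (-c⁻¹) 0) ?_).trans (by simp)
      rintro _ ⟨y, hy, rfl⟩
      have h1 : 0 < y := hc.trans_le hy
      exact ⟨neg_le_neg (inv_anti₀ hc hy), neg_nonpos.2 (inv_nonneg.2 h1.le)⟩
    · intro y hy z hz hyz
      exact neg_le_neg (inv_anti₀ (hc.trans_le hy) hyz)
  · have hlt : ∀ y ∈ Set.Iic (-c), y < 0 := fun y hy => lt_of_le_of_lt hy (neg_lt_zero.2 hc)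
    rw [lintegral_deriv_eq_volume_image_of_monotoneOn (f := fun y => -y⁻¹) measurableSet_Iic
      (fun y hy => (hd y (hlt y hy).ne).hasDerivWithinAt)]
    · refine (measure_mono (t := Set.Icc 0 c⁻¹) ?_).trans (by simp)
      rintro _ ⟨y, hy, rfl⟩
      have h1 : c ≤ -y := le_neg.1 hy
      refine ⟨neg_nonneg.2 (inv_nonpos.2 (hlt y hy).le), ?_⟩
      change -y⁻¹ ≤ c⁻¹
      rw [← inv_neg]
      exact inv_anti₀ hc h1
    · intro y hy z hz hyz
      simp only
      rw [← inv_neg, ← inv_neg]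
      exact inv_anti₀ (neg_pos.2 (hlt z hz)) (neg_le_neg hyz)

variable [DecidableEq ι]

theorem exists_lintegral_prod_comp_mul_jacobian_le {f : ι → (ι → ℝ) → ℝ} {K : Set (ι → ℝ)}
    (hK : IsCompact K) (hf : ∀ i, AnalyticOnNhd ℝ (f i) K) :
    ∃ N : ℕ, ∀ ψ : ι → ℝ → ℝ≥0∞, (∀ j, Measurable (ψ j)) →
      ∫⁻ x in K, (∏ j, ψ j (f j x)) * ENNReal.ofReal |jacobian f x| ≤ N * ∏ j, ∫⁻ s, ψ j s := by
  obtain ⟨N, hN⟩ := exists_lintegral_comp_mul_jacobian_le hK hf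
  refine ⟨N, fun ψ hψ => ?_⟩
  rw [← lintegral_prod_apply_eq_prod hψ]
  exact hN (fun y => ∏ j, ψ j (y j)) (by fun_prop)

theorem lintegral_indicator_abs_le (δ : ℝ) :
    ∫⁻ s, (Set.Icc (-δ) δ).indicator (fun _ => (1 : ℝ≥0∞)) s = ENNReal.ofReal (2 * δ) := by
  rw [lintegral_indicator measurableSet_Icc]
  simp only [lintegral_const, Measure.restrict_apply, MeasurableSet.univ, Set.univ_inter, one_mul,
    Real.volume_Icc]
  congr 1
  ring

theorem exists_setLIntegral_slot_le {f : ι → (ι → ℝ) → ℝ} {K : Set (ι → ℝ)}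
    (hK : IsCompact K) (hf : ∀ i, AnalyticOnNhd ℝ (f i) K) (k : ι) :
    ∃ N : ℕ, ∀ (δ : ι → ℝ) (Ψ : ℝ → ℝ≥0∞), Measurable Ψ → ∀ A ⊆ K, MeasurableSet A →
      (∀ x ∈ A, ∀ j ≠ k, |f j x| ≤ δ j) →
      ∫⁻ x in A, Ψ (f k x) * ENNReal.ofReal |jacobian f x| ≤
        N * ((∏ j ∈ Finset.univ.erase k, ENNReal.ofReal (2 * δ j)) * ∫⁻ s, Ψ s) := by
  obtain ⟨N, hN⟩ := exists_lintegral_prod_comp_mul_jacobian_le hK hf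
  refine ⟨N, fun δ Ψ hΨ A hAK hAm hA => ?_⟩
  let ψ : ι → ℝ → ℝ≥0∞ := fun j => if j = k then Ψ else (Set.Icc (-δ j) (δ j)).indicator fun _ => 1
  have hψ : ∀ j, Measurable (ψ j) := by
    intro j
    by_cases h : j = k
    · simpa [ψ, h] using hΨ
    · simpa only [ψ, h, if_false] using measurable_const.indicator measurableSet_Icc
  calc ∫⁻ x in A, Ψ (f k x) * ENNReal.ofReal |jacobian f x|
      = ∫⁻ x in A, (∏ j, ψ j (f j x)) * ENNReal.ofReal |jacobian f x| := by
        refine setLIntegral_congr_fun hAm fun x hx => ?_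
        congr 1
        rw [← Finset.prod_erase_mul _ _ (Finset.mem_univ k), Finset.prod_eq_one, one_mul]
        · simp [ψ]
        · intro j hj
          have hj := Finset.ne_of_mem_erase hj
          simp only [ψ, hj, if_false]
          exact Set.indicator_of_mem (s := Set.Icc _ _) (abs_le.1 (hA x hx j hj)) _
    _ ≤ ∫⁻ x in K, (∏ j, ψ j (f j x)) * ENNReal.ofReal |jacobian f x| := lintegral_mono_set hAK
    _ ≤ N * ∏ j, ∫⁻ s, ψ j s := hN ψ hψ
    _ = _ := by
        rw [← Finset.prod_erase_mul _ _ (Finset.mem_univ k)]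
        congr 2
        · refine Finset.prod_congr rfl fun j hj => ?_
          simp only [ψ, Finset.ne_of_mem_erase hj, if_false]
          exact lintegral_indicator_abs_le _
        · simp [ψ]

/-- The sublevel set estimate for a nondegenerate system. -/
theorem exists_measureReal_le {f : ι → (ι → ℝ) → ℝ} {K : Set (ι → ℝ)}
    (hK : IsCompact K) (hf : ∀ i, AnalyticOnNhd ℝ (f i) K) :
    ∃ C : ℝ, 0 ≤ C ∧ ∀ (δ : ι → ℝ) (c : ℝ), (∀ j, 0 ≤ δ j) → 0 < c → ∀ A ⊆ K, MeasurableSet A →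
      (∀ x ∈ A, (∀ j, |f j x| ≤ δ j) ∧ c ≤ |jacobian f x|) →
      volume.real A ≤ C * ((∏ j, δ j) / c) := by
  obtain ⟨N, hN⟩ := exists_lintegral_prod_comp_mul_jacobian_le hK hf
  refine ⟨N * 2 ^ Fintype.card ι, by positivity, fun δ c hδ hc A hAK hAm hA => ?_⟩
  let ψ : ι → ℝ → ℝ≥0∞ := fun j => (Set.Icc (-δ j) (δ j)).indicator fun _ => 1
  have hψ : ∀ j, Measurable (ψ j) := fun j => measurable_const.indicator measurableSet_Icc
  have h1 : ENNReal.ofReal c * volume A ≤ ENNReal.ofReal (N * ∏ j, 2 * δ j) := by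
    calc ENNReal.ofReal c * volume A = ∫⁻ x in A, ENNReal.ofReal c := by simp
      _ ≤ ∫⁻ x in A, (∏ j, ψ j (f j x)) * ENNReal.ofReal |jacobian f x| := by
        refine setLIntegral_mono' hAm fun x hx => ?_
        rw [Finset.prod_eq_one, one_mul]
        · exact ENNReal.ofReal_le_ofReal (hA x hx).2
        · exact fun j _ => Set.indicator_of_mem (s := Set.Icc _ _) (abs_le.1 ((hA x hx).1 j)) _
      _ ≤ ∫⁻ x in K, (∏ j, ψ j (f j x)) * ENNReal.ofReal |jacobian f x| := lintegral_mono_set hAK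
      _ ≤ N * ∏ j, ∫⁻ s, ψ j s := hN ψ hψ
      _ = _ := by
        rw [ENNReal.ofReal_mul (by positivity), ENNReal.ofReal_natCast,
          ENNReal.ofReal_prod_of_nonneg fun j _ => by have := hδ j; positivity]
        congr 1
        exact Finset.prod_congr rfl fun j _ => lintegral_indicator_abs_le _
  have hpos : 0 ≤ N * ∏ j, 2 * δ j :=
    mul_nonneg (by positivity) (Finset.prod_nonneg fun j _ => by have := hδ j; positivity)
  have h2 := ENNReal.toReal_mono ENNReal.ofReal_ne_top h1
  rw [ENNReal.toReal_mul, ENNReal.toReal_ofReal hc.le, ENNReal.toReal_ofReal hpos,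
    Finset.prod_mul_distrib, Finset.prod_const, Finset.card_univ] at h2
  rw [← mul_div_assoc, le_div_iff₀ hc, mul_comm, mul_assoc]
  exact h2

end

/-- A smooth approximation of the indicator function of `[a, ∞)`. -/
noncomputable def smoothStep (a t s : ℝ) : ℝ := Real.smoothTransition (1 + (s - a) / t)

namespace smoothStep

theorem nonneg (a t s : ℝ) : 0 ≤ smoothStep a t s := Real.smoothTransition.nonneg _

theorem le_one (a t s : ℝ) : smoothStep a t s ≤ 1 := Real.smoothTransition.le_one _

theorem contDiff (a t : ℝ) {n : ℕ∞} : ContDiff ℝ n (smoothStep a t) := by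
  unfold smoothStep
  exact Real.smoothTransition.contDiff.comp (by fun_prop)

theorem hasDerivAt (a t s : ℝ) : HasDerivAt (smoothStep a t) (deriv (smoothStep a t) s) s :=
  ((contDiff a t (n := 1)).differentiable one_ne_zero s).hasDerivAt

theorem continuous_deriv (a t : ℝ) : Continuous (deriv (smoothStep a t)) :=
  (contDiff a t (n := 1)).continuous_deriv le_rfl

variable {a t s : ℝ}

theorem eq_zero (ht : 0 < t) (h : s ≤ a - t) : smoothStep a t s = 0 := by
  apply Real.smoothTransition.zero_of_nonpos
  have : (s - a) / t ≤ -1 := by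
    rw [div_le_iff₀ ht]
    linarith
  linarith

theorem eq_one (ht : 0 < t) (h : a ≤ s) : smoothStep a t s = 1 := by
  apply Real.smoothTransition.one_of_one_le
  have := div_nonneg (sub_nonneg.2 h) ht.le
  linarith

theorem monotone (ht : 0 < t) : Monotone (smoothStep a t) := by
  intro x y hxy
  apply Real.smoothTransition.monotone
  gcongr

theorem deriv_nonneg (ht : 0 < t) (s : ℝ) : 0 ≤ deriv (smoothStep a t) s :=
  (monotone ht).deriv_nonneg

theorem lintegral_deriv_le (ht : 0 < t) :
    ∫⁻ s, ENNReal.ofReal (deriv (smoothStep a t) s) ≤ 1 := by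
  have := lintegral_deriv_eq_volume_image_of_monotoneOn MeasurableSet.univ
    (fun s _ => (hasDerivAt a t s).hasDerivWithinAt) ((monotone ht).monotoneOn _)
  rw [Measure.restrict_univ] at this
  rw [this]
  refine (measure_mono (t := Set.Icc 0 1) ?_).trans (by simp)
  rintro _ ⟨s, -, rfl⟩
  exact ⟨nonneg a t s, le_one a t s⟩

end smoothStep

theorem isClosed_of_forall_le {X κ : Type*} [TopologicalSpace X] {h : κ → X → ℝ} {K : Set X}
    (hK : IsClosed K) (hh : ∀ i, ContinuousOn (h i) K) {b : κ → ℝ} (hb : ∀ x, (∀ i, b i ≤ h i x) → x ∈ K) :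
    IsClosed {x | ∀ i, b i ≤ h i x} := by
  have : {x | ∀ i, b i ≤ h i x} = K ∩ ⋂ i, K ∩ h i ⁻¹' Set.Ici (b i) := by
    ext x
    simp only [Set.mem_ofPred_eq, Set.mem_inter_iff, Set.mem_iInter, Set.mem_preimage, Set.mem_Ici]
    exact ⟨fun hx => ⟨hb x hx, fun i => ⟨hb x hx, hx i⟩⟩, fun hx i => (hx.2 i).2⟩
  rw [this]
  exact hK.inter (isClosed_iInter fun i => (hh i).preimage_isClosed_of_isClosed hK isClosed_Ici)

section

variable {ι : Type} [Fintype ι] [DecidableEq ι] {κ : Type} [Fintype κ]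

/-- The total variation estimate for the amplitude. -/
theorem exists_lintegral_jacobian_cutoff_le {f : ι → (ι → ℝ) → ℝ} {h : κ → (ι → ℝ) → ℝ}
    {K : Set (ι → ℝ)} (hK : IsCompact K) (hf : ∀ i, AnalyticOnNhd ℝ (f i) K)
    (hh : ∀ i, AnalyticOnNhd ℝ (h i) K) (k : ι) :
    ∃ C : ℝ, 0 ≤ C ∧ ∀ (a : κ → ℝ) (t : ℝ) (δ : ι → ℝ) (c : ℝ), 0 < t → (∀ j, 0 ≤ δ j) → 0 < c →
      (∀ x, (∀ i, a i - t ≤ h i x) → x ∈ K ∧ (∀ j ≠ k, |f j x| ≤ δ j) ∧ c ≤ |jacobian f x|) →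
      ∫⁻ x in {x | ∀ i, a i - t ≤ h i x}, ENNReal.ofReal |jacobian (Function.update f k
        fun x => (∏ i, smoothStep (a i) t (h i x)) * (jacobian f x)⁻¹) x| ≤
      ENNReal.ofReal (C * ((∏ j ∈ Finset.univ.erase k, δ j) / c)) := by
  classical
  have hu : ∀ g : (ι → ℝ) → ℝ, AnalyticOnNhd ℝ g K →
      ∀ j, AnalyticOnNhd ℝ (Function.update f k g j) K := by
    intro g hg j
    rcases eq_or_ne j k with rfl | hj
    · simpa using hg
    · simpa [hj] using hf j
  have hJ : AnalyticOnNhd ℝ (jacobian f) K := fun x hx => AnalyticAt.jacobian fun i => hf i x hx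
  choose Nh hNh using fun i => exists_setLIntegral_slot_le hK (hu (h i) (hh i)) k
  obtain ⟨NJ, hNJ⟩ := exists_setLIntegral_slot_le hK (hu _ hJ) k
  refine ⟨((∑ i, Nh i : ℕ) + 2 * NJ) * 2 ^ (Finset.univ.erase k).card, by positivity,
    fun a t δ c ht hδ hc hA => ?_⟩
  set A : Set (ι → ℝ) := {x | ∀ i, a i - t ≤ h i x} with hAdef
  have hAK : A ⊆ K := fun x hx => (hA x hx).1
  have hAc : IsClosed A := isClosed_of_forall_le hK.isClosed (fun i => (hh i).continuousOn)
    fun x hx => (hA x hx).1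
  have hδA : ∀ g : (ι → ℝ) → ℝ, ∀ x ∈ A, ∀ j ≠ k, |Function.update f k g j x| ≤ δ j := by
    intro g x hx j hj
    rw [Function.update_of_ne hj]
    exact (hA x hx).2.1 j hj
  have hJ0 : ∀ x ∈ A, jacobian f x ≠ 0 := fun x hx =>
    abs_pos.1 (hc.trans_le (hA x hx).2.2)
  let χ : (ι → ℝ) → ℝ := fun x => ∏ i, smoothStep (a i) t (h i x)
  have hcont : ∀ g : (ι → ℝ) → ℝ, AnalyticOnNhd ℝ g K →
      ContinuousOn (jacobian (Function.update f k g)) A := fun g hg x hx =>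
    (AnalyticAt.jacobian fun j => hu g hg j x (hAK hx)).continuousAt.continuousWithinAt
  let P : ℝ≥0∞ := ∏ j ∈ Finset.univ.erase k, ENNReal.ofReal (2 * δ j)
  let Ψ : ℝ → ℝ≥0∞ := {y : ℝ | c ≤ |y|}.indicator fun y => ENNReal.ofReal ((y ^ 2)⁻¹)
  have hΨm : MeasurableSet {y : ℝ | c ≤ |y|} := measurableSet_le measurable_const (by fun_prop)
  have hΨ : Measurable Ψ := Measurable.indicator (by fun_prop) hΨm
  have hpt : ∀ x ∈ A, ENNReal.ofReal |jacobian (Function.update f k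
        fun x => χ x * (jacobian f x)⁻¹) x| ≤
      (∑ i, ENNReal.ofReal c⁻¹ * (ENNReal.ofReal (deriv (smoothStep (a i) t) (h i x)) *
        ENNReal.ofReal |jacobian (Function.update f k (h i)) x|)) +
      Ψ (jacobian f x) * ENNReal.ofReal |jacobian (Function.update f k (jacobian f)) x| := by
    intro x hx
    obtain ⟨Λ, hΛ⟩ := exists_jacobian_update_eq f k x
    have h1 : HasFDerivAt χ (∑ i, (∏ l ∈ Finset.univ.erase i, smoothStep (a l) t (h l x)) •
        (deriv (smoothStep (a i) t) (h i x) • fderiv ℝ (h i) x)) x :=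
      HasFDerivAt.finsetProd (u := Finset.univ) (g := fun i x => smoothStep (a i) t (h i x))
        fun i _ => (smoothStep.hasDerivAt (a i) t (h i x)).comp_hasFDerivAt x
          (hh i x (hAK hx)).differentiableAt.hasFDerivAt
    have h2 : HasFDerivAt (fun x => (jacobian f x)⁻¹)
        (-(jacobian f x ^ 2)⁻¹ • fderiv ℝ (jacobian f) x) x :=
      (hasDerivAt_inv (hJ0 x hx)).comp_hasFDerivAt x (hJ x (hAK hx)).differentiableAt.hasFDerivAt
    have hc0 : |(jacobian f x)⁻¹| ≤ c⁻¹ := by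
      rw [abs_inv]
      exact inv_anti₀ hc (hA x hx).2.2
    have hprod : ∀ s : Finset κ, |∏ l ∈ s, smoothStep (a l) t (h l x)| ≤ 1 := by
      intro s
      rw [abs_of_nonneg (Finset.prod_nonneg fun l _ => smoothStep.nonneg _ _ _)]
      exact Finset.prod_le_one (fun l _ => smoothStep.nonneg _ _ _)
        fun l _ => smoothStep.le_one _ _ _
    have hΨx : Ψ (jacobian f x) = ENNReal.ofReal ((jacobian f x ^ 2)⁻¹) :=
      Set.indicator_of_mem (s := {y : ℝ | c ≤ |y|}) (hA x hx).2.2 _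
    simp_rw [hΨx, hΛ]
    rw [(h1.fun_mul h2).fderiv, map_add, map_smul, map_smul, map_smul, map_sum]
    simp_rw [map_smul, smul_eq_mul]
    simp_rw [← ENNReal.ofReal_mul (smoothStep.deriv_nonneg ht _),
      ← ENNReal.ofReal_mul (inv_nonneg.2 hc.le), ← ENNReal.ofReal_mul (inv_nonneg.2 (sq_nonneg _))]
    rw [← ENNReal.ofReal_sum_of_nonneg, ← ENNReal.ofReal_add, add_comm]
    · apply ENNReal.ofReal_le_ofReal
      refine (abs_add_le _ _).trans (add_le_add ?_ ?_)
      · rw [abs_mul, ← Finset.mul_sum]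
        refine mul_le_mul hc0 ((Finset.abs_sum_le_sum_abs _ _).trans
          (Finset.sum_le_sum fun i _ => ?_)) (abs_nonneg _) (inv_nonneg.2 hc.le)
        rw [abs_mul, abs_mul, abs_of_nonneg (smoothStep.deriv_nonneg ht _)]
        exact mul_le_of_le_one_left
          (mul_nonneg (smoothStep.deriv_nonneg ht _) (abs_nonneg _)) (hprod _)
      · rw [abs_mul, abs_mul, abs_neg,
          abs_of_nonneg (inv_nonneg.2 (sq_nonneg (jacobian f x)))]
        exact mul_le_of_le_one_left
          (mul_nonneg (inv_nonneg.2 (sq_nonneg _)) (abs_nonneg _)) (hprod _)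
    · exact Finset.sum_nonneg fun i _ => mul_nonneg (inv_nonneg.2 hc.le)
        (mul_nonneg (smoothStep.deriv_nonneg ht _) (abs_nonneg _))
    · exact mul_nonneg (inv_nonneg.2 (sq_nonneg _)) (abs_nonneg _)
    · exact fun i _ => mul_nonneg (inv_nonneg.2 hc.le)
        (mul_nonneg (smoothStep.deriv_nonneg ht _) (abs_nonneg _))
  have hmeas : ∀ i, AEMeasurable (fun x => ENNReal.ofReal c⁻¹ *
      (ENNReal.ofReal (deriv (smoothStep (a i) t) (h i x)) *
        ENNReal.ofReal |jacobian (Function.update f k (h i)) x|)) (volume.restrict A) := by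
    intro i
    have h1 : AEMeasurable (fun x => deriv (smoothStep (a i) t) (h i x)) (volume.restrict A) :=
      ((smoothStep.continuous_deriv (a i) t).comp_continuousOn
        ((hh i).continuousOn.mono hAK)).aemeasurable hAc.measurableSet
    have h2 := (hcont _ (hh i)).aemeasurable (μ := volume) hAc.measurableSet
    exact (h1.ennreal_ofReal.mul h2.abs.ennreal_ofReal).const_mul _
  calc _ ≤ ∫⁻ x in A, (∑ i, ENNReal.ofReal c⁻¹ *
          (ENNReal.ofReal (deriv (smoothStep (a i) t) (h i x)) *
          ENNReal.ofReal |jacobian (Function.update f k (h i)) x|)) +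
          Ψ (jacobian f x) * ENNReal.ofReal |jacobian (Function.update f k (jacobian f)) x| :=
        setLIntegral_mono' hAc.measurableSet hpt
    _ = (∑ i, ENNReal.ofReal c⁻¹ * ∫⁻ x in A,
          (ENNReal.ofReal (deriv (smoothStep (a i) t) (h i x)) *
          ENNReal.ofReal |jacobian (Function.update f k (h i)) x|)) + ∫⁻ x in A,
          Ψ (jacobian f x) * ENNReal.ofReal |jacobian (Function.update f k (jacobian f)) x| := by
        rw [lintegral_add_left' (Finset.aemeasurable_fun_sum _ fun i _ => hmeas i),
          lintegral_finsetSum' _ fun i _ => hmeas i]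
        congr 1
        exact Finset.sum_congr rfl fun i _ => lintegral_const_mul' _ _ ENNReal.ofReal_ne_top
    _ ≤ (∑ i, ENNReal.ofReal c⁻¹ * (Nh i * (P * 1))) +
          NJ * (P * (2 * ENNReal.ofReal c⁻¹)) := by
        gcongr with i
        · refine (?_ : _ ≤ _).trans (mul_le_mul_right (mul_le_mul_right
            (smoothStep.lintegral_deriv_le (a := a i) ht) _) _)
          have := hNh i δ (fun s => ENNReal.ofReal (deriv (smoothStep (a i) t) s))
            ((smoothStep.continuous_deriv _ _).measurable.ennreal_ofReal) A hAK hAc.measurableSet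
            (hδA _)
          simpa only [Function.update_self] using this
        · refine (?_ : _ ≤ _).trans (mul_le_mul_right (mul_le_mul_right
            (setLIntegral_inv_sq_le hc) _) _)
          have := hNJ δ Ψ hΨ A hAK hAc.measurableSet (hδA _)
          rw [lintegral_indicator hΨm] at this
          simpa only [Function.update_self] using this
    _ = _ := by
        have hP : P = ENNReal.ofReal (2 ^ (Finset.univ.erase k).card *
            ∏ j ∈ Finset.univ.erase k, δ j) := by
          rw [← Finset.prod_const, ← Finset.prod_mul_distrib, ENNReal.ofReal_prod_of_nonneg]
          exact fun j _ => mul_nonneg zero_le_two (hδ j)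
        have hp0 : 0 ≤ ∏ j ∈ Finset.univ.erase k, δ j := Finset.prod_nonneg fun j _ => hδ j
        rw [show ((∑ i, Nh i : ℕ) + 2 * NJ : ℝ) * 2 ^ (Finset.univ.erase k).card *
          ((∏ j ∈ Finset.univ.erase k, δ j) / c) = ((∑ i, Nh i + 2 * NJ : ℕ) : ℝ) *
          ((2 ^ (Finset.univ.erase k).card * ∏ j ∈ Finset.univ.erase k, δ j) * c⁻¹) by
            push_cast; ring, ENNReal.ofReal_mul (by positivity), ENNReal.ofReal_natCast,
          ENNReal.ofReal_mul (by positivity), ← hP, ← Finset.mul_sum, ← Finset.sum_mul]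
        push_cast
        ring

end

section

variable {ι : Type} [Fintype ι] [DecidableEq ι] {κ : Type} [Fintype κ]

/-- Integration by parts against a smooth cutoff. -/
theorem exists_abs_integral_cutoff_mul_comp_le {f : ι → (ι → ℝ) → ℝ} {h : κ → (ι → ℝ) → ℝ}
    {K : Set (ι → ℝ)} (hK : IsCompact K) (hf : ∀ i, AnalyticOnNhd ℝ (f i) K)
    (hh : ∀ i, AnalyticOnNhd ℝ (h i) K) (k : ι) :
    ∃ C : ℝ, 0 ≤ C ∧ ∀ (a : κ → ℝ) (t : ℝ) (δ : ι → ℝ) (c : ℝ), 0 < t → (∀ j, 0 ≤ δ j) → 0 < c →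
      (∀ x, (∀ i, a i - t ≤ h i x) → x ∈ K ∧ (∀ j ≠ k, |f j x| ≤ δ j) ∧ c ≤ |jacobian f x|) →
      ∀ (w w' : ℝ → ℝ) (L : ℝ), ContDiff ℝ 1 w → (∀ s, HasDerivAt w (w' s) s) →
      0 ≤ L → (∀ s, |w s| ≤ L) →
      |∫ x, (∏ i, smoothStep (a i) t (h i x)) * w' (f k x)| ≤
        C * (L * ((∏ j ∈ Finset.univ.erase k, δ j) / c)) := by
  obtain ⟨C, hC, hCb⟩ := exists_lintegral_jacobian_cutoff_le hK hf hh k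
  refine ⟨C, hC, fun a t δ c ht hδ hc hA w w' L hw hw' hL hwL => ?_⟩
  have hbound := hCb a t δ c ht hδ hc hA
  have hδp : 0 ≤ (∏ j ∈ Finset.univ.erase k, δ j) / c :=
    div_nonneg (Finset.prod_nonneg fun j _ => hδ j) hc.le
  set A : Set (ι → ℝ) := {x | ∀ i, a i - t ≤ h i x} with hAdef
  have hAK : A ⊆ K := fun x hx => (hA x hx).1
  have hAc : IsClosed A := isClosed_of_forall_le hK.isClosed (fun i => (hh i).continuousOn)
    fun x hx => (hA x hx).1
  have hAcomp : IsCompact A := hK.of_isClosed_subset hAc hAK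
  let χ : (ι → ℝ) → ℝ := fun x => ∏ i, smoothStep (a i) t (h i x)
  let η : (ι → ℝ) → ℝ := fun x => χ x * (jacobian f x)⁻¹
  let P : (ι → ℝ) → ℝ := fun x => η x * w (f k x)
  have hχ0 : ∀ x ∉ A, χ x = 0 := by
    intro x hx
    simp only [hAdef, Set.mem_ofPred_eq, not_forall, not_le] at hx
    obtain ⟨i, hi⟩ := hx
    exact Finset.prod_eq_zero (Finset.mem_univ i) (smoothStep.eq_zero ht hi.le)
  have hη0 : ∀ x ∉ A, η x = 0 := fun x hx => by simp only [η, hχ0 x hx, zero_mul]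
  have hP0 : ∀ x ∉ A, P x = 0 := fun x hx => by simp only [P, hη0 x hx, zero_mul]
  have hJ0 : ∀ x ∈ A, jacobian f x ≠ 0 := fun x hx =>
    abs_pos.1 (hc.trans_le (hA x hx).2.2)
  have hηA : ∀ x ∈ A, ContDiffAt ℝ ((1 : ℕ∞) : WithTop ℕ∞) η x := by
    intro x hx
    refine ContDiffAt.mul (contDiffAt_prod fun i _ => ?_) (ContDiffAt.inv ?_ (hJ0 x hx))
    · exact (smoothStep.contDiff (a i) t).contDiffAt.comp x (hh i x (hAK hx)).contDiffAt
    · exact (AnalyticAt.jacobian fun i => hf i x (hAK hx)).contDiffAt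
  have hPA : ∀ x ∈ A, ContDiffAt ℝ ((1 : ℕ∞) : WithTop ℕ∞) P x := fun x hx =>
    (hηA x hx).mul (hw.contDiffAt.comp x (hf k x (hAK hx)).contDiffAt)
  have hPc : ContDiff ℝ 1 P := contDiff_of_eqOn_zero_compl (n := 1) hAc hP0 hPA
  obtain ⟨hPi, hPz⟩ := integrable_jacobian_update_and_integral_eq_zero k hAcomp
    (fun i => (hf i).mono hAK) hPc hP0
  have key : ∀ x, χ x * w' (f k x) - jacobian (Function.update f k P) x =
      -(w (f k x) * jacobian (Function.update f k η) x) := by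
    intro x
    obtain ⟨Λ, hΛ⟩ := exists_jacobian_update_eq f k x
    rw [hΛ, hΛ]
    by_cases hx : x ∈ A
    · have h1 : HasFDerivAt η (fderiv ℝ η x) x :=
        ((hηA x hx).differentiableAt (by simp)).hasFDerivAt
      have h2 : HasFDerivAt (fun x => w (f k x)) (w' (f k x) • fderiv ℝ (f k) x) x :=
        (hw' _).comp_hasFDerivAt x (hf k x (hAK hx)).differentiableAt.hasFDerivAt
      have h3 : Λ (fderiv ℝ (f k) x) = jacobian f x := by
        rw [← hΛ, Function.update_eq_self]
      rw [(h1.fun_mul h2).fderiv, map_add, map_smul, map_smul, map_smul, h3]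
      simp only [smul_eq_mul, η]
      field_simp [hJ0 x hx]
      ring
    · rw [fderiv_eq_zero_of_eqOn_zero_compl hAc hP0 hx,
        fderiv_eq_zero_of_eqOn_zero_compl hAc hη0 hx, hχ0 x hx]
      simp
  have hnn : 0 ≤ C * (L * ((∏ j ∈ Finset.univ.erase k, δ j) / c)) := by positivity
  change |∫ x, χ x * w' (f k x)| ≤ _
  by_cases hint : Integrable fun x => χ x * w' (f k x)
  swap
  · rw [integral_undef hint, abs_zero]
    exact hnn
  have hsub := integral_sub hint hPi
  rw [hPz, sub_zero] at hsub
  rw [← hsub, ← Real.norm_eq_abs]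
  refine (norm_integral_le_lintegral_norm _).trans (ENNReal.toReal_le_of_le_ofReal hnn ?_)
  calc _ ≤ ∫⁻ x, A.indicator (fun x => ENNReal.ofReal L *
          ENNReal.ofReal |jacobian (Function.update f k η) x|) x := by
        refine lintegral_mono fun x => ?_
        rw [key, norm_neg, Real.norm_eq_abs, abs_mul]
        by_cases hx : x ∈ A
        · rw [Set.indicator_of_mem hx, ← ENNReal.ofReal_mul hL]
          exact ENNReal.ofReal_le_ofReal (mul_le_mul_of_nonneg_right (hwL _) (abs_nonneg _))
        · obtain ⟨Λ, hΛ⟩ := exists_jacobian_update_eq f k x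
          rw [hΛ, fderiv_eq_zero_of_eqOn_zero_compl hAc hη0 hx]
          simp
    _ = ENNReal.ofReal L * ∫⁻ x in A,
          ENNReal.ofReal |jacobian (Function.update f k η) x| := by
        rw [lintegral_indicator hAc.measurableSet, lintegral_const_mul' _ _ ENNReal.ofReal_ne_top]
    _ ≤ ENNReal.ofReal L * ENNReal.ofReal (C * ((∏ j ∈ Finset.univ.erase k, δ j) / c)) :=
        mul_le_mul_right hbound _
    _ = _ := by
        rw [← ENNReal.ofReal_mul hL]
        congr 1
        ring

end

theorem IsUpperSet.exists_seq_eventually_le {I : Set ℝ} (hI : IsUpperSet I) (hne : I.Nonempty) :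
    ∃ u : ℕ → ℝ, (∀ n, u n ∈ I) ∧ ∀ x ∈ I, ∀ᶠ n in atTop, u n ≤ x := by
  have := hI.ordConnected
  have := hne.to_subtype
  obtain ⟨u, hu⟩ := exists_seq_tendsto (atBot : Filter I)
  exact ⟨fun n => u n, fun n => (u n).2, fun x hx => hu.eventually (eventually_le_atBot ⟨x, hx⟩)⟩

theorem tendsto_smoothStep_indicator {X κ : Type*} [Fintype κ] {h : κ → X → ℝ} {a : κ → ℝ}
    {t : ℕ → ℝ} (ht0 : ∀ n, 0 < t n) (ht : Tendsto t atTop (𝓝 0)) (x : X) :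
    Tendsto (fun n => ∏ i, smoothStep (a i) (t n) (h i x)) atTop
      (𝓝 ({x | ∀ i, a i ≤ h i x}.indicator 1 x)) := by
  by_cases hx : ∀ i, a i ≤ h i x
  · rw [Set.indicator_of_mem (s := {x | ∀ i, a i ≤ h i x}) hx]
    refine tendsto_const_nhds.congr fun n => ?_
    exact (Finset.prod_eq_one fun i _ => smoothStep.eq_one (ht0 n) (hx i)).symm
  · rw [Set.indicator_of_notMem (s := {x | ∀ i, a i ≤ h i x}) hx]
    simp only [not_forall, not_le] at hx
    obtain ⟨i, hi⟩ := hx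
    refine tendsto_const_nhds.congr' ?_
    filter_upwards [ht.eventually_lt_const (sub_pos.2 hi)] with n hn
    exact (Finset.prod_eq_zero (Finset.mem_univ i)
      (smoothStep.eq_zero (ht0 n) (by linarith))).symm

section

variable {ι : Type} [Fintype ι] [DecidableEq ι] {κ : Type} [Fintype κ]

theorem exists_abs_setIntegral_comp_le_of_closed {f : ι → (ι → ℝ) → ℝ} {h : κ → (ι → ℝ) → ℝ}
    {K : Set (ι → ℝ)} (hK : IsCompact K) (hf : ∀ i, AnalyticOnNhd ℝ (f i) K)
    (hh : ∀ i, AnalyticOnNhd ℝ (h i) K) (k : ι) :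
    ∃ C : ℝ, 0 ≤ C ∧ ∀ (a : κ → ℝ) (r : ℝ) (δ : ι → ℝ) (c : ℝ), 0 < r →
      (∀ x, (∀ i, a i - r ≤ h i x) → x ∈ K) → (∀ j, 0 < δ j) → 0 < c →
      (∀ x, (∀ i, a i ≤ h i x) → (∀ j ≠ k, |f j x| ≤ δ j) ∧ c ≤ |jacobian f x|) →
      ∀ (w w' : ℝ → ℝ) (L : ℝ), ContDiff ℝ 1 w → (∀ s, HasDerivAt w (w' s) s) →
      Continuous w' → (∀ s, |w' s| ≤ 1) → 0 ≤ L → (∀ s, |w s| ≤ L) →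
      |∫ x in {x | ∀ i, a i ≤ h i x}, w' (f k x)| ≤
        C * (L * ((∏ j ∈ Finset.univ.erase k, δ j) / c)) := by
  obtain ⟨C, hC, hCb⟩ := exists_abs_integral_cutoff_mul_comp_le hK hf hh k
  refine ⟨C * (2 ^ (Finset.univ.erase k).card * 2), by positivity,
    fun a r δ c hr hrK hδ hc hS w w' L hw hw' hw'c hw'1 hL hwL => ?_⟩
  let t : ℕ → ℝ := fun n => r / (n + 1)
  have ht0 : ∀ n, 0 < t n := fun n => by positivity
  have htr : ∀ n, t n ≤ r := fun n => div_le_self hr.le (by simp)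
  have htlim : Tendsto t atTop (𝓝 0) := by
    have := (tendsto_one_div_add_atTop_nhds_zero_nat (𝕜 := ℝ)).const_mul r
    simpa only [mul_zero, mul_one_div] using this
  have htanti : Antitone t := fun n m hnm => by
    simp only [t]
    gcongr
  let V : ℕ → Set (ι → ℝ) := fun n => {x | ∀ i, a i - t n ≤ h i x}
  have hVK : ∀ n, V n ⊆ K := fun n x hx => hrK x fun i => by
    linarith [hx i, htr n]
  have hVc : ∀ n, IsClosed (V n) := fun n =>
    isClosed_of_forall_le hK.isClosed (fun i => (hh i).continuousOn) (hVK n)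
  have hSc : IsClosed {x | ∀ i, a i ≤ h i x} :=
    isClosed_of_forall_le hK.isClosed (fun i => (hh i).continuousOn)
      fun x hx => hrK x fun i => by linarith [hx i]
  obtain ⟨N, hN⟩ : ∃ N, V N ⊆
      {x | (∀ j ≠ k, |f j x| ≤ 2 * δ j) ∧ c / 2 ≤ |jacobian f x|} := by
    refine exists_subset_nhds_of_isCompact' (V := V) ?_
      (fun n => hK.of_isClosed_subset (hVc n) (hVK n)) hVc ?_
    · exact directed_of_isDirected_le fun n m hnm x hx i => by
        linarith [hx i, htanti hnm]
    · intro x hx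
      have hx' : ∀ n, x ∈ V n := Set.mem_iInter.1 hx
      have hxS : ∀ i, a i ≤ h i x := fun i => by
        have : Tendsto (fun n => a i - t n) atTop (𝓝 (a i - 0)) := tendsto_const_nhds.sub htlim
        rw [sub_zero] at this
        exact le_of_tendsto' this fun n => hx' n i
      have hxK : x ∈ K := hVK 0 (hx' 0)
      obtain ⟨h1, h2⟩ := hS x hxS
      have e1 : ∀ j, ∀ᶠ y in 𝓝 x, j ≠ k → |f j y| ≤ 2 * δ j := by
        intro j
        by_cases hj : j = k
        · exact Eventually.of_forall fun y hjk => absurd hj hjk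
        · have : |f j x| < 2 * δ j := by linarith [h1 j hj, hδ j]
          filter_upwards [(hf j x hxK).continuousAt.abs.eventually_lt_const this] with y hy _
          exact hy.le
      have e2 : ∀ᶠ y in 𝓝 x, c / 2 ≤ |jacobian f y| := by
        have : c / 2 < |jacobian f x| := by linarith
        filter_upwards [(AnalyticAt.jacobian fun i => hf i x hxK).continuousAt.abs.eventually_const_lt
          this] with y hy
        exact hy.le
      filter_upwards [eventually_all.2 e1, e2] with y hy1 hy2
      exact ⟨hy1, hy2⟩
  have hbd : ∀ n ≥ N, |∫ x, (∏ i, smoothStep (a i) (t n) (h i x)) * w' (f k x)| ≤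
      C * (L * ((∏ j ∈ Finset.univ.erase k, 2 * δ j) / (c / 2))) := by
    intro n hn
    refine hCb a (t n) (fun j => 2 * δ j) (c / 2) (ht0 n) (fun j => by linarith [hδ j])
      (by positivity) (fun x hx => ?_) w w' L hw hw' hL hwL
    refine ⟨hVK n hx, hN fun i => ?_⟩
    linarith [hx i, htanti hn]
  have hlim : Tendsto (fun n => ∫ x, (∏ i, smoothStep (a i) (t n) (h i x)) * w' (f k x)) atTop
      (𝓝 (∫ x, {x | ∀ i, a i ≤ h i x}.indicator 1 x * w' (f k x))) := by
    have hz : ∀ n, ∀ x ∉ V n, ∏ i, smoothStep (a i) (t n) (h i x) = 0 := by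
      intro n x hx
      simp only [V, Set.mem_ofPred_eq, not_forall, not_le] at hx
      obtain ⟨i, hi⟩ := hx
      exact Finset.prod_eq_zero (Finset.mem_univ i) (smoothStep.eq_zero (ht0 n) hi.le)
    refine tendsto_integral_of_dominated_convergence (K.indicator 1) (fun n => ?_) ?_ ?_ ?_
    · have : (fun x => (∏ i, smoothStep (a i) (t n) (h i x)) * w' (f k x)) =
          (V n).indicator fun x => (∏ i, smoothStep (a i) (t n) (h i x)) * w' (f k x) := by
        symm
        rw [Set.indicator_eq_self]
        intro x hx
        by_contra hxV
        exact hx (by simp only [hz n x hxV, zero_mul])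
      rw [this, aestronglyMeasurable_indicator_iff (hVc n).measurableSet]
      refine ContinuousOn.aestronglyMeasurable (ContinuousOn.mul ?_ ?_) (hVc n).measurableSet
      · exact continuousOn_finsetProd _ fun i _ =>
          (smoothStep.contDiff (a i) (t n) (n := 1)).continuous.comp_continuousOn
            ((hh i).continuousOn.mono (hVK n))
      · exact hw'c.comp_continuousOn ((hf k).continuousOn.mono (hVK n))
    · exact (integrable_indicator_iff hK.isClosed.measurableSet).2
        (integrableOn_const (hs := hK.measure_lt_top.ne))
    · refine fun n => Eventually.of_forall fun x => ?_
      by_cases hx : x ∈ V n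
      · rw [Set.indicator_of_mem (hVK n hx), Real.norm_eq_abs, abs_mul,
          abs_of_nonneg (Finset.prod_nonneg fun i _ => smoothStep.nonneg _ _ _)]
        exact mul_le_one₀ (Finset.prod_le_one (fun i _ => smoothStep.nonneg _ _ _)
          fun i _ => smoothStep.le_one _ _ _) (abs_nonneg _) (hw'1 _)
      · rw [hz n x hx, zero_mul, norm_zero]
        exact Set.indicator_nonneg (fun _ _ => zero_le_one) x
    · exact Eventually.of_forall fun x =>
        (tendsto_smoothStep_indicator ht0 htlim x).mul_const _
  have hind : ∀ x, {x | ∀ i, a i ≤ h i x}.indicator 1 x * w' (f k x) =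
      {x | ∀ i, a i ≤ h i x}.indicator (fun x => w' (f k x)) x := fun x => by
    by_cases hx : x ∈ {x | ∀ i, a i ≤ h i x} <;> simp only [hx, Set.indicator_of_mem,
      Set.indicator_of_notMem, not_false_eq_true, Pi.one_apply, one_mul, zero_mul]
  simp_rw [hind] at hlim
  rw [integral_indicator hSc.measurableSet] at hlim
  refine (le_of_tendsto hlim.abs (eventually_atTop.2 ⟨N, hbd⟩)).trans_eq ?_
  rw [Finset.prod_mul_distrib, Finset.prod_const]
  field_simp

end

/-- The part of `{0 ≤ ρ}` on which each `h i` takes values in `I i`. -/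
def cell {X κ : Type*} (ρ : X → ℝ) (h : κ → X → ℝ) (I : κ → Set ℝ) : Set X :=
  {x | 0 ≤ ρ x ∧ ∀ i, h i x ∈ I i}

theorem ContinuousOn.measurableSet_inter_preimage {X Y : Type*} [TopologicalSpace X]
    [MeasurableSpace X] [OpensMeasurableSpace X] [TopologicalSpace Y] [MeasurableSpace Y]
    [BorelSpace Y] {g : X → Y} {K : Set X} {I : Set Y} (hg : ContinuousOn g K)
    (hK : MeasurableSet K) (hI : MeasurableSet I) : MeasurableSet (K ∩ g ⁻¹' I) := by
  have := hK.subtype_image ((continuousOn_iff_continuous_domRestrict.1 hg).measurable hI)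
  convert this using 1
  ext x
  simp [and_comm]

theorem measurableSet_cell {X κ : Type*} [TopologicalSpace X] [MeasurableSpace X]
    [OpensMeasurableSpace X] [Countable κ] {ρ : X → ℝ} {h : κ → X → ℝ} {I : κ → Set ℝ}
    {K : Set X} (hK : MeasurableSet K) (hρ : ContinuousOn ρ K) (hh : ∀ i, ContinuousOn (h i) K)
    (hρK : ∀ x, 0 ≤ ρ x → x ∈ K) (hI : ∀ i, MeasurableSet (I i)) :
    MeasurableSet (cell ρ h I) := by
  have : cell ρ h I = (K ∩ ρ ⁻¹' Set.Ici 0) ∩ ⋂ i, (K ∩ h i ⁻¹' I i) := by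
    ext x
    simp only [cell, Set.mem_ofPred_eq, Set.mem_inter_iff, Set.mem_iInter, Set.mem_preimage,
      Set.mem_Ici]
    exact ⟨fun hx => ⟨⟨hρK x hx.1, hx.1⟩, fun i => ⟨hρK x hx.1, hx.2 i⟩⟩,
      fun hx => ⟨hx.1.2, fun i => (hx.2 i).2⟩⟩
  rw [this]
  exact (hρ.measurableSet_inter_preimage hK measurableSet_Ici).inter
    (MeasurableSet.iInter fun i => (hh i).measurableSet_inter_preimage hK (hI i))

section

variable {ι : Type} [Fintype ι] [DecidableEq ι] {κ : Type} [Fintype κ]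

theorem exists_abs_setIntegral_comp_le {f : ι → (ι → ℝ) → ℝ} {h : κ → (ι → ℝ) → ℝ}
    {ρ : (ι → ℝ) → ℝ} {r : ℝ} {K : Set (ι → ℝ)} (hK : IsCompact K)
    (hf : ∀ i, AnalyticOnNhd ℝ (f i) K) (hh : ∀ i, AnalyticOnNhd ℝ (h i) K)
    (hρ : AnalyticOnNhd ℝ ρ K) (hr : 0 < r) (hρK : ∀ x, -r ≤ ρ x → x ∈ K) (k : ι) :
    ∃ C : ℝ, 0 ≤ C ∧ ∀ (I : κ → Set ℝ) (δ : ι → ℝ) (c : ℝ),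
      (∀ i, IsUpperSet (I i)) → (∀ j, 0 < δ j) → 0 < c →
      (∀ x ∈ cell ρ h I, (∀ j ≠ k, |f j x| ≤ δ j) ∧ c ≤ |jacobian f x|) →
      ∀ (w w' : ℝ → ℝ) (L : ℝ), ContDiff ℝ 1 w → (∀ s, HasDerivAt w (w' s) s) →
      Continuous w' → (∀ s, |w' s| ≤ 1) → 0 ≤ L → (∀ s, |w s| ≤ L) →
      |∫ x in cell ρ h I, w' (f k x)| ≤
        C * (L * ((∏ j ∈ Finset.univ.erase k, δ j) / c)) := by
  let g : Option κ → (ι → ℝ) → ℝ := fun o => o.elim ρ h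
  obtain ⟨C, hC, hCb⟩ := exists_abs_setIntegral_comp_le_of_closed (h := g) hK hf
    (fun o => by cases o; exacts [hρ, hh _]) k
  refine ⟨C, hC, fun I δ c hI hδ hc hS w w' L hw hw' hw'c hw'1 hL hwL => ?_⟩
  have hδp : 0 ≤ (∏ j ∈ Finset.univ.erase k, δ j) / c :=
    div_nonneg (Finset.prod_nonneg fun j _ => (hδ j).le) hc.le
  by_cases hne : ∀ i, (I i).Nonempty
  swap
  · simp only [not_forall, Set.not_nonempty_iff_eq_empty] at hne
    obtain ⟨i, hi⟩ := hne
    have : cell ρ h I = ∅ := Set.eq_empty_of_forall_notMem fun x hx => by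
      have := hx.2 i
      rw [hi] at this
      exact this
    rw [this, setIntegral_empty, abs_zero]
    positivity
  choose u hu hulim using fun i => (hI i).exists_seq_eventually_le (hne i)
  have hρK' : ∀ x, 0 ≤ ρ x → x ∈ K := fun x hx => hρK x (by linarith)
  have hcm : ∀ J : κ → Set ℝ, (∀ i, IsUpperSet (J i)) → MeasurableSet (cell ρ h J) := fun J hJ =>
    measurableSet_cell hK.isClosed.measurableSet hρ.continuousOn (fun i => (hh i).continuousOn)
      hρK' fun i => (hJ i).ordConnected.measurableSet
  have hsub : ∀ n, cell ρ h (fun i => Set.Ici (u i n)) ⊆ cell ρ h I := fun n x hx =>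
    ⟨hx.1, fun i => hI i (hx.2 i) (hu i n)⟩
  have hcK : ∀ J, cell ρ h J ⊆ K := fun J x hx => hρK' x hx.1
  have hlim : Tendsto (fun n => ∫ x in cell ρ h (fun i => Set.Ici (u i n)), w' (f k x)) atTop
      (𝓝 (∫ x in cell ρ h I, w' (f k x))) := by
    simp_rw [← integral_indicator (hcm _ hI),
      ← integral_indicator (hcm _ fun i => isUpperSet_Ici (u i _))]
    refine tendsto_integral_of_dominated_convergence (K.indicator 1) (fun n => ?_) ?_ ?_ ?_
    · rw [aestronglyMeasurable_indicator_iff (hcm _ fun i => isUpperSet_Ici (u i n))]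
      exact (hw'c.comp_continuousOn ((hf k).continuousOn.mono (hcK _))).aestronglyMeasurable
        (hcm _ fun i => isUpperSet_Ici (u i n))
    · exact (integrable_indicator_iff hK.isClosed.measurableSet).2
        (integrableOn_const (hs := hK.measure_lt_top.ne))
    · refine fun n => Eventually.of_forall fun x => ?_
      by_cases hx : x ∈ cell ρ h (fun i => Set.Ici (u i n))
      · rw [Set.indicator_of_mem hx, Set.indicator_of_mem (hcK _ hx)]
        exact hw'1 _
      · rw [Set.indicator_of_notMem hx, norm_zero]
        exact Set.indicator_nonneg (fun _ _ => zero_le_one) x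
    · refine Eventually.of_forall fun x => ?_
      by_cases hx : x ∈ cell ρ h I
      · refine tendsto_const_nhds.congr' ?_
        filter_upwards [eventually_all.2 fun i => hulim i _ (hx.2 i)] with n hn
        rw [Set.indicator_of_mem hx, Set.indicator_of_mem]
        exact ⟨hx.1, hn⟩
      · refine tendsto_const_nhds.congr fun n => ?_
        rw [Set.indicator_of_notMem hx, Set.indicator_of_notMem fun h => hx (hsub n h)]
  refine le_of_tendsto' hlim.abs fun n => ?_
  have hcell : cell ρ h (fun i => Set.Ici (u i n)) =
      {x | ∀ o : Option κ, (o.elim 0 fun i => u i n : ℝ) ≤ g o x} := by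
    ext x
    simp [cell, g, Option.forall]
  rw [hcell]
  refine hCb (fun o => o.elim 0 fun i => u i n) r δ c hr (fun x hx => hρK x ?_) hδ hc
    (fun x hx => ?_) w w' L hw hw' hw'c hw'1 hL hwL
  · simpa [g] using hx none
  · exact hS x (hsub n (by rw [hcell]; exact hx))

/-- Nonstationary phase with one slot of the Jacobian taken up by the phase. -/
theorem exists_norm_setIntegral_cexp_le {f : ι → (ι → ℝ) → ℝ} {h : κ → (ι → ℝ) → ℝ}
    {ρ : (ι → ℝ) → ℝ} {r : ℝ} {K : Set (ι → ℝ)} (hK : IsCompact K)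
    (hf : ∀ i, AnalyticOnNhd ℝ (f i) K) (hh : ∀ i, AnalyticOnNhd ℝ (h i) K)
    (hρ : AnalyticOnNhd ℝ ρ K) (hr : 0 < r) (hρK : ∀ x, -r ≤ ρ x → x ∈ K) (k : ι) :
    ∃ C : ℝ, 0 ≤ C ∧ ∀ (I : κ → Set ℝ) (δ : ι → ℝ) (c lam : ℝ),
      (∀ i, IsUpperSet (I i)) → (∀ j, 0 < δ j) → 0 < c → lam ≠ 0 →
      (∀ x ∈ cell ρ h I, (∀ j ≠ k, |f j x| ≤ δ j) ∧ c ≤ |jacobian f x|) →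
      ‖∫ x in cell ρ h I, Complex.exp (Complex.I * lam * f k x)‖ ≤
        C * (|lam|⁻¹ * ((∏ j ∈ Finset.univ.erase k, δ j) / c)) := by
  obtain ⟨C, hC, hCb⟩ := exists_abs_setIntegral_comp_le hK hf hh hρ hr hρK k
  refine ⟨C + C, by positivity, fun I δ c lam hI hδ hc hlam hS => ?_⟩
  have hcK : cell ρ h I ⊆ K := fun x hx => hρK x (by linarith [hx.1])
  have hint : IntegrableOn (fun x => Complex.exp (Complex.I * lam * f k x)) (cell ρ h I) := by
    refine (ContinuousOn.integrableOn_compact hK ?_).mono_set hcK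
    have := (hf k).continuousOn
    fun_prop
  have hexp : ∀ s : ℝ, Complex.exp (Complex.I * lam * s) =
      (Real.cos (lam * s) : ℝ) + (Real.sin (lam * s) : ℝ) * Complex.I := fun s => by
    rw [Complex.ofReal_cos, Complex.ofReal_sin, ← Complex.exp_mul_I]
    congr 1
    push_cast
    ring
  have hlin : ∀ s : ℝ, HasDerivAt (fun s => lam * s) lam s := fun s => by
    simpa using (hasDerivAt_id s).const_mul lam
  have hdiv : ∀ y : ℝ, |y| ≤ 1 → |y / lam| ≤ |lam|⁻¹ := fun y hy => by
    rw [abs_div, div_eq_mul_inv]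
    exact mul_le_of_le_one_left (by positivity) hy
  rw [add_mul]
  refine (Complex.norm_le_abs_re_add_abs_im _).trans (add_le_add ?_ ?_)
  · have := hCb I δ c hI hδ hc hS (fun s => Real.sin (lam * s) / lam)
      (fun s => Real.cos (lam * s)) |lam|⁻¹ (by fun_prop)
      (fun s => by
        have := ((hlin s).sin).div_const lam
        rwa [mul_div_cancel_right₀ _ hlam] at this)
      (by fun_prop) (fun s => Real.abs_cos_le_one _) (by positivity)
      fun s => hdiv _ (Real.abs_sin_le_one _)
    have hre : (∫ x in cell ρ h I, Complex.exp (Complex.I * lam * f k x)).re =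
        ∫ x in cell ρ h I, Real.cos (lam * f k x) := by
      rw [← RCLike.re_eq_complex_re, ← integral_re hint]
      congr 1
      ext x
      rw [hexp]
      simp [-Complex.ofReal_cos, -Complex.ofReal_sin]
    rwa [hre]
  · have := hCb I δ c hI hδ hc hS (fun s => -Real.cos (lam * s) / lam)
      (fun s => Real.sin (lam * s)) |lam|⁻¹ (by fun_prop)
      (fun s => by
        have := ((hlin s).cos).neg.div_const lam
        rwa [neg_mul, neg_neg, mul_div_cancel_right₀ _ hlam] at this)
      (by fun_prop) (fun s => Real.abs_sin_le_one _) (by positivity)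
      fun s => hdiv _ (by rw [abs_neg]; exact Real.abs_cos_le_one _)
    have him : (∫ x in cell ρ h I, Complex.exp (Complex.I * lam * f k x)).im =
        ∫ x in cell ρ h I, Real.sin (lam * f k x) := by
      rw [← RCLike.im_eq_complex_im, ← integral_im hint]
      congr 1
      ext x
      rw [hexp]
      simp [-Complex.ofReal_cos, -Complex.ofReal_sin]
    rwa [him]

end

/-- The sign of `s`, where values in `[-δ, δ]` count as zero. -/
noncomputable def thresholdSign (δ s : ℝ) : SignType :=
  if δ < s then 1 else if s < -δ then -1 else 0

/-- The half-line of values compatible from below with a given threshold sign. -/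
def signRay (δ : ℝ) : SignType → Set ℝ
  | .pos => Set.Ioi δ
  | .zero => Set.Ici (-δ)
  | .neg => Set.univ

theorem isUpperSet_signRay (δ : ℝ) : ∀ p, IsUpperSet (signRay δ p)
  | .pos => isUpperSet_Ioi δ
  | .zero => isUpperSet_Ici (-δ)
  | .neg => isUpperSet_univ

theorem thresholdSign_eq_iff {δ s : ℝ} (hδ : 0 ≤ δ) (p : SignType) :
    thresholdSign δ s = p ↔ s ∈ signRay δ p ∧ -s ∈ signRay δ (-p) := by
  unfold thresholdSign
  rcases p with _ | _ | _
  · change _ = (0 : SignType) ↔ s ∈ Set.Ici (-δ) ∧ -s ∈ Set.Ici (-δ)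
    simp only [Set.mem_Ici, neg_le_neg_iff]
    split_ifs with h1 h2
    · simp [h1]
    · simp [h2]
    · simp [not_lt.1 h1, not_lt.1 h2]
  · change _ = (-1 : SignType) ↔ s ∈ Set.univ ∧ -s ∈ Set.Ioi δ
    simp only [Set.mem_univ, Set.mem_Ioi, true_and, lt_neg]
    split_ifs with h1 h2
    · simp only [false_iff, not_lt]
      linarith
    · simp [h2]
    · simp [h2]
  · change _ = (1 : SignType) ↔ s ∈ Set.Ioi δ ∧ -s ∈ Set.univ
    simp only [Set.mem_univ, Set.mem_Ioi, and_true]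
    split_ifs with h1 h2
    · simp [h1]
    · simp [h1]
    · simp [h1]

theorem thresholdSign_eq_zero_iff {δ s : ℝ} (hδ : 0 ≤ δ) : thresholdSign δ s = 0 ↔ |s| ≤ δ := by
  rw [thresholdSign_eq_iff hδ, neg_zero, abs_le]
  change (s ∈ Set.Ici (-δ) ∧ -s ∈ Set.Ici (-δ)) ↔ _
  simp

theorem norm_setIntegral_le_sum_preimage {X α E : Type*} [MeasurableSpace X] [Fintype α]
    [NormedAddCommGroup E] [NormedSpace ℝ E] {μ : Measure X} {S : Set X} {F : X → E} (τ : X → α)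
    (hτ : ∀ p, MeasurableSet (S ∩ τ ⁻¹' {p})) (hF : IntegrableOn F S μ) :
    ‖∫ x in S, F x ∂μ‖ ≤ ∑ p, ‖∫ x in S ∩ τ ⁻¹' {p}, F x ∂μ‖ := by
  have hS : S = ⋃ p, S ∩ τ ⁻¹' {p} := by
    ext x
    simp
  have := integral_iUnion_fintype (μ := μ) (f := F) hτ
    (fun p q hpq => Set.disjoint_left.2 fun x hx hy => hpq (hx.2.symm.trans hy.2))
    fun p => hF.mono_set Set.inter_subset_left
  rw [← hS] at this
  rw [this]
  exact norm_sum_le _ _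

section

variable {X κ α : Type*} {ρ : X → ℝ} {h : κ → X → ℝ} {I : κ → Set ℝ} {q : α → X → ℝ} {δ : α → ℝ}

theorem cell_inter_thresholdSign (hδ : ∀ k, 0 ≤ δ k) (p : α → SignType) :
    cell ρ h I ∩ (fun x k => thresholdSign (δ k) (q k x)) ⁻¹' {p} =
      cell ρ (Sum.elim h (Sum.elim q (-q))) (Sum.elim I
        (Sum.elim (fun k => signRay (δ k) (p k)) fun k => signRay (δ k) (-p k))) := by
  ext x
  simp only [cell, Set.mem_inter_iff, Set.mem_ofPred_eq, Set.mem_preimage, Set.mem_singleton_iff,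
    funext_iff, thresholdSign_eq_iff (hδ _), Sum.forall, Sum.elim_inl, Sum.elim_inr, Pi.neg_apply,
    forall_and, and_assoc]

theorem isUpperSet_elim_signRay (hI : ∀ i, IsUpperSet (I i)) (p : α → SignType) :
    ∀ i, IsUpperSet (Sum.elim I (Sum.elim (fun k => signRay (δ k) (p k))
      fun k => signRay (δ k) (-p k)) i) := by
  rintro (i | k | k)
  exacts [hI i, isUpperSet_signRay _ _, isUpperSet_signRay _ _]

end

namespace DTree

variable {d m : ℕ}

theorem analyticOnNhd_deriv {π : Fin m → (Fin d → ℝ) → ℝ} {K : Set (Fin d → ℝ)}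
    (hπ : ∀ j, AnalyticOnNhd ℝ (π j) K) (G : DTree d m) : AnalyticOnNhd ℝ (G.deriv π) K := by
  induction G with
  | leaf i => exact hπ i
  | node G ih => exact fun x hx => AnalyticAt.jacobian fun k => ih k x hx

theorem deriv_node (π : Fin m → (Fin d → ℝ) → ℝ) (G : Fin d → DTree d m) :
    (node G).deriv π = jacobian fun k => (G k).deriv π := rfl

theorem count_node (G : Fin d → DTree d m) : (node G).count = (∑ k, (G k).count) + 1 := rfl

theorem mult_node (G : Fin d → DTree d m) (j : Fin m) :
    (node G).mult j = ∑ k, (G k).mult j := rfl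

theorem mult_leaf (i j : Fin m) : (leaf i : DTree d m).mult j = if i = j then 1 else 0 := rfl

theorem deriv_leaf (π : Fin m → (Fin d → ℝ) → ℝ) (i : Fin m) : (leaf i).deriv π = π i := rfl

theorem count_leaf (i : Fin m) : (leaf i : DTree d m).count = 0 := rfl

theorem nontrivial_node (G : Fin d → DTree d m) : (node G).Nontrivial := fun _ => nofun

theorem Nontrivial.count_pos {G : DTree d m} (hG : G.Nontrivial) : 0 < G.count := by
  cases G with
  | leaf i => exact absurd rfl (hG i)
  | node G => exact Nat.succ_pos _

/-- The monomial `∏ j, E j ^ G^{(j)}`. -/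
noncomputable def weight (E : Fin m → ℝ) (G : DTree d m) : ℝ := ∏ j, E j ^ G.mult j

theorem weight_leaf (E : Fin m → ℝ) (i : Fin m) : (leaf i : DTree d m).weight E = E i := by
  simp [weight, mult_leaf]

theorem weight_node (E : Fin m → ℝ) (G : Fin d → DTree d m) :
    (node G).weight E = ∏ k, (G k).weight E := by
  simp only [weight, mult_node, ← Finset.prod_pow_eq_pow_sum]
  exact Finset.prod_comm

theorem weight_pos {E : Fin m → ℝ} (hE : ∀ j, 0 < E j) (G : DTree d m) : 0 < G.weight E :=
  Finset.prod_pos fun j _ => pow_pos (hE j) _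

/-- The size of the estimate attached to the tree `G`. -/
noncomputable def bound (E : Fin m → ℝ) (c : ℝ) (G : DTree d m) : ℝ :=
  (G.weight E / c) ^ (1 / (G.count : ℝ))

theorem bound_pos {E : Fin m → ℝ} (hE : ∀ j, 0 < E j) {c : ℝ} (hc : 0 < c) (G : DTree d m) :
    0 < G.bound E c := Real.rpow_pos_of_pos (div_pos (G.weight_pos hE) hc) _

theorem bound_pow_count {E : Fin m → ℝ} (hE : ∀ j, 0 < E j) {c : ℝ} (hc : 0 < c) {G : DTree d m}
    (hG : G.Nontrivial) : G.bound E c ^ G.count = G.weight E / c := by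
  rw [bound, one_div, Real.rpow_inv_natCast_pow (div_pos (G.weight_pos hE) hc).le
    hG.count_pos.ne']

/-- The threshold at which the tree `G` contributes an estimate of size `M`. -/
noncomputable def threshold (E : Fin m → ℝ) (M : ℝ) (G : DTree d m) : ℝ :=
  G.weight E / M ^ G.count

theorem threshold_pos {E : Fin m → ℝ} (hE : ∀ j, 0 < E j) {M : ℝ} (hM : 0 < M) (G : DTree d m) :
    0 < G.threshold E M := div_pos (G.weight_pos hE) (pow_pos hM _)

theorem threshold_leaf (E : Fin m → ℝ) (M : ℝ) (i : Fin m) :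
    (leaf i : DTree d m).threshold E M = E i := by
  rw [threshold, weight_leaf, count_leaf, pow_zero, div_one]

theorem bound_threshold {E : Fin m → ℝ} (hE : ∀ j, 0 < E j) {M : ℝ} (hM : 0 < M) {G : DTree d m}
    (hG : G.Nontrivial) : G.bound E (G.threshold E M) = M := by
  rw [bound, threshold, div_div_cancel₀ (G.weight_pos hE).ne', one_div,
    Real.pow_rpow_inv_natCast hM.le hG.count_pos.ne']

theorem prod_threshold_div {E : Fin m → ℝ} (hE : ∀ j, 0 < E j) {c : ℝ} (hc : 0 < c)
    (G : Fin d → DTree d m) :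
    (∏ k, (G k).threshold E ((node G).bound E c)) / c = (node G).bound E c := by
  have hM := bound_pos hE hc (node G)
  have h := bound_pow_count hE hc (nontrivial_node G)
  set M := (node G).bound E c
  rw [count_node, pow_succ, weight_node, eq_div_iff hc.ne'] at h
  simp only [threshold, Finset.prod_div_distrib, Finset.prod_pow_eq_pow_sum]
  rw [← h]
  field_simp

end DTree

namespace DTree

variable {d m' : ℕ}

/-- The derived function of a nontrivial tree, and zero for a trivial one. -/
noncomputable def derivOrZero {m : ℕ} (π : Fin m → (Fin d → ℝ) → ℝ) :
    DTree d m → (Fin d → ℝ) → ℝ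
  | leaf _ => 0
  | node G => (node G).deriv π

theorem Nontrivial.derivOrZero_eq {m : ℕ} {π : Fin m → (Fin d → ℝ) → ℝ} {G : DTree d m}
    (hG : G.Nontrivial) : G.derivOrZero π = G.deriv π := by
  cases G with
  | leaf i => exact absurd rfl (hG i)
  | node G => rfl

theorem analyticOnNhd_derivOrZero {m : ℕ} {π : Fin m → (Fin d → ℝ) → ℝ} {K : Set (Fin d → ℝ)}
    (hπ : ∀ j, AnalyticOnNhd ℝ (π j) K) (G : DTree d m) :
    AnalyticOnNhd ℝ (G.derivOrZero π) K := by
  cases G with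
  | leaf i => exact fun x _ => analyticAt_const
  | node G => exact analyticOnNhd_deriv hπ (node G)

theorem exists_norm_setIntegral_le {π : Fin (m' + 1) → (Fin d → ℝ) → ℝ} {ρ : (Fin d → ℝ) → ℝ}
    {r : ℝ} {K : Set (Fin d → ℝ)} (hK : IsCompact K) (hπ : ∀ j, AnalyticOnNhd ℝ (π j) K)
    (hρ : AnalyticOnNhd ℝ ρ K) (hr : 0 < r) (hρK : ∀ x, -r ≤ ρ x → x ∈ K)
    (G : DTree d (m' + 1)) (hG : G.Nontrivial) (κ : Type) [Fintype κ]
    (h : κ → (Fin d → ℝ) → ℝ) (hh : ∀ i, AnalyticOnNhd ℝ (h i) K) :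
    ∃ C : ℝ, 0 ≤ C ∧ ∀ (I : κ → Set ℝ) (E : Fin (m' + 1) → ℝ) (c lam : ℝ),
      (∀ i, IsUpperSet (I i)) → (∀ j, 0 < E j) → 0 < c → lam ≠ 0 → E (Fin.last m') = |lam|⁻¹ →
      (∀ x ∈ cell ρ h I, (∀ j : Fin m', |π j.castSucc x| ≤ E j.castSucc) ∧ c ≤ |G.deriv π x|) →
      ‖∫ x in cell ρ h I, Complex.exp (Complex.I * lam * π (Fin.last m') x)‖ ≤
        C * G.bound E c := by
  induction G generalizing κ with
  | leaf i => exact absurd rfl (hG i)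
  | node G ih =>
    let f : Fin d → (Fin d → ℝ) → ℝ := fun k => (G k).deriv π
    have hf : ∀ k, AnalyticOnNhd ℝ (f k) K := fun k => analyticOnNhd_deriv hπ (G k)
    let q : Fin d → (Fin d → ℝ) → ℝ := fun k => (G k).derivOrZero π
    have hq : ∀ k, AnalyticOnNhd ℝ (q k) K := fun k => analyticOnNhd_derivOrZero hπ (G k)
    let g : κ ⊕ (Fin d ⊕ Fin d) → (Fin d → ℝ) → ℝ := Sum.elim h (Sum.elim q (-q))
    have hg : ∀ i, AnalyticOnNhd ℝ (g i) K := by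
      rintro (i | k | k)
      exacts [hh i, hq k, (hq k).neg]
    have ih' : ∀ k, ∃ C : ℝ, 0 ≤ C ∧ ((G k).Nontrivial →
        ∀ (I : κ ⊕ (Fin d ⊕ Fin d) → Set ℝ) (E : Fin (m' + 1) → ℝ) (c lam : ℝ),
        (∀ i, IsUpperSet (I i)) → (∀ j, 0 < E j) → 0 < c → lam ≠ 0 →
        E (Fin.last m') = |lam|⁻¹ →
        (∀ x ∈ cell ρ g I, (∀ j : Fin m', |π j.castSucc x| ≤ E j.castSucc) ∧
          c ≤ |(G k).deriv π x|) →
        ‖∫ x in cell ρ g I, Complex.exp (Complex.I * lam * π (Fin.last m') x)‖ ≤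
          C * (G k).bound E c) := by
      intro k
      by_cases hk : (G k).Nontrivial
      · obtain ⟨C, hC, hCb⟩ := ih k hk _ g hg
        exact ⟨C, hC, fun _ => hCb⟩
      · exact ⟨0, le_rfl, fun hk' => absurd hk' hk⟩
    choose C₁ hC₁ hC₁b using ih'
    obtain ⟨C₂, hC₂, hC₂b⟩ := exists_measureReal_le hK hf
    choose C₃ hC₃ hC₃b using fun k => exists_norm_setIntegral_cexp_le hK hf hg hρ hr hρK k
    have hs₁ : 0 ≤ ∑ k, C₁ k := Finset.sum_nonneg fun k _ => hC₁ k
    have hs₃ : 0 ≤ ∑ k, C₃ k := Finset.sum_nonneg fun k _ => hC₃ k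
    have hle₁ : ∀ k, C₁ k ≤ ∑ k, C₁ k := fun k =>
      Finset.single_le_sum (fun k _ => hC₁ k) (Finset.mem_univ k)
    have hle₃ : ∀ k, C₃ k ≤ ∑ k, C₃ k := fun k =>
      Finset.single_le_sum (fun k _ => hC₃ k) (Finset.mem_univ k)
    refine ⟨Fintype.card (Fin d → SignType) * (∑ k, C₁ k + C₂ + ∑ k, C₃ k), by positivity,
      fun I E c lam hI hE hc hlam hElam hS => ?_⟩
    have hM : 0 < (node G).bound E c := bound_pos hE hc _
    have hMprod := prod_threshold_div hE hc G
    set M := (node G).bound E c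
    let δ : Fin d → ℝ := fun k => (G k).threshold E M
    have hδ : ∀ k, 0 < δ k := fun k => threshold_pos hE hM _
    have hρK' : ∀ x, 0 ≤ ρ x → x ∈ K := fun x hx => hρK x (by linarith)
    have hcm : ∀ p : Fin d → SignType,
        MeasurableSet (cell ρ h I ∩ (fun x k => thresholdSign (δ k) (q k x)) ⁻¹' {p}) := by
      intro p
      rw [cell_inter_thresholdSign fun k => (hδ k).le]
      exact measurableSet_cell hK.isClosed.measurableSet hρ.continuousOn
        (fun i => (hg i).continuousOn) hρK' fun i =>
          (isUpperSet_elim_signRay hI p i).ordConnected.measurableSet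
    have hint : IntegrableOn (fun x => Complex.exp (Complex.I * lam * π (Fin.last m') x))
        (cell ρ h I) := by
      refine (ContinuousOn.integrableOn_compact hK ?_).mono_set fun x hx => hρK' x hx.1
      have := (hπ (Fin.last m')).continuousOn
      fun_prop
    refine (norm_setIntegral_le_sum_preimage _ hcm hint).trans ?_
    rw [mul_assoc, ← nsmul_eq_mul, ← Finset.card_univ]
    refine Finset.sum_le_card_nsmul _ _ _ fun p _ => ?_
    have hpiece := hcm p
    rw [cell_inter_thresholdSign fun k => (hδ k).le] at hpiece ⊢
    set J : κ ⊕ (Fin d ⊕ Fin d) → Set ℝ := Sum.elim I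
      (Sum.elim (fun k => signRay (δ k) (p k)) fun k => signRay (δ k) (-p k)) with hJ
    have hJu : ∀ i, IsUpperSet (J i) := isUpperSet_elim_signRay hI p
    have hmem : ∀ x ∈ cell ρ g J, x ∈ cell ρ h I ∧ ∀ k, thresholdSign (δ k) (q k x) = p k := by
      intro x hx
      rw [← cell_inter_thresholdSign fun k => (hδ k).le] at hx
      exact ⟨hx.1, fun k => congrFun hx.2 k⟩
    have hempty : cell ρ g J = ∅ →
        ‖∫ x in cell ρ g J, Complex.exp (Complex.I * lam * π (Fin.last m') x)‖ ≤
          (∑ k, C₁ k + C₂ + ∑ k, C₃ k) * M := by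
      intro he
      rw [he, setIntegral_empty, norm_zero]
      positivity
    by_cases hp : ∃ k, p k ≠ 0
    · obtain ⟨k, hk⟩ := hp
      by_cases hGk : (G k).Nontrivial
      · refine (hC₁b k hGk J E (δ k) lam hJu hE (hδ k) hlam hElam fun x hx => ?_).trans ?_
        · obtain ⟨hx1, hx2⟩ := hmem x hx
          refine ⟨(hS x hx1).1, ?_⟩
          rw [← hGk.derivOrZero_eq]
          refine (not_le.1 fun hle => hk ?_).le
          rw [← hx2 k]
          exact (thresholdSign_eq_zero_iff (hδ k).le).2 hle
        · rw [bound_threshold hE hM hGk]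
          exact mul_le_mul_of_nonneg_right (by linarith [hle₁ k]) hM.le
      · refine hempty (Set.eq_empty_of_forall_notMem fun x hx => hk ?_)
        rw [← (hmem x hx).2 k, thresholdSign_eq_zero_iff (hδ k).le]
        simp only [Nontrivial, not_forall, not_not] at hGk
        obtain ⟨i, hi⟩ := hGk
        simp only [q, hi, derivOrZero, Pi.zero_apply, abs_zero]
        exact (hδ k).le
    simp only [not_exists, not_not] at hp
    have hsmall : ∀ x ∈ cell ρ g J, ∀ k, G k ≠ leaf (Fin.last m') → |f k x| ≤ δ k := by
      intro x hx k hk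
      obtain ⟨hx1, hx2⟩ := hmem x hx
      by_cases hGk : (G k).Nontrivial
      · have := hx2 k
        rw [hp k, thresholdSign_eq_zero_iff (hδ k).le] at this
        simpa only [q, hGk.derivOrZero_eq] using this
      · simp only [Nontrivial, not_forall, not_not] at hGk
        obtain ⟨i, hi⟩ := hGk
        simp only [f, δ, hi, deriv_leaf, threshold_leaf]
        obtain ⟨j, rfl⟩ | rfl := i.eq_castSucc_or_eq_last
        · exact (hS x hx1).1 j
        · exact absurd hi hk
    by_cases hlast : ∃ k, G k = leaf (Fin.last m')
    swap
    · simp only [not_exists] at hlast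
      have hvol := hC₂b δ c (fun k => (hδ k).le) hc (cell ρ g J) (fun x hx => hρK' x hx.1) hpiece
        fun x hx => ⟨fun k => hsmall x hx k (hlast k), (hS x (hmem x hx).1).2⟩
      refine (norm_setIntegral_le_of_norm_le_const (C := 1)
        ((measure_mono fun x hx => hρK' x hx.1).trans_lt hK.measure_lt_top) fun x _ => ?_).trans ?_
      · rw [mul_assoc, ← Complex.ofReal_mul, Complex.norm_exp_I_mul_ofReal]
      · rw [one_mul]
        refine hvol.trans ?_
        rw [hMprod]
        exact mul_le_mul_of_nonneg_right (by linarith) hM.le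
    obtain ⟨k, hk⟩ := hlast
    by_cases huniq : ∃ l ≠ k, G l = leaf (Fin.last m')
    · obtain ⟨l, hlk, hl⟩ := huniq
      refine hempty (Set.eq_empty_of_forall_notMem fun x hx => ?_)
      have h0 : (node G).deriv π x = 0 := by
        rw [deriv_node]
        refine Matrix.det_zero_of_column_eq hlk fun i => ?_
        simp only [Matrix.of_apply, hl, hk]
      have := (hS x (hmem x hx).1).2
      rw [h0, abs_zero] at this
      linarith
    · simp only [not_exists, not_and] at huniq
      have hfk : f k = π (Fin.last m') := by simp only [f, hk, deriv_leaf]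
      have := hC₃b k J δ c lam hJu hδ hc hlam fun x hx =>
        ⟨fun j hj => hsmall x hx j (huniq j hj), (hS x (hmem x hx).1).2⟩
      rw [hfk] at this
      refine this.trans ?_
      have hδk : |lam|⁻¹ = δ k := by simp only [δ, hk, threshold_leaf, hElam]
      rw [hδk, ← mul_div_assoc, Finset.mul_prod_erase _ _ (Finset.mem_univ k), hMprod]
      exact mul_le_mul_of_nonneg_right (by linarith [hle₃ k]) hM.le

end DTree

theorem thresholdSign_zero_eq_one_iff {s : ℝ} : thresholdSign 0 s = 1 ↔ 0 < s := by
  rw [thresholdSign_eq_iff le_rfl]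
  change (s ∈ Set.Ioi 0 ∧ -s ∈ Set.univ) ↔ _
  simp

theorem thresholdSign_zero_eq_zero_iff {s : ℝ} : thresholdSign 0 s = 0 ↔ s = 0 := by
  rw [thresholdSign_eq_zero_iff le_rfl, abs_nonpos_iff]

/-- Near a closed Euclidean ball, membership in a semi-analytic set is determined by the signs of
finitely many analytic functions. -/
theorem IsSemianalytic.exists_sign {d : ℕ} {U D : Set (Fin d → ℝ)} (hD : IsSemianalytic U D) :
    ∃ (α : Type) (_ : Fintype α) (q : α → (Fin d → ℝ) → ℝ) (P : Set (α → SignType)),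
      (∀ a, AnalyticOnNhd ℝ (q a) U) ∧
      ∀ x ∈ U, x ∈ D ↔ (fun a => thresholdSign 0 (q a x)) ∈ P := by
  obtain ⟨n, k, l, f, g, hf, hg, rfl⟩ := hD
  refine ⟨(Σ i, Fin (k i)) ⊕ (Σ i, Fin (l i)), inferInstance,
    Sum.elim (fun a => f a.1 a.2) (fun a => g a.1 a.2),
    {p | ∃ i, (∀ j, p (Sum.inl ⟨i, j⟩) = 0) ∧ ∀ j, p (Sum.inr ⟨i, j⟩) = 1}, ?_, fun x hx => ?_⟩
  · rintro (a | a)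
    exacts [hf _ _, hg _ _]
  · simp only [Set.mem_iUnion, Set.mem_ofPred_eq, hx, true_and, Sum.elim_inl, Sum.elim_inr,
      thresholdSign_zero_eq_zero_iff, thresholdSign_zero_eq_one_iff]

section

variable {d : ℕ} (x₀ : Fin d → ℝ) (R : ℝ)

theorem isCompact_setOf_sum_sq_le :
    IsCompact {x : Fin d → ℝ | ∑ i, (x i - x₀ i) ^ 2 ≤ R} := by
  refine (isCompact_closedBall x₀ (Real.sqrt R)).of_isClosed_subset
    (isClosed_le (by fun_prop) continuous_const) fun x hx => ?_
  rw [mem_closedBall, dist_pi_le_iff (Real.sqrt_nonneg R)]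
  intro i
  rw [Real.dist_eq]
  exact Real.abs_le_sqrt ((Finset.single_le_sum (f := fun i => (x i - x₀ i) ^ 2)
    (fun i _ => sq_nonneg _) (Finset.mem_univ i)).trans hx)

theorem exists_setOf_sum_sq_le_add_subset {U : Set (Fin d → ℝ)} (hU : IsOpen U)
    (hR : {x : Fin d → ℝ | ∑ i, (x i - x₀ i) ^ 2 ≤ R} ⊆ U) :
    ∃ r > 0, {x : Fin d → ℝ | ∑ i, (x i - x₀ i) ^ 2 ≤ R + r} ⊆ U := by
  have hlim : ∀ x : Fin d → ℝ, (∀ n : ℕ, ∑ i, (x i - x₀ i) ^ 2 ≤ R + 1 / ((n : ℝ) + 1)) →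
      ∑ i, (x i - x₀ i) ^ 2 ≤ R := fun x hx => by
    have := (tendsto_one_div_add_atTop_nhds_zero_nat (𝕜 := ℝ)).const_add R
    rw [add_zero] at this
    exact ge_of_tendsto' this hx
  obtain ⟨n, hn⟩ := exists_subset_nhds_of_isCompact'
    (V := fun n : ℕ => {x : Fin d → ℝ | ∑ i, (x i - x₀ i) ^ 2 ≤ R + 1 / ((n : ℝ) + 1)})
    (directed_of_isDirected_le fun n m hnm x hx => hx.trans <|
      add_le_add_right (Nat.one_div_le_one_div hnm) R)
    (fun n => isCompact_setOf_sum_sq_le x₀ _) (fun n => (isCompact_setOf_sum_sq_le x₀ _).isClosed)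
    (U := U) fun x hx => hU.mem_nhds (hR (hlim x (Set.mem_iInter.1 hx)))
  exact ⟨_, Nat.one_div_pos_of_nat, hn⟩

end

theorem DTree.bound_snoc {d m' : ℕ} (G : DTree d (m' + 1)) {ε : Fin m' → ℝ} (hε : ∀ j, 0 < ε j)
    {lam c : ℝ} (hlam : lam ≠ 0) (hc : 0 < c) :
    G.bound (Fin.snoc (α := fun _ => ℝ) ε |lam|⁻¹) c = c ^ (-(1 : ℝ) / (G.count : ℝ)) *
      |lam| ^ (-(G.mult (Fin.last m') : ℝ) / (G.count : ℝ)) *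
      ∏ j : Fin m', ε j ^ ((G.mult j.castSucc : ℝ) / (G.count : ℝ)) := by
  have hl : 0 < |lam| := abs_pos.2 hlam
  rw [bound, weight, Fin.prod_univ_castSucc]
  simp only [Fin.snoc_castSucc, Fin.snoc_last]
  rw [Real.div_rpow (mul_nonneg (Finset.prod_nonneg fun j _ => pow_nonneg (hε j).le _)
      (by positivity)) hc.le, Real.mul_rpow (Finset.prod_nonneg fun j _ => pow_nonneg (hε j).le _)
      (by positivity), ← Real.finsetProd_rpow _ _ fun j _ => pow_nonneg (hε j).le _]
  have h1 : ∀ (y : ℝ) (k : ℕ), 0 ≤ y →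
      (y ^ k) ^ (1 / (G.count : ℝ)) = y ^ ((k : ℝ) / (G.count : ℝ)) := fun y k hy => by
    rw [← Real.rpow_natCast, ← Real.rpow_mul hy, mul_one_div]
  rw [h1 _ _ (by positivity), Finset.prod_congr rfl fun j _ => h1 (ε j) _ (hε j).le,
    Real.inv_rpow hl.le, neg_div, neg_div, Real.rpow_neg hl.le, Real.rpow_neg hc.le]
  ring

end

/-- The main oscillatory integral theorem (Theorem 5 of the paper), Euclidean
real-analytic case, on a closed Euclidean ball: the phase is `π_m` (the last of the `m'+1`
functions, `m = m'+1`), and the sublevel parameters `ε_1,…,ε_{m-1}` constrain the remaining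
functions. -/
theorem oscillatory_estimate_dtree
    (d m' : ℕ) (hd : 1 ≤ d) (x₀ : Fin d → ℝ) (R : ℝ) (hR : 0 < R)
    (U : Set (Fin d → ℝ)) (hUopen : IsOpen U) (hUconn : IsConnected U)
    (hBU : {x : Fin d → ℝ | ∑ i, (x i - x₀ i) ^ 2 ≤ R ^ 2} ⊆ U)
    (π : Fin (m' + 1) → (Fin d → ℝ) → ℝ) (hπ : ∀ j, AnalyticOnNhd ℝ (π j) U)
    (D : Set (Fin d → ℝ)) (hD : D ⊆ {x : Fin d → ℝ | ∑ i, (x i - x₀ i) ^ 2 ≤ R ^ 2})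
    (hDsa : IsSemianalytic U D)
    (G : DTree d (m' + 1)) (hG : G.Nontrivial) :
    ∃ C : ℝ, ∀ ε : Fin m' → ℝ, (∀ j, 0 < ε j) → ∀ lam : ℝ, lam ≠ 0 → ∀ c : ℝ, 0 < c →
      (∀ x ∈ {x ∈ {x : Fin d → ℝ | ∑ i, (x i - x₀ i) ^ 2 ≤ R ^ 2} |
          ∀ j : Fin m', |π j.castSucc x| ≤ ε j} ∩ D, c ≤ |G.deriv π x|) →
      ‖∫ x in {x ∈ {x : Fin d → ℝ | ∑ i, (x i - x₀ i) ^ 2 ≤ R ^ 2} |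
            ∀ j : Fin m', |π j.castSucc x| ≤ ε j} ∩ D,
          Complex.exp (Complex.I * lam * π (Fin.last m') x)‖ ≤
        C * c ^ (-(1 : ℝ) / (G.count : ℝ)) *
          |lam| ^ (-(G.mult (Fin.last m') : ℝ) / (G.count : ℝ)) *
          ∏ j : Fin m', ε j ^ ((G.mult j.castSucc : ℝ) / (G.count : ℝ)) := by
  classical
  obtain ⟨r, hr, hrU⟩ := exists_setOf_sum_sq_le_add_subset x₀ (R ^ 2) hUopen hBU
  set B : Set (Fin d → ℝ) := {x | ∑ i, (x i - x₀ i) ^ 2 ≤ R ^ 2} with hB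
  set K : Set (Fin d → ℝ) := {x | ∑ i, (x i - x₀ i) ^ 2 ≤ R ^ 2 + r}
  have hK : IsCompact K := isCompact_setOf_sum_sq_le x₀ _
  let ρ : (Fin d → ℝ) → ℝ := fun x => R ^ 2 - ∑ i, (x i - x₀ i) ^ 2
  have hρ : AnalyticOnNhd ℝ ρ K := fun x _ => by
    refine analyticAt_const.fun_sub (Finset.analyticAt_fun_sum _ fun i _ => ?_)
    exact (((ContinuousLinearMap.proj (R := ℝ) (φ := fun _ : Fin d => ℝ) i).analyticAt x).fun_sub
      analyticAt_const).fun_pow 2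
  have hρK : ∀ x, -r ≤ ρ x → x ∈ K := fun x hx => by
    simp only [ρ] at hx
    change ∑ i, (x i - x₀ i) ^ 2 ≤ R ^ 2 + r
    linarith
  have hπK : ∀ j, AnalyticOnNhd ℝ (π j) K := fun j => (hπ j).mono hrU
  obtain ⟨α, _, q, P, hq, hqP⟩ := hDsa.exists_sign
  let h : Fin m' ⊕ Fin m' → (Fin d → ℝ) → ℝ :=
    Sum.elim (fun j => π j.castSucc) fun j => -π j.castSucc
  have hh : ∀ i, AnalyticOnNhd ℝ (h i) K := by
    rintro (j | j)
    exacts [hπK _, (hπK _).neg]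
  let g : (Fin m' ⊕ Fin m') ⊕ (α ⊕ α) → (Fin d → ℝ) → ℝ := Sum.elim h (Sum.elim q (-q))
  have hg : ∀ i, AnalyticOnNhd ℝ (g i) K := by
    rintro (i | a | a)
    exacts [hh i, (hq a).mono hrU, ((hq a).mono hrU).neg]
  obtain ⟨C, hC, hCb⟩ := G.exists_norm_setIntegral_le hK hπK hρ hr hρK hG _ g hg
  refine ⟨Fintype.card (α → SignType) * C, fun ε hε lam hlam c hc hS => ?_⟩
  have hE : ∀ j, 0 < Fin.snoc (α := fun _ => ℝ) ε |lam|⁻¹ j := by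
    refine Fin.lastCases ?_ fun j => ?_
    · rw [Fin.snoc_last]
      exact inv_pos.2 (abs_pos.2 hlam)
    · rw [Fin.snoc_castSucc]
      exact hε j
  rw [mul_assoc (_ * _), mul_assoc (_ * _), ← mul_assoc (c ^ _), ← G.bound_snoc hε hlam hc]
  have hM : 0 < G.bound (Fin.snoc (α := fun _ => ℝ) ε |lam|⁻¹) c := DTree.bound_pos hE hc G
  set M := G.bound (Fin.snoc (α := fun _ => ℝ) ε |lam|⁻¹) c
  let I : Fin m' ⊕ Fin m' → Set ℝ := fun i => Set.Ici (-ε (i.elim id id))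
  have hI : ∀ i, IsUpperSet (I i) := fun i => isUpperSet_Ici _
  set S : Set (Fin d → ℝ) := {x ∈ B | ∀ j : Fin m', |π j.castSucc x| ≤ ε j} ∩ D with hSdef
  have hcell : {x ∈ B | ∀ j : Fin m', |π j.castSucc x| ≤ ε j} = cell ρ h I := by
    ext x
    simp only [cell, hB, Set.mem_ofPred_eq, ρ, sub_nonneg, Sum.forall, h, I, Sum.elim_inl,
      Sum.elim_inr, Set.mem_Ici, id, abs_le, Pi.neg_apply, neg_le_neg_iff, forall_and]
  have hpiece : ∀ p, S ∩ (fun x a => thresholdSign 0 (q a x)) ⁻¹' {p} = ∅ ∨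
      S ∩ (fun x a => thresholdSign 0 (q a x)) ⁻¹' {p} =
        cell ρ g (Sum.elim I (Sum.elim (fun a => signRay 0 (p a)) fun a => signRay 0 (-p a))) := by
    intro p
    rw [← cell_inter_thresholdSign (δ := fun _ : α => 0) (fun _ => le_rfl) p, ← hcell, hSdef]
    by_cases hp : p ∈ P
    · right
      ext x
      refine ⟨fun hx => ⟨hx.1.1, hx.2⟩, fun hx => ⟨⟨hx.1, (hqP x (hBU hx.1.1)).2 ?_⟩, hx.2⟩⟩
      have := Set.mem_singleton_iff.1 hx.2
      simpa only [this] using hp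
    · left
      refine Set.eq_empty_of_forall_notMem fun x hx => hp ?_
      have := Set.mem_singleton_iff.1 hx.2
      rw [← this]
      exact (hqP x (hBU hx.1.1.1)).1 hx.1.2
  have hint : IntegrableOn (fun x => Complex.exp (Complex.I * lam * π (Fin.last m') x)) S := by
    refine (ContinuousOn.integrableOn_compact hK ?_).mono_set fun x hx =>
      hx.1.1.trans (le_add_of_nonneg_right hr.le)
    have := (hπK (Fin.last m')).continuousOn
    fun_prop
  refine (norm_setIntegral_le_sum_preimage (fun x a => thresholdSign 0 (q a x)) (fun p => ?_)
    hint).trans ?_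
  · rcases hpiece p with hp | hp <;> rw [hp]
    · exact MeasurableSet.empty
    · exact measurableSet_cell hK.isClosed.measurableSet hρ.continuousOn
        (fun i => (hg i).continuousOn) (fun x hx => hρK x (by linarith)) fun i =>
          (isUpperSet_elim_signRay hI p i).ordConnected.measurableSet
  · rw [mul_assoc, ← nsmul_eq_mul, ← Finset.card_univ]
    refine Finset.sum_le_card_nsmul _ _ _ fun p _ => ?_
    rcases hpiece p with hp | hp
    · rw [hp, setIntegral_empty, norm_zero]
      positivity
    · rw [hp]
      refine hCb _ _ c lam (isUpperSet_elim_signRay hI p) hE hc hlam (Fin.snoc_last _ _)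
        fun x hx => ?_
      rw [← hp] at hx
      refine ⟨fun j => ?_, hS x hx.1⟩
      rw [Fin.snoc_castSucc]
      exact hx.1.1.2 j
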